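/- Let Ω be a smoothly bounded pseudoconvex domain in ℂ^n with n > 1, and write the Green function of Ω as G(z,ζ) = −c_n/|z−ζ|^{2n−2} + ψ(z,ζ), where ψ(z,·) is harmonic. Let Λ(z) = ψ(z,z) be the Robin function of Ω. Then log Λ is plurisubharmonic on Ω. -/

import Mathlib

open MeasureTheory Filter Set Metric Complex
open scoped ENNReal NNReal Topology

noncomputable section

namespace Berndtsson

instance (n : ℕ) : MeasurableSpace (EuclideanSpace ℂ (Fin n)) := borel _
instance (n : ℕ) : BorelSpace (EuclideanSpace ℂ (Fin n)) := ⟨rfl⟩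
instance (n : ℕ) : MeasureSpace (EuclideanSpace ℂ (Fin n)) :=
  ⟨Measure.map (EuclideanSpace.equiv (Fin n) ℂ).symm volume⟩

abbrev Cn (n : ℕ) := EuclideanSpace ℂ (Fin n)

/-- A function `f`, with values in `EReal`, is plurisubharmonic on `s` if it is upper
semicontinuous on `s` and satisfies the sub-mean value inequality on every complex circle
whose corresponding closed disk is contained in `s` (formulated via continuous majorants,
which for upper semicontinuous integrands is equivalent to the upper-integral form). -/
def PlurisubharmonicOn {E : Type*} [NormedAddCommGroup E] [NormedSpace ℂ E]
    (f : E → EReal) (s : Set E) : Prop :=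
  UpperSemicontinuousOn f s ∧
    ∀ z ∈ s, ∀ w : E, ∀ r : ℝ, 0 < r →
      (∀ l : ℂ, ‖l‖ ≤ r → z + l • w ∈ s) →
      ∀ h : ℝ → ℝ, Continuous h →
        (∀ θ : ℝ, f (z + ((r : ℂ) * Complex.exp (θ * Complex.I)) • w) ≤ (h θ : EReal)) →
        f z ≤ (((2 * Real.pi)⁻¹ * ∫ θ in (0:ℝ)..(2 * Real.pi), h θ : ℝ) : EReal)

/-- Plurisubharmonicity for real-valued functions. -/
def PshOn {E : Type*} [NormedAddCommGroup E] [NormedSpace ℂ E] (f : E → ℝ) (s : Set E) : Prop :=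
  PlurisubharmonicOn (fun z => (f z : EReal)) s

/-- A pseudoconvex domain: an open set admitting a plurisubharmonic exhaustion function. -/
def Pseudoconvex {E : Type*} [NormedAddCommGroup E] [NormedSpace ℂ E] (D : Set E) : Prop :=
  IsOpen D ∧ ∃ u : E → ℝ, PshOn u D ∧ ∀ c : ℝ, IsCompact {z ∈ D | u z ≤ c}

/-- `log` with values in `EReal`, sending nonpositive reals to `⊥`. -/
def elog (x : ℝ) : EReal := if 0 < x then ((Real.log x : ℝ) : EReal) else ⊥

/-- Membership in the weighted Bergman space `A²(Ω, e^{-φ})`. -/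
def MemA2 {n : ℕ} (Ω : Set (Cn n)) (φ : Cn n → ℝ) (h : Cn n → ℂ) : Prop :=
  DifferentiableOn ℂ h Ω ∧
    IntegrableOn (fun ζ => ‖h ζ‖ ^ 2 * Real.exp (-φ ζ)) Ω volume

/-- `Kz` is the Bergman kernel of `A²(Ω, e^{-φ})` at the point `z`:
it belongs to the space and reproduces the value at `z` of every member. -/
def IsBergmanKernelAt {n : ℕ} (Ω : Set (Cn n)) (φ : Cn n → ℝ) (z : Cn n)
    (Kz : Cn n → ℂ) : Prop :=
  MemA2 Ω φ Kz ∧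
    ∀ h : Cn n → ℂ, MemA2 Ω φ h →
      ∫ ζ in Ω, h ζ * (starRingEnd ℂ) (Kz ζ) * (Real.exp (-φ ζ) : ℂ) = h z

/-- The Bergman kernel on the diagonal, via its extremal characterization
`K(z,z) = sup {|h(z)|² : h holomorphic on Ω, ∫_Ω |h|² e^{-φ} ≤ 1}`. -/
def bergmanDiag {n : ℕ} (Ω : Set (Cn n)) (φ : Cn n → ℝ) (z : Cn n) : ℝ :=
  sSup {v : ℝ | ∃ h : Cn n → ℂ, DifferentiableOn ℂ h Ω ∧
    IntegrableOn (fun ζ => ‖h ζ‖ ^ 2 * Real.exp (-φ ζ)) Ω volume ∧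
    (∫ ζ in Ω, ‖h ζ‖ ^ 2 * Real.exp (-φ ζ)) ≤ 1 ∧ v = ‖h z‖ ^ 2}

end Berndtsson

namespace Berndtsson

/-- The (real) Laplacian of a function on `ℂⁿ ≅ ℝ²ⁿ`. -/
def laplacianC {n : ℕ} (w : Cn n → ℝ) (ζ : Cn n) : ℝ :=
  ∑ j, (iteratedFDeriv ℝ 2 w ζ
      ![EuclideanSpace.single j 1, EuclideanSpace.single j 1] +
    iteratedFDeriv ℝ 2 w ζ
      ![EuclideanSpace.single j Complex.I, EuclideanSpace.single j Complex.I])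

/-- `G` is the Green function of `Ω` with pole at `z`. -/
def IsGreenFunction {n : ℕ} (Ω : Set (Cn n)) (z : Cn n) (G : Cn n → ℝ) : Prop :=
  ContinuousOn G (closure Ω \ {z}) ∧ (∀ ζ ∈ frontier Ω, G ζ = 0) ∧
    ∀ w : Cn n → ℝ, ContDiff ℝ (⊤ : ℕ∞) w → HasCompactSupport w → tsupport w ⊆ Ω →
      (∫ ζ in Ω, G ζ * laplacianC w ζ) = w z

/-- A smoothly bounded pseudoconvex domain in `ℂⁿ`. -/
def SmoothlyBoundedPseudoconvex (n : ℕ) (Ω : Set (Cn n)) : Prop :=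
  IsOpen Ω ∧ Bornology.IsBounded Ω ∧
    ∃ (r : Cn n → ℝ) (W : Set (Cn n)), IsOpen W ∧ closure Ω ⊆ W ∧
      ContDiffOn ℝ (⊤ : ℕ∞) r W ∧ PshOn r W ∧ Ω = {z ∈ W | r z < 0} ∧
      ∀ z ∈ frontier Ω, fderiv ℝ r z ≠ 0

local notation "𝒞" => ContDiffAt ℝ ((⊤ : ℕ∞) : WithTop ℕ∞)

section Calculus

section Directional

variable {E F : Type*} [NormedAddCommGroup E] [NormedSpace ℝ E]
  [NormedAddCommGroup F] [NormedSpace ℝ F]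

lemma two_le_smooth : (2 : WithTop ℕ∞) ≤ ((⊤ : ℕ∞) : WithTop ℕ∞) := by
  exact WithTop.coe_le_coe.2 (le_top : (2 : ℕ∞) ≤ ⊤)

/-- Directional derivative. -/
def pd (v : E) (u : E → F) (x : E) : F := fderiv ℝ u x v

/-- Second derivative as a bilinear map. -/
def hess (u : E → F) (x : E) : E →L[ℝ] E →L[ℝ] F := fderiv ℝ (fderiv ℝ u) x

lemma sm_ev {u : E → F} {x : E} (h : 𝒞 u x) : ∀ᶠ y in 𝓝 x, DifferentiableAt ℝ u y := by
  have : ContDiffAt ℝ 1 u x := h.of_le (by exact_mod_cast le_top)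
  exact (this.eventually (by simp)).mono fun y hy => hy.differentiableAt one_ne_zero

lemma sm_diff {u : E → F} {x : E} (h : 𝒞 u x) : DifferentiableAt ℝ u x :=
  (sm_ev h).self_of_nhds

lemma sm_fderiv {u : E → F} {x : E} (h : 𝒞 u x) : 𝒞 (fderiv ℝ u) x :=
  h.fderiv_right (by norm_cast)

lemma sm_pd {u : E → F} {x : E} (h : 𝒞 u x) (v : E) : 𝒞 (pd v u) x :=
  (sm_fderiv h).clm_apply contDiffAt_const

lemma sm_hess {u : E → F} {x : E} (h : 𝒞 u x) : 𝒞 (hess u) x := sm_fderiv (sm_fderiv h)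

lemma pd_congr {u w : E → F} {x : E} (h : u =ᶠ[𝓝 x] w) (v : E) : pd v u x = pd v w x := by
  simp [pd, h.fderiv_eq]

lemma pd_congr_ev {u w : E → F} {x : E} (h : u =ᶠ[𝓝 x] w) (v : E) : pd v u =ᶠ[𝓝 x] pd v w :=
  (h.fderiv (𝕜 := ℝ)).mono fun y hy => by simp only [pd, hy]

lemma pd_const (v : E) (a : F) : pd v (fun _ : E => a) = 0 := by
  ext x; simp [pd]

lemma pd_add {u w : E → F} {x : E} (hu : DifferentiableAt ℝ u x) (hw : DifferentiableAt ℝ w x)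
    (v : E) : pd v (fun y => u y + w y) x = pd v u x + pd v w x := by
  simp [pd, fderiv_fun_add hu hw]

lemma pd_sub {u w : E → F} {x : E} (hu : DifferentiableAt ℝ u x) (hw : DifferentiableAt ℝ w x)
    (v : E) : pd v (fun y => u y - w y) x = pd v u x - pd v w x := by
  simp [pd, fderiv_fun_sub hu hw]

lemma pd_neg {u : E → F} {x : E} (v : E) : pd v (fun y => - u y) x = - pd v u x := by
  simp [pd, fderiv_fun_neg]

lemma pd_const_mul {u : E → ℝ} {x : E} (v : E) (a : ℝ) (hu : DifferentiableAt ℝ u x) :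
    pd v (fun y => a * u y) x = a * pd v u x := by
  simp [pd, fderiv_const_mul hu]

lemma pd_mul {u w : E → ℝ} {x : E} (hu : DifferentiableAt ℝ u x) (hw : DifferentiableAt ℝ w x)
    (v : E) : pd v (fun y => u y * w y) x = u x * pd v w x + w x * pd v u x := by
  simp [pd, fderiv_fun_mul hu hw]

lemma pd_comp {u : E → ℝ} {φ : ℝ → ℝ} {x : E} (hφ : DifferentiableAt ℝ φ (u x))
    (hu : DifferentiableAt ℝ u x) (v : E) :
    pd v (fun y => φ (u y)) x = deriv φ (u x) * pd v u x := by
  have := (hφ.hasDerivAt.comp_hasFDerivAt x hu.hasFDerivAt).fderiv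
  simp only [pd]
  change fderiv ℝ (φ ∘ u) x v = _
  rw [this]; simp

lemma pd_pd {u : E → F} {x : E} (h : 𝒞 u x) (v w : E) : pd v (pd w u) x = hess u x v w := by
  change fderiv ℝ (fun y => fderiv ℝ u y w) x v = _
  rw [fderiv_clm_apply (sm_diff (sm_fderiv h)) (by fun_prop)]
  simp [hess]

lemma hess_symm {u : E → F} {x : E} (h : 𝒞 u x) (v w : E) : hess u x v w = hess u x w v :=
  (h.isSymmSndFDerivAt (by simpa using two_le_smooth)).eq v w

lemma pd_comm {u : E → F} {x : E} (h : 𝒞 u x) (v w : E) : pd v (pd w u) x = pd w (pd v u) x := by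
  rw [pd_pd h, pd_pd h, hess_symm h]

end Directional

variable {E F : Type*} [NormedAddCommGroup E] [InnerProductSpace ℝ E]
  [NormedAddCommGroup F] [NormedSpace ℝ F]
variable {ι : Type*} [Fintype ι] (b : OrthonormalBasis ι ℝ E)

/-- The Laplacian with respect to an orthonormal basis. -/
def Lap (u : E → ℝ) (x : E) : ℝ := ∑ i, pd (b i) (pd (b i) u) x

/-- The inner product of the gradients. -/
def gip (u w : E → ℝ) (x : E) : ℝ := ∑ i, pd (b i) u x * pd (b i) w x

lemma Lap_hess {u : E → ℝ} {x : E} (h : 𝒞 u x) : Lap b u x = ∑ i, hess u x (b i) (b i) :=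
  Finset.sum_congr rfl fun _ _ => pd_pd h _ _

lemma Lap_congr {u w : E → ℝ} {x : E} (h : u =ᶠ[𝓝 x] w) : Lap b u x = Lap b w x :=
  Finset.sum_congr rfl fun _ _ => pd_congr (pd_congr_ev h _) _

lemma Lap_congr_ev {u w : E → ℝ} {x : E} (h : u =ᶠ[𝓝 x] w) : Lap b u =ᶠ[𝓝 x] Lap b w :=
  h.eventuallyEq_nhds.mono fun _ hy => Lap_congr b hy

lemma sm_Lap {u : E → ℝ} {x : E} (h : 𝒞 u x) : 𝒞 (Lap b u) x :=
  ContDiffAt.sum fun _ _ => sm_pd (sm_pd h _) _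

lemma sm_gip {u w : E → ℝ} {x : E} (h : 𝒞 u x) (h' : 𝒞 w x) : 𝒞 (gip b u w) x :=
  ContDiffAt.sum fun _ _ => (sm_pd h _).mul (sm_pd h' _)

lemma Lap_add {u w : E → ℝ} {x : E} (hu : 𝒞 u x) (hw : 𝒞 w x) :
    Lap b (fun y => u y + w y) x = Lap b u x + Lap b w x := by
  simp only [Lap, ← Finset.sum_add_distrib]
  refine Finset.sum_congr rfl fun i _ => ?_
  rw [← pd_add (sm_diff (sm_pd hu _)) (sm_diff (sm_pd hw _))]
  refine pd_congr ?_ _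
  filter_upwards [sm_ev hu, sm_ev hw] with y h1 h2 using pd_add h1 h2 _

lemma Lap_const_mul {u : E → ℝ} {x : E} (hu : 𝒞 u x) (a : ℝ) :
    Lap b (fun y => a * u y) x = a * Lap b u x := by
  simp only [Lap, Finset.mul_sum]
  refine Finset.sum_congr rfl fun i _ => ?_
  rw [← pd_const_mul _ _ (sm_diff (sm_pd hu _))]
  refine pd_congr ?_ _
  filter_upwards [sm_ev hu] with y h1 using pd_const_mul _ _ h1

lemma Lap_neg {u : E → ℝ} {x : E} (hu : 𝒞 u x) :
    Lap b (fun y => - u y) x = - Lap b u x := by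
  simpa using Lap_const_mul b hu (-1)

lemma Lap_sub {u w : E → ℝ} {x : E} (hu : 𝒞 u x) (hw : 𝒞 w x) :
    Lap b (fun y => u y - w y) x = Lap b u x - Lap b w x := by
  simp only [sub_eq_add_neg]
  rw [Lap_add b hu hw.neg, Lap_neg b hw]

lemma Lap_const (a : ℝ) (x : E) : Lap b (fun _ => a) x = 0 := by
  simp only [Lap, pd_const]
  exact Finset.sum_eq_zero fun i _ => by simp [pd]

lemma Lap_sum {κ : Type*} (s : Finset κ) {u : κ → E → ℝ} {x : E} (hu : ∀ k ∈ s, 𝒞 (u k) x) :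
    Lap b (fun y => ∑ k ∈ s, u k y) x = ∑ k ∈ s, Lap b (u k) x := by
  classical
  induction s using Finset.induction_on with
  | empty => simp [Lap_const]
  | insert k s hk ih =>
    simp only [Finset.sum_insert hk]
    rw [Lap_add b (hu k (by simp)) (ContDiffAt.sum fun j hj => hu j (by simp [hj])),
      ih fun j hj => hu j (by simp [hj])]

lemma Lap_mul {u w : E → ℝ} {x : E} (hu : 𝒞 u x) (hw : 𝒞 w x) :
    Lap b (fun y => u y * w y) x = u x * Lap b w x + 2 * gip b u w x + w x * Lap b u x := by
  simp only [Lap, gip, Finset.mul_sum, ← Finset.sum_add_distrib]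
  refine Finset.sum_congr rfl fun i _ => ?_
  have : pd (b i) (fun y => u y * w y) =ᶠ[𝓝 x]
      fun y => u y * pd (b i) w y + w y * pd (b i) u y := by
    filter_upwards [sm_ev hu, sm_ev hw] with y h1 h2 using pd_mul h1 h2 _
  have hu' := sm_diff hu
  have hw' := sm_diff hw
  have hu1 := sm_diff (sm_pd hu (b i))
  have hw1 := sm_diff (sm_pd hw (b i))
  rw [pd_congr this, pd_add (by fun_prop) (by fun_prop), pd_mul hu' hw1, pd_mul hw' hu1]
  ring

lemma Lap_comp {u : E → ℝ} {φ : ℝ → ℝ} {x : E} (hφ : 𝒞 φ (u x)) (hu : 𝒞 u x) :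
    Lap b (fun y => φ (u y)) x = deriv (deriv φ) (u x) * gip b u u x + deriv φ (u x) * Lap b u x := by
  simp only [Lap, gip, Finset.mul_sum, ← Finset.sum_add_distrib]
  refine Finset.sum_congr rfl fun i _ => ?_
  have hev : ∀ᶠ y in 𝓝 x, DifferentiableAt ℝ φ (u y) :=
    hu.continuousAt.eventually (sm_ev hφ)
  have : pd (b i) (fun y => φ (u y)) =ᶠ[𝓝 x] fun y => deriv φ (u y) * pd (b i) u y := by
    filter_upwards [sm_ev hu, hev] with y h1 h2 using pd_comp h2 h1 _
  have hd : DifferentiableAt ℝ (deriv φ) (u x) := by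
    have : deriv φ = pd 1 φ := by ext t; simp [pd]
    rw [this]; exact sm_diff (sm_pd hφ _)
  have hu' := sm_diff hu
  rw [pd_congr this, pd_mul (u := fun y => deriv φ (u y)) (hd.comp x hu') (sm_diff (sm_pd hu _)), pd_comp hd hu']
  ring

lemma Lap_pd {u : E → ℝ} {x : E} (hu : 𝒞 u x) (v : E) : Lap b (pd v u) x = pd v (Lap b u) x := by
  have h3 : ∀ᶠ y in 𝓝 x, ContDiffAt ℝ 2 u y :=
    (hu.of_le (m := 2) two_le_smooth).eventually (by simp)
  have : ∀ i, pd (b i) (pd v u) =ᶠ[𝓝 x] pd v (pd (b i) u) := by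
    intro i
    filter_upwards [h3] with y hy
    have hd : DifferentiableAt ℝ (fderiv ℝ u) y :=
      (hy.fderiv_right (m := 1) (by norm_num)).differentiableAt one_ne_zero
    change fderiv ℝ (fun y => fderiv ℝ u y v) y (b i) = fderiv ℝ (fun y => fderiv ℝ u y (b i)) y v
    rw [fderiv_clm_apply hd (by fun_prop), fderiv_clm_apply hd (by fun_prop)]
    simpa using (hy.isSymmSndFDerivAt (by simp)).eq (b i) v
  have hL : Lap b u = ∑ i, pd (b i) (pd (b i) u) := by ext; simp [Lap]
  rw [hL, pd, fderiv_sum fun i _ => sm_diff (sm_pd (sm_pd hu _) _)]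
  simp only [sum_apply, Lap]
  refine Finset.sum_congr rfl fun i _ => ?_
  rw [pd_congr (this i)]
  exact pd_comm (sm_pd hu _) _ _

lemma sm_scale {u : E → F} {x y : E} {ρ : ℝ} (hu : 𝒞 u (x + ρ • y)) :
    𝒞 (fun y => u (x + ρ • y)) y :=
  ContDiffAt.comp y (f := fun y => x + ρ • y) hu (by fun_prop)

lemma pd_scale {u : E → F} {x y : E} {ρ : ℝ} (hu : DifferentiableAt ℝ u (x + ρ • y)) (v : E) :
    pd v (fun y => u (x + ρ • y)) y = ρ • pd v u (x + ρ • y) := by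
  have h1 : HasFDerivAt (fun y : E => x + ρ • y) (ρ • ContinuousLinearMap.id ℝ E) y :=
    ((hasFDerivAt_id y).const_smul ρ).const_add x
  have := (hu.hasFDerivAt.comp y h1).fderiv
  simp only [pd]
  change fderiv ℝ (u ∘ fun y => x + ρ • y) y v = _
  rw [this]; simp

lemma Lap_scale {u : E → ℝ} {x y : E} {ρ : ℝ} (hu : 𝒞 u (x + ρ • y)) :
    Lap b (fun y => u (x + ρ • y)) y = ρ ^ 2 * Lap b u (x + ρ • y) := by
  simp only [Lap, Finset.mul_sum]
  refine Finset.sum_congr rfl fun i _ => ?_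
  have hc : ContinuousAt (fun y : E => x + ρ • y) y := by fun_prop
  have : pd (b i) (fun y => u (x + ρ • y)) =ᶠ[𝓝 y] fun y => ρ * pd (b i) u (x + ρ • y) := by
    filter_upwards [hc.eventually (sm_ev hu)] with y h1 using pd_scale h1 _
  rw [pd_congr this, pd_const_mul _ _ (sm_diff (sm_scale (sm_pd hu _))),
    pd_scale (sm_diff (sm_pd hu _))]
  simp; ring

lemma gip_self_nonneg (u : E → ℝ) (x : E) : 0 ≤ gip b u u x :=
  Finset.sum_nonneg fun _ _ => mul_self_nonneg _

lemma sum_inner_smul (x : E) : ∑ i, inner ℝ (b i) x • b i = x := b.sum_repr' x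

lemma pd_sq_norm (x v : E) : pd v (fun y : E => ‖y‖ ^ 2) x = 2 * inner ℝ x v := by
  simp only [pd]
  rw [fderiv_norm_sq_apply]; simp

lemma Lap_sq_norm (a x : E) : Lap b (fun y : E => ‖y - a‖ ^ 2) x = 2 * Fintype.card ι := by
  have h : ∀ i, pd (b i) (fun y : E => ‖y - a‖ ^ 2) = fun y => 2 * inner ℝ (y - a) (b i) := by
    intro i; ext y
    have := pd_scale (u := fun y : E => ‖y‖ ^ 2) (x := -a) (y := y) (ρ := 1)
      ((contDiff_norm_sq ℝ).differentiable one_ne_zero _) (b i)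
    rw [pd_sq_norm] at this
    simpa [neg_add_eq_sub] using this
  simp only [Lap, h]
  have : ∀ i, pd (b i) (fun y => 2 * inner ℝ (y - a) (b i)) x = 2 := by
    intro i
    simp only [pd]
    rw [fderiv_const_mul (DifferentiableAt.inner ℝ (by fun_prop) (by fun_prop))]
    have := fderiv_inner_apply ℝ (f := fun y : E => y - a) (g := fun _ => b i) (x := x)
      (by fun_prop) (by fun_prop) (b i)
    simp [this, fderiv_sub_const]
  simp [this]; ring

/-- The trace of a bilinear form does not depend on the orthonormal basis. -/
lemma sum_bilin_basis {κ : Type*} [Fintype κ] (b' : OrthonormalBasis κ ℝ E)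
    (A : E →L[ℝ] E →L[ℝ] ℝ) : ∑ i, A (b' i) (b' i) = ∑ i, A (b i) (b i) := by
  have h1 : ∀ i, A (b' i) (b' i) = ∑ j, inner ℝ (b j) (b' i) * A (b j) (b' i) := by
    intro i
    have := congrArg (fun v => A v (b' i)) (sum_inner_smul b (b' i))
    simpa using this.symm
  have h2 : ∀ j, A (b j) (b j) = ∑ i, inner ℝ (b' i) (b j) * A (b j) (b' i) := by
    intro j
    have := congrArg (fun v => A (b j) v) (sum_inner_smul b' (b j))
    simpa using this.symm
  simp only [h1, h2]
  rw [Finset.sum_comm]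
  simp only [real_inner_comm]

lemma sum_bilin_isometry (A : E →L[ℝ] E →L[ℝ] ℝ) (J : E ≃ₗᵢ[ℝ] E) :
    ∑ i, A (J (b i)) (J (b i)) = ∑ i, A (b i) (b i) := by
  simpa using sum_bilin_basis b (b.map J) A

lemma sum_bilin_J (A : E →L[ℝ] E →L[ℝ] ℝ) (J : E ≃ₗᵢ[ℝ] E) (hJ : ∀ x, J (J x) = -x) :
    ∑ i, A (b i) (J (b i)) = - ∑ i, A (J (b i)) (b i) := by
  have := sum_bilin_isometry b (A.flip.comp (J : E →L[ℝ] E)).flip J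
  simp [hJ] at this
  rw [← this]

end Calculus

section MaxPrinciple

variable {E : Type*} [NormedAddCommGroup E] [InnerProductSpace ℝ E]
  {ι : Type*} [Fintype ι] (b : OrthonormalBasis ι ℝ E)

lemma pd_pd_nonpos_of_isLocalMax {u : E → ℝ} {x : E} (hu : 𝒞 u x) (h : IsLocalMax u x) (v : E) :
    pd v (pd v u) x ≤ 0 := by
  by_contra! hpos
  set p : ℝ → E := fun t => x + t • v with hp
  have hp0 : p 0 = x := by simp [hp]
  have hpc : Continuous p := by fun_prop
  have hpd : ∀ t, HasDerivAt p v t := fun t =>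
    (((hasDerivAt_id t).smul_const v).const_add x).congr_deriv (one_smul _ _)
  have key : ∀ {w : E → ℝ} {t : ℝ}, DifferentiableAt ℝ w (p t) →
      deriv (fun s => w (p s)) t = pd v w (p t) := by
    intro w t hw
    exact (hw.hasFDerivAt.comp_hasDerivAt t (hpd t)).deriv
  have hev : ∀ᶠ t in 𝓝 (0 : ℝ), DifferentiableAt ℝ u (p t) := by
    have : Tendsto p (𝓝 0) (𝓝 x) := by simpa [hp0] using hpc.tendsto 0
    exact this.eventually (sm_ev hu)
  have hd1 : deriv (fun s => u (p s)) =ᶠ[𝓝 0] fun t => pd v u (p t) := hev.mono fun t ht => key ht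
  have hd2 : deriv (deriv (fun s => u (p s))) 0 = pd v (pd v u) x := by
    rw [hd1.deriv_eq, key (by rw [hp0]; exact sm_diff (sm_pd hu v)), hp0]
  have hmax : IsLocalMax (fun s => u (p s)) 0 := by
    have : Tendsto p (𝓝 0) (𝓝 x) := by simpa [hp0] using hpc.tendsto 0
    have h' := this.eventually h
    simpa [IsLocalMax, IsMaxFilter, hp0] using h'
  have hmin : IsLocalMin (fun s => u (p s)) 0 := by
    refine isLocalMin_of_deriv_deriv_pos (by rw [hd2]; exact hpos) hmax.deriv_eq_zero ?_
    have : ContinuousAt u (p 0) := by rw [hp0]; exact hu.continuousAt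
    exact this.comp hpc.continuousAt
  have hconst : (fun s => u (p s)) =ᶠ[𝓝 0] fun _ => u (p 0) := by
    filter_upwards [hmax, hmin] with t h1 h2 using le_antisymm h1 h2
  have h0 : deriv (deriv (fun s => u (p s))) 0 = 0 := by
    have h1 := hconst.deriv
    rw [h1.deriv_eq]; simp
  linarith

lemma Lap_nonpos_of_isLocalMax {u : E → ℝ} {x : E} (hu : 𝒞 u x) (h : IsLocalMax u x) :
    Lap b u x ≤ 0 :=
  Finset.sum_nonpos fun _ _ => pd_pd_nonpos_of_isLocalMax hu h _

variable [Nonempty ι]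

theorem max_principle {A : Set E} (hA : IsCompact A) {u : E → ℝ} (hu : ContinuousOn u A)
    (h : ∀ x ∈ A, u x ≤ 0 ∨ (A ∈ 𝓝 x ∧ 𝒞 u x ∧ 0 ≤ Lap b u x)) : ∀ x ∈ A, u x ≤ 0 := by
  obtain ⟨R, hR⟩ := hA.isBounded.exists_norm_le
  have key : ∀ δ > 0, ∀ x ∈ A, u x + δ * (‖x - 0‖ ^ 2 - R ^ 2) ≤ 0 := by
    intro δ hδ x hx
    obtain ⟨x0, hx0, hmax⟩ := hA.exists_isMaxOn ⟨x, hx⟩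
      (f := fun x => u x + δ * (‖x - 0‖ ^ 2 - R ^ 2)) (by fun_prop)
    refine (hmax hx).trans ?_
    rcases h x0 hx0 with h0 | ⟨hn, hs, hl⟩
    · have h1 := hR x0 hx0
      have h2 := norm_nonneg x0
      have : ‖x0 - 0‖ ^ 2 ≤ R ^ 2 := by rw [sub_zero]; gcongr
      simp only
      nlinarith
    · exfalso
      have hsq : 𝒞 (fun y : E => ‖y - 0‖ ^ 2) x0 :=
        ((contDiff_norm_sq ℝ).comp (contDiff_id.sub contDiff_const)).contDiffAt
      have hlm : IsLocalMax (fun x => u x + δ * (‖x - 0‖ ^ 2 - R ^ 2)) x0 := hmax.isLocalMax hn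
      have h1 := Lap_nonpos_of_isLocalMax b (by fun_prop) hlm
      rw [Lap_add b hs (by fun_prop), Lap_const_mul b (by fun_prop),
        Lap_sub b hsq contDiffAt_const, Lap_sq_norm, Lap_const] at h1
      have : (0 : ℝ) < Fintype.card ι := by exact_mod_cast Fintype.card_pos
      have := mul_pos hδ this
      nlinarith
  intro x hx
  have hlim : Tendsto (fun δ : ℝ => u x + δ * (‖x - 0‖ ^ 2 - R ^ 2)) (𝓝[>] 0) (𝓝 (u x)) := by
    have : ContinuousAt (fun δ : ℝ => u x + δ * (‖x - 0‖ ^ 2 - R ^ 2)) 0 := by fun_prop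
    have := this.tendsto
    simp only [zero_mul, add_zero] at this
    exact this.mono_left nhdsWithin_le_nhds
  exact le_of_tendsto hlim (by filter_upwards [self_mem_nhdsWithin] with δ hδ using key δ hδ x hx)

/-- Maximum principle on an open set, with boundary behaviour expressed by compact exhaustion. -/
theorem max_principle_open {O : Set E} (hO : IsOpen O) {u : E → ℝ} (hu : ∀ x ∈ O, 𝒞 u x)
    (hL : ∀ x ∈ O, 0 ≤ Lap b u x)
    (hb : ∀ ε > 0, ∃ C ⊆ O, IsCompact C ∧ ∀ x ∈ O \ C, u x ≤ ε) : ∀ x ∈ O, u x ≤ 0 := by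
  intro x hx
  refine le_of_forall_pos_le_add fun ε hε => ?_
  obtain ⟨C, hCO, hC, hCu⟩ := hb ε hε
  rw [zero_add]
  by_cases hxC : x ∈ C
  swap
  · exact hCu x ⟨hx, hxC⟩
  have := max_principle b hC (u := fun x => u x - ε)
    (fun y hy => ((hu y (hCO hy)).continuousAt.sub continuousAt_const).continuousWithinAt) ?_ x hxC
  · simpa using this
  intro y hy
  by_cases hn : C ∈ 𝓝 y
  · refine Or.inr ⟨hn, (hu y (hCO hy)).sub contDiffAt_const, ?_⟩
    rw [Lap_sub b (hu y (hCO hy)) contDiffAt_const, Lap_const, sub_zero]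
    exact hL y (hCO hy)
  · left
    have hfr : ∃ᶠ w in 𝓝 y, w ∉ C := fun h => hn (h.mono fun w hw => not_not.1 hw)
    by_contra! hlt
    have h1 : ∀ᶠ w in 𝓝 y, ε < u w :=
      (hu y (hCO hy)).continuousAt.eventually (lt_mem_nhds (by linarith))
    obtain ⟨w, hw, hw1, hw2⟩ := (hfr.and_eventually (h1.and (hO.mem_nhds (hCO hy)))).exists
    linarith [hCu w ⟨hw2, hw⟩]

end MaxPrinciple

section Integrals

variable {E : Type*} [NormedAddCommGroup E] [InnerProductSpace ℝ E]

lemma exists_cutoff [FiniteDimensional ℝ E] {C O : Set E} (hC : IsCompact C) (hO : IsOpen O)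
    (hCO : C ⊆ O) :
    ∃ η : E → ℝ, (∀ x, 𝒞 η x) ∧ HasCompactSupport η ∧ tsupport η ⊆ O ∧
      (∀ x ∈ C, η =ᶠ[𝓝 x] fun _ => 1) ∧ ∀ x, η x ∈ Icc (0 : ℝ) 1 := by
  obtain ⟨K, hK, hCK, hKO⟩ := exists_compact_between hC hO hCO
  obtain ⟨f, hf1, hf0, hfI⟩ := exists_contMDiffMap_one_nhds_of_subset_interior
    (n := ⊤) (modelWithCornersSelf ℝ E) hC.isClosed hCK
  have hsup : tsupport f ⊆ K := by
    refine closure_minimal (fun x hx => ?_) hK.isClosed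
    by_contra h
    exact hx (hf0 x h)
  refine ⟨f, fun x => f.contMDiff.contDiff.contDiffAt,
    hK.of_isClosed_subset (isClosed_tsupport _) hsup, hsup.trans hKO, fun x hx => ?_, hfI⟩
  exact (Filter.eventually_iff_exists_mem.2 ⟨_, hf1, fun _ h => h⟩ |> fun h =>
    (eventually_nhdsSet_iff_forall.1 h x hx))

lemma pd_eq_zero_of_notMem {u : E → ℝ} {x : E} (h : x ∉ tsupport u) (v : E) : pd v u x = 0 := by
  simp [pd, fderiv_of_notMem_tsupport ℝ h]

lemma tsupport_pd_subset (v : E) (u : E → ℝ) : tsupport (pd v u) ⊆ tsupport u :=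
  closure_minimal (fun x hx => by_contra fun h => hx (pd_eq_zero_of_notMem h v))
    (isClosed_tsupport _)

lemma tsupport_Lap_subset {ι : Type*} [Fintype ι] (b : OrthonormalBasis ι ℝ E) (u : E → ℝ) :
    tsupport (Lap b u) ⊆ tsupport u := by
  refine closure_minimal (fun _ hx => by_contra fun h => hx ?_) (isClosed_tsupport _)
  exact Finset.sum_eq_zero fun _ _ => pd_eq_zero_of_notMem
    (fun h' => h (tsupport_pd_subset _ _ h')) _

/-- A product with a test function is smooth once the other factor is smooth near its support. -/
lemma sm_mul_supp {Γ w : E → ℝ} (hw : ∀ x, 𝒞 w x) (hΓ : ∀ x ∈ tsupport w, 𝒞 Γ x) (x : E) :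
    𝒞 (fun y => Γ y * w y) x := by
  by_cases h : x ∈ tsupport w
  · exact (hΓ x h).mul (hw x)
  · have : (fun y => Γ y * w y) =ᶠ[𝓝 x] fun _ => 0 := by
      have := notMem_tsupport_iff_eventuallyEq.1 h
      filter_upwards [this] with y hy; simp [hy]
    exact contDiffAt_const.congr_of_eventuallyEq this

omit [InnerProductSpace ℝ E] in
lemma tsupport_mul_subset' (Γ w : E → ℝ) : tsupport (fun y => Γ y * w y) ⊆ tsupport w :=
  closure_mono fun y hy => by
    simp only [Function.mem_support] at hy ⊢; exact right_ne_zero_of_mul hy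

lemma cs_mul {Γ w : E → ℝ} (hw : HasCompactSupport w) :
    HasCompactSupport (fun y => Γ y * w y) :=
  hw.of_isClosed_subset (isClosed_tsupport _) (tsupport_mul_subset' Γ w)

lemma cs_pd {w : E → ℝ} (hw : HasCompactSupport w) (v : E) : HasCompactSupport (pd v w) :=
  hw.of_isClosed_subset (isClosed_tsupport _) (tsupport_pd_subset v w)

variable [FiniteDimensional ℝ E] [MeasurableSpace E] [BorelSpace E]
  (μ : Measure E) [μ.IsAddHaarMeasure]

omit [InnerProductSpace ℝ E] [FiniteDimensional ℝ E] in
lemma integrable_cs {u : E → ℝ} (hu : ∀ x, ContinuousAt u x) (hc : HasCompactSupport u) :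
    Integrable u μ := (continuous_iff_continuousAt.2 hu).integrable_of_hasCompactSupport hc

lemma integral_pd_eq_zero {φ : E → ℝ} (hφ : ∀ x, 𝒞 φ x) (hc : HasCompactSupport φ) (v : E) :
    ∫ x, pd v φ x ∂μ = 0 := by
  have := integral_mul_fderiv_eq_neg_fderiv_mul_of_integrable (μ := μ) (f := fun _ : E => (1 : ℝ))
    (g := φ) (v := v) (by simp)
    (by simpa using! integrable_cs μ (fun x => (sm_pd (hφ x) v).continuousAt) (cs_pd hc v))
    (by simpa using integrable_cs μ (fun x => (hφ x).continuousAt) hc)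
    (by simp) (fun x _ => sm_diff (hφ x))
  simpa [pd] using this

variable {ι : Type*} [Fintype ι] (b : OrthonormalBasis ι ℝ E)

/-- Green's second identity against a test function. -/
lemma integral_mul_Lap {Γ w : E → ℝ} (hw : ∀ x, 𝒞 w x) (hc : HasCompactSupport w)
    (hΓ : ∀ x ∈ tsupport w, 𝒞 Γ x) :
    ∫ x, Γ x * Lap b w x ∂μ = ∫ x, Lap b Γ x * w x ∂μ := by
  have hS : ∀ i x, 𝒞 (fun y => Γ y * pd (b i) w y) x := fun i =>
    sm_mul_supp (fun x => sm_pd (hw x) _) fun x hx => hΓ x (tsupport_pd_subset _ _ hx)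
  have hT : ∀ i x, 𝒞 (fun y => pd (b i) Γ y * w y) x := fun i =>
    sm_mul_supp hw fun x hx => sm_pd (hΓ x hx) _
  have e : ∀ i x, Γ x * pd (b i) (pd (b i) w) x - pd (b i) (pd (b i) Γ) x * w x =
      pd (b i) (fun y => Γ y * pd (b i) w y) x - pd (b i) (fun y => pd (b i) Γ y * w y) x := by
    intro i x
    by_cases hx : x ∈ tsupport w
    · rw [pd_mul (sm_diff (hΓ x hx)) (sm_diff (sm_pd (hw x) _)),
        pd_mul (sm_diff (sm_pd (hΓ x hx) _)) (sm_diff (hw x))]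
      ring
    · rw [pd_eq_zero_of_notMem fun h => hx (tsupport_pd_subset _ _ h),
        pd_eq_zero_of_notMem fun h => hx (tsupport_pd_subset _ _ (tsupport_mul_subset' _ _ h)),
        pd_eq_zero_of_notMem fun h => hx (tsupport_mul_subset' _ _ h), image_eq_zero_of_notMem_tsupport hx]
      ring
  have hI1 : Integrable (fun x => Γ x * Lap b w x) μ := by
    refine integrable_cs μ (fun x => ?_) (cs_mul (hc.of_isClosed_subset (isClosed_tsupport _)
      (tsupport_Lap_subset b w)))
    exact (sm_mul_supp (fun x => sm_Lap b (hw x))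
      (fun x hx => hΓ x (tsupport_Lap_subset b w hx)) x).continuousAt
  have hI2 : Integrable (fun x => Lap b Γ x * w x) μ := by
    refine integrable_cs μ (fun x => ?_) (cs_mul hc)
    exact (sm_mul_supp hw (fun x hx => sm_Lap b (hΓ x hx)) x).continuousAt
  have hI3 : ∀ i, Integrable (fun x => pd (b i) (fun y => Γ y * pd (b i) w y) x) μ := fun i =>
    integrable_cs μ (fun x => (sm_pd (hS i x) _).continuousAt) (cs_pd (cs_mul (cs_pd hc _)) _)
  have hI4 : ∀ i, Integrable (fun x => pd (b i) (fun y => pd (b i) Γ y * w y) x) μ := fun i =>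
    integrable_cs μ (fun x => (sm_pd (hT i x) _).continuousAt) (cs_pd (cs_mul hc) _)
  rw [← sub_eq_zero, ← integral_sub hI1 hI2]
  have : ∀ x, Γ x * Lap b w x - Lap b Γ x * w x = ∑ i,
      (pd (b i) (fun y => Γ y * pd (b i) w y) x - pd (b i) (fun y => pd (b i) Γ y * w y) x) := by
    intro x
    simp only [Lap, Finset.mul_sum, Finset.sum_mul, ← Finset.sum_sub_distrib, e]
  simp only [this]
  rw [integral_finsetSum _ fun i _ => by exact (hI3 i).sub (hI4 i)]
  refine Finset.sum_eq_zero fun i _ => ?_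
  rw [integral_sub (hI3 i) (hI4 i), integral_pd_eq_zero μ (hS i) (cs_mul (cs_pd hc _)),
    integral_pd_eq_zero μ (hT i) (cs_mul hc), sub_zero]

/-- A smooth convex truncation. -/
lemma exists_truncation {ε : ℝ} (hε : 0 < ε) : ∃ (θ : ℝ → ℝ) (d : ℝ), ContDiff ℝ (⊤ : ℕ∞) θ ∧
    (∀ s ≤ ε, θ s = 0) ∧ (∀ s, 2 * ε ≤ s → θ s = s - d) ∧ (∀ s, 0 ≤ deriv (deriv θ) s) ∧
    (∀ s, 0 ≤ deriv θ s) := by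
  set τ : ℝ → ℝ := fun s => Real.smoothTransition ((s - ε) / ε) with hτ
  have hτs : ContDiff ℝ (⊤ : ℕ∞) τ := Real.smoothTransition.contDiff.comp
    ((contDiff_id.sub contDiff_const).div_const ε)
  have hd : ∀ s, HasDerivAt (fun s => ∫ t in ε..s, τ t) (τ s) s := fun s =>
    intervalIntegral.integral_hasDerivAt_right (hτs.continuous.intervalIntegrable _ _)
      (hτs.continuous.stronglyMeasurableAtFilter _ _) hτs.continuous.continuousAt
  have hder : deriv (fun s => ∫ t in ε..s, τ t) = τ := funext fun s => (hd s).deriv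
  have hmono : Monotone τ := by
    intro s t hst
    exact Real.smoothTransition.monotone (by gcongr)
  refine ⟨fun s => ∫ t in ε..s, τ t, 2 * ε - ∫ t in ε..2 * ε, τ t, ?_, ?_, ?_, ?_, ?_⟩
  · rw [contDiff_infty_iff_deriv, hder]
    exact ⟨fun s => (hd s).differentiableAt, hτs⟩
  · intro s hs
    beta_reduce
    rw [intervalIntegral.integral_congr (g := fun _ => 0)]
    · simp
    · intro t ht
      rw [uIcc_of_ge hs] at ht
      exact Real.smoothTransition.zero_of_nonpos
        (div_nonpos_of_nonpos_of_nonneg (by linarith [ht.2]) hε.le)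
  · intro s hs
    have h1 : ∫ t in 2 * ε..s, τ t = ∫ t in 2 * ε..s, 1 := by
      refine intervalIntegral.integral_congr fun t ht => ?_
      rw [uIcc_of_le hs] at ht
      exact Real.smoothTransition.one_of_one_le (by rw [le_div_iff₀ hε]; linarith [ht.1])
    have h2 := intervalIntegral.integral_add_adjacent_intervals (μ := volume) (f := τ)
      (a := ε) (b := 2 * ε) (c := s) (hτs.continuous.intervalIntegrable _ _)
      (hτs.continuous.intervalIntegrable _ _)
    rw [h1] at h2
    simp only [intervalIntegral.integral_const, smul_eq_mul, mul_one] at h2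
    simp only
    linarith
  · intro s; rw [hder]; exact hmono.deriv_nonneg
  · intro s; rw [hder]; exact Real.smoothTransition.nonneg _

/-- The representation formula produced by a truncated Green function. -/
theorem green_repr [Nontrivial E] {O : Set E} {z : E} {g : E → ℝ}
    (hg : ∀ x ∈ O, x ≠ z → 𝒞 g x) (hharm : ∀ x ∈ O, x ≠ z → Lap b g x = 0) {ε : ℝ}
    (hO : IsOpen O) {C : Set E} (hC : IsCompact C) (hCO : C ⊆ O) (hzC : z ∈ C)
    (hgC : ∀ x ∈ O, x ∉ C → g x < ε) (hgz : ∀ᶠ x in 𝓝[≠] z, 2 * ε < g x) (hgz' : g z < ε)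
    (h_int : ∀ w : E → ℝ, ContDiff ℝ (⊤ : ℕ∞) w → HasCompactSupport w → tsupport w ⊆ O →
      ∫ x, -(g x) * Lap b w x ∂μ = w z)
    {θ : ℝ → ℝ} {d : ℝ} (hθ : ContDiff ℝ (⊤ : ℕ∞) θ) (hθ0 : ∀ s ≤ ε, θ s = 0)
    (hθ1 : ∀ s, 2 * ε ≤ s → θ s = s - d) {H : E → ℝ} (hH : ∀ x ∈ O, 𝒞 H x)
    (hHz : ∀ᶠ x in 𝓝 z, Lap b H x = 0) :
    ∫ x in O, deriv (deriv θ) (g x) * gip b g g x * H x ∂μ =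
      H z + ∫ x in O, θ (g x) * Lap b H x ∂μ := by
  have hθ2 : ∀ s < ε, deriv (deriv θ) s = 0 := by
    intro s hs
    have h1 : θ =ᶠ[𝓝 s] fun _ => 0 := by
      filter_upwards [Iio_mem_nhds hs] with t ht using hθ0 t ht.le
    rw [h1.deriv.deriv_eq]; simp
  obtain ⟨η, hη, hηc, hηO, hη1, -⟩ := exists_cutoff hC hO hCO
  set w : E → ℝ := fun x => H x * η x with hw
  have hws : ∀ x, 𝒞 w x := sm_mul_supp hη fun x hx => hH x (hηO hx)
  have hwc : HasCompactSupport w := cs_mul hηc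
  have hwO : tsupport w ⊆ O := (tsupport_mul_subset' _ _).trans hηO
  have hwC : ∀ x ∈ C, w =ᶠ[𝓝 x] H := fun x hx => by
    filter_upwards [hη1 x hx] with y hy; simp [hw, hy]
  classical
  set Γ : E → ℝ := fun x => if x = z then -d else θ (g x) - g x with hΓ
  have hΓz : Γ =ᶠ[𝓝 z] fun _ => -d := by
    have := eventually_nhdsWithin_iff.1 hgz
    filter_upwards [this] with x hx
    by_cases h : x = z
    · simp [hΓ, h]
    · simp [hΓ, h, hθ1 _ (hx h).le]
  have hΓx : ∀ x, x ≠ z → Γ =ᶠ[𝓝 x] fun x => θ (g x) - g x := fun x hx => by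
    filter_upwards [isOpen_ne.mem_nhds hx] with y hy
    simp only [hΓ]; rw [if_neg hy]
  have hΓs : ∀ x ∈ O, 𝒞 Γ x := by
    intro x hx
    by_cases h : x = z
    · subst h; exact contDiffAt_const.congr_of_eventuallyEq hΓz
    · exact ((hθ.contDiffAt.comp x (hg x hx h)).sub (hg x hx h)).congr_of_eventuallyEq (hΓx x h)
  have hmain := integral_mul_Lap μ b hws hwc fun x hx => hΓs x (hwO hx)
  have hLw : ∀ x, θ (g x) * Lap b w x = O.indicator (fun x => θ (g x) * Lap b H x) x := by
    intro x
    by_cases hxC : x ∈ C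
    · rw [Lap_congr b (hwC x hxC), indicator_of_mem (hCO hxC)]
    · by_cases hxO : x ∈ O
      · rw [indicator_of_mem hxO, hθ0 _ (hgC x hxO hxC).le, zero_mul, zero_mul]
      · rw [image_eq_zero_of_notMem_tsupport (fun h => hxO (hwO (tsupport_Lap_subset b w h))),
          mul_zero, indicator_of_notMem hxO]
  have hwL : HasCompactSupport (Lap b w) :=
    hwc.of_isClosed_subset (isClosed_tsupport _) (tsupport_Lap_subset b w)
  have hI1 : Integrable (fun x => Γ x * Lap b w x) μ :=
    integrable_cs μ (fun x => (sm_mul_supp (fun x => sm_Lap b (hws x))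
      (fun x hx => hΓs x (hwO (tsupport_Lap_subset b w hx))) x).continuousAt) (cs_mul hwL)
  have hI2 : Integrable (fun x => θ (g x) * Lap b w x) μ := by
    refine integrable_cs μ (fun x => ?_) (cs_mul hwL)
    by_cases hxz : x = z
    · subst hxz
      have : (fun y => θ (g y) * Lap b w y) =ᶠ[𝓝 x] fun _ => 0 := by
        filter_upwards [hHz, Lap_congr_ev b (hwC x hzC)] with y h1 h2
        rw [h2, h1, mul_zero]
      exact continuousAt_const.congr this.symm
    · by_cases hx : x ∈ tsupport (Lap b w)
      · have hxO := hwO (tsupport_Lap_subset b w hx)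
        exact ((hθ.contDiffAt.comp x (hg x hxO hxz)).mul (sm_Lap b (hws x))).continuousAt
      · have : (fun y => θ (g y) * Lap b w y) =ᶠ[𝓝 x] fun _ => 0 := by
          filter_upwards [notMem_tsupport_iff_eventuallyEq.1 hx] with y h1
          rw [h1]; simp
        exact continuousAt_const.congr this.symm
  have h1 : ∫ x, Γ x * Lap b w x ∂μ =
      ∫ x, -(g x) * Lap b w x ∂μ + ∫ x in O, θ (g x) * Lap b H x ∂μ := by
    rw [← integral_indicator hO.measurableSet, ← integral_congr_ae
      (Eventually.of_forall hLw), ← sub_eq_iff_eq_add, ← integral_sub hI1 hI2]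
    refine integral_congr_ae ?_
    have : ∀ᵐ x ∂μ, x ≠ z := by simp [ae_iff, measure_singleton]
    filter_upwards [this] with x hx
    simp only [hΓ]; rw [if_neg hx, sub_mul]; ring
  rw [h1, h_int w (contDiff_iff_contDiffAt.2 hws) hwc hwO, (hwC z hzC).eq_of_nhds] at hmain
  rw [hmain, ← integral_indicator hO.measurableSet]
  refine integral_congr_ae (Eventually.of_forall fun x => ?_)
  by_cases hxO : x ∈ O
  swap
  · simp only [indicator_of_notMem hxO]
    rw [image_eq_zero_of_notMem_tsupport fun h => hxO (hwO h), mul_zero]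
  simp only [indicator_of_mem hxO]
  by_cases hxz : x = z
  · subst hxz
    rw [Lap_congr b hΓz, Lap_const, hθ2 _ hgz']; ring
  · have hgx := hg x hxO hxz
    rw [Lap_congr b (hΓx x hxz), Lap_sub b (u := fun x => θ (g x)) (hθ.contDiffAt.comp x hgx) hgx,
      Lap_comp b hθ.contDiffAt hgx, hharm x hxO hxz]
    by_cases hxC : x ∈ C
    · rw [(hwC x hxC).eq_of_nhds]; ring
    · rw [hθ2 _ (hgC x hxO hxC)]; ring

/-- The harmonic mean-value formula produced by a truncated Green function. -/
theorem green_mean [Nontrivial E] {O : Set E} {z : E} {g : E → ℝ}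
    (hg : ∀ x ∈ O, x ≠ z → 𝒞 g x) (hharm : ∀ x ∈ O, x ≠ z → Lap b g x = 0) {ε : ℝ}
    (hO : IsOpen O) {C : Set E} (hC : IsCompact C) (hCO : C ⊆ O) (hzC : z ∈ C)
    (hgC : ∀ x ∈ O, x ∉ C → g x < ε) (hgz : ∀ᶠ x in 𝓝[≠] z, 2 * ε < g x) (hgz' : g z < ε)
    (h_int : ∀ w : E → ℝ, ContDiff ℝ (⊤ : ℕ∞) w → HasCompactSupport w → tsupport w ⊆ O →
      ∫ x, -(g x) * Lap b w x ∂μ = w z)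
    {θ : ℝ → ℝ} {d : ℝ} (hθ : ContDiff ℝ (⊤ : ℕ∞) θ) (hθ0 : ∀ s ≤ ε, θ s = 0)
    (hθ1 : ∀ s, 2 * ε ≤ s → θ s = s - d) {H : E → ℝ} (hH : ∀ x ∈ O, 𝒞 H x)
    (hHL : ∀ x ∈ O, Lap b H x = 0) :
    ∫ x in O, deriv (deriv θ) (g x) * gip b g g x * H x ∂μ = H z := by
  rw [green_repr μ b hg hharm hO hC hCO hzC hgC hgz hgz' h_int hθ hθ0 hθ1 hH
    (by filter_upwards [hO.mem_nhds (hCO hzC)] with x hx using hHL x hx),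
    setIntegral_congr_fun (g := fun _ => (0 : ℝ)) hO.measurableSet fun x hx => ?_]
  · simp
  · simp [hHL x hx]

end Integrals

section Kernel

variable {E : Type*} [NormedAddCommGroup E] [InnerProductSpace ℝ E]
  {ι : Type*} [Fintype ι] (b : OrthonormalBasis ι ℝ E)

/-- Smooth harmonic functions on a set. -/
def Harm (O : Set E) (H : E → ℝ) : Prop := ∀ x ∈ O, 𝒞 H x ∧ Lap b H x = 0

variable {b}

lemma Harm.mono {O O' : Set E} {H : E → ℝ} (h : Harm b O H) (hO : O' ⊆ O) : Harm b O' H :=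
  fun x hx => h x (hO hx)

lemma Harm.sm {O : Set E} {H : E → ℝ} (h : Harm b O H) {x : E} (hx : x ∈ O) : 𝒞 H x := (h x hx).1

lemma Harm.pd {O : Set E} (hO : IsOpen O) {H : E → ℝ} (h : Harm b O H) (v : E) :
    Harm b O (pd v H) := fun x hx => by
  refine ⟨sm_pd (h.sm hx) v, ?_⟩
  rw [Lap_pd b (h.sm hx), pd_congr (w := fun _ => (0 : ℝ)), pd_const]
  · rfl
  · filter_upwards [hO.mem_nhds hx] with y hy using (h y hy).2

lemma Harm.add {O : Set E} {H H' : E → ℝ} (h : Harm b O H) (h' : Harm b O H') :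
    Harm b O (fun x => H x + H' x) := fun x hx => by
  refine ⟨(h.sm hx).add (h'.sm hx), ?_⟩
  rw [Lap_add b (h.sm hx) (h'.sm hx), (h x hx).2, (h' x hx).2, add_zero]

lemma Harm.sub {O : Set E} {H H' : E → ℝ} (h : Harm b O H) (h' : Harm b O H') :
    Harm b O (fun x => H x - H' x) := fun x hx => by
  refine ⟨(h.sm hx).sub (h'.sm hx), ?_⟩
  rw [Lap_sub b (h.sm hx) (h'.sm hx), (h x hx).2, (h' x hx).2, sub_zero]

lemma Harm.const (O : Set E) (a : ℝ) : Harm b O (fun _ => a) := fun x _ =>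
  ⟨contDiffAt_const, Lap_const b a x⟩

lemma Harm.scale {O : Set E} {H : E → ℝ} (h : Harm b O H) (x : E) (ρ : ℝ) :
    Harm b {y | x + ρ • y ∈ O} (fun y => H (x + ρ • y)) := fun y hy => by
  refine ⟨sm_scale (h.sm hy), ?_⟩
  rw [Lap_scale b (h.sm hy), (h _ hy).2, mul_zero]

variable (b)

/-- The model fundamental solution. -/
def fundK (c : ℝ) (m : ℕ) (x : E) : ℝ := c / ‖x‖ ^ (2 * m)

omit [InnerProductSpace ℝ E] in
lemma fundK_eq (c : ℝ) (m : ℕ) : (fundK c m : E → ℝ) = fun x => c * ((‖x‖ ^ 2) ^ m)⁻¹ := by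
  ext x; rw [fundK, pow_mul, div_eq_mul_inv]

lemma sm_norm_sq (x : E) : 𝒞 (fun y : E => ‖y‖ ^ 2) x := (contDiff_norm_sq ℝ).contDiffAt

lemma Lap_norm_sq (x : E) : Lap b (fun y : E => ‖y‖ ^ 2) x = 2 * Fintype.card ι := by
  simpa using Lap_sq_norm b 0 x

lemma gip_norm_sq (x : E) : gip b (fun y : E => ‖y‖ ^ 2) (fun y : E => ‖y‖ ^ 2) x = 4 * ‖x‖ ^ 2 := by
  simp only [gip, pd_sq_norm]
  have := b.sum_inner_mul_inner x x
  rw [real_inner_self_eq_norm_sq] at this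
  rw [← this, Finset.mul_sum]
  refine Finset.sum_congr rfl fun i _ => ?_
  rw [real_inner_comm x (b i)]; ring

lemma gip_comp {u : E → ℝ} {φ : ℝ → ℝ} {x : E} (hφ : 𝒞 φ (u x)) (hu : 𝒞 u x) :
    gip b (fun y => φ (u y)) (fun y => φ (u y)) x = (deriv φ (u x)) ^ 2 * gip b u u x := by
  simp only [gip, Finset.mul_sum, pd_comp (sm_diff hφ) (sm_diff hu)]
  exact Finset.sum_congr rfl fun i _ => by ring

lemma sm_invpow (c : ℝ) (m : ℕ) {s : ℝ} (hs : s ≠ 0) : 𝒞 (fun s : ℝ => c * (s ^ m)⁻¹) s :=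
  contDiffAt_const.mul ((contDiffAt_id.pow m).inv (pow_ne_zero m hs))

lemma deriv_invpow (c : ℝ) (m : ℕ) {s : ℝ} (hs : s ≠ 0) :
    deriv (fun s : ℝ => c * (s ^ m)⁻¹) s = (-(c * m)) * (s ^ (m + 1))⁻¹ := by
  have := (((hasDerivAt_id s).pow m).inv (pow_ne_zero m hs)).const_mul c
  have h2 := this.deriv
  simp only [id] at h2
  change deriv (fun s : ℝ => c * (s ^ m)⁻¹) s = _ at h2
  rw [h2]
  rcases m with _ | m
  · simp
  · simp; field_simp; ring

lemma sm_fundK (c : ℝ) (m : ℕ) {x : E} (hx : x ≠ 0) : 𝒞 (fundK c m) x := by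
  rw [fundK_eq]
  exact ContDiffAt.comp (g := fun s : ℝ => c * (s ^ m)⁻¹) x (sm_invpow c m (by positivity : ‖x‖ ^ 2 ≠ 0)) (sm_norm_sq x)

lemma gip_fundK (c : ℝ) (m : ℕ) {x : E} (hx : x ≠ 0) :
    gip b (fundK c m) (fundK c m) x =
      ((-(c * m)) * ((‖x‖ ^ 2) ^ (m + 1))⁻¹) ^ 2 * (4 * ‖x‖ ^ 2) := by
  have h : ‖x‖ ^ 2 ≠ 0 := by positivity
  rw [fundK_eq, gip_comp b (u := fun y : E => ‖y‖ ^ 2) (φ := fun s => c * (s ^ m)⁻¹)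
    (sm_invpow c m h) (sm_norm_sq x), deriv_invpow _ _ h, gip_norm_sq]

lemma Lap_fundK (c : ℝ) (m : ℕ) (hdim : Fintype.card ι = 2 * m + 2) {x : E} (hx : x ≠ 0) :
    Lap b (fundK c m) x = 0 := by
  have h : ‖x‖ ^ 2 ≠ 0 := by positivity
  have hev : deriv (fun s : ℝ => c * (s ^ m)⁻¹) =ᶠ[𝓝 (‖x‖ ^ 2)]
      fun s => (-(c * m)) * (s ^ (m + 1))⁻¹ := by
    filter_upwards [isOpen_ne.mem_nhds h] with s hs using deriv_invpow c m hs
  rw [fundK_eq, Lap_comp b (u := fun y : E => ‖y‖ ^ 2) (φ := fun s => c * (s ^ m)⁻¹)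
    (sm_invpow c m h) (sm_norm_sq x), hev.deriv_eq, deriv_invpow _ _ h, deriv_invpow _ _ h,
    gip_norm_sq, Lap_norm_sq, hdim]
  push_cast
  field_simp
  ring

lemma Harm_fundK (c : ℝ) (m : ℕ) (hdim : Fintype.card ι = 2 * m + 2) :
    Harm b {x : E | x ≠ 0} (fundK c m) :=
  fun _ hx => ⟨sm_fundK c m hx, Lap_fundK b c m hdim hx⟩

omit [InnerProductSpace ℝ E] in
lemma tendsto_fundK {c : ℝ} (hc : 0 < c) {m : ℕ} (hm : 1 ≤ m) :
    Tendsto (fundK c m : E → ℝ) (𝓝[≠] 0) atTop := by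
  have h1 : Tendsto (fun x : E => ‖x‖ ^ (2 * m)) (𝓝[≠] 0) (𝓝[>] 0) := by
    refine tendsto_nhdsWithin_iff.2 ⟨?_, ?_⟩
    · have : Continuous fun x : E => ‖x‖ ^ (2 * m) := by fun_prop
      have := this.tendsto 0
      rw [norm_zero, zero_pow (by omega)] at this
      exact this.mono_left nhdsWithin_le_nhds
    · filter_upwards [self_mem_nhdsWithin] with x hx
      have : 0 < ‖x‖ := norm_pos_iff.2 hx
      exact pow_pos this _
  have h2 := (tendsto_inv_nhdsGT_zero.comp h1).const_mul_atTop hc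
  exact h2

omit [InnerProductSpace ℝ E] in
lemma fundK_anti {c : ℝ} (hc : 0 < c) {m : ℕ} (hm : 1 ≤ m) {x y : E} (hx : x ≠ 0)
    (h : ‖x‖ < ‖y‖) : fundK c m y < fundK c m x := by
  have : 0 < ‖x‖ := norm_pos_iff.2 hx
  exact div_lt_div_of_pos_left hc (by positivity) (pow_lt_pow_left₀ h this.le (by omega))

omit [InnerProductSpace ℝ E] in
lemma fundK_zero (c : ℝ) {m : ℕ} (hm : 1 ≤ m) : fundK c m (0 : E) = 0 := by
  rw [fundK, norm_zero, zero_pow (by omega), div_zero]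

variable [FiniteDimensional ℝ E] [MeasurableSpace E] [BorelSpace E]
  (μ : Measure E) [μ.IsAddHaarMeasure]

/-- A smooth radial kernel with the mean value property for harmonic functions. -/
structure MVKernel (k : E → ℝ) : Prop where
  sm : ∀ x, 𝒞 k x
  nonneg : ∀ x, 0 ≤ k x
  supp : ∀ x, 1 / 4 < ‖x‖ → k x = 0
  radial : ∀ x y, ‖x‖ = ‖y‖ → k x = k y
  mean : ∀ H, Harm b (ball 0 (1 / 2)) H → ∫ x, k x * H x ∂μ = H 0
  pos : ∃ x ≠ 0, 0 < k x

theorem exists_MVKernel [Nontrivial E] {c : ℝ} (hc : 0 < c) {m : ℕ} (hm : 1 ≤ m)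
    (hdim : Fintype.card ι = 2 * m + 2)
    (hfund : ∀ w : E → ℝ, ContDiff ℝ (⊤ : ℕ∞) w → HasCompactSupport w →
      ∫ x, -(fundK c m x) * Lap b w x ∂μ = w 0) : ∃ k : E → ℝ, MVKernel b μ k := by
  obtain ⟨e, he⟩ := exists_norm_eq E (by norm_num : (0 : ℝ) ≤ 1 / 4)
  have he0 : e ≠ 0 := by rw [← norm_pos_iff, he]; norm_num
  set K : E → ℝ := fundK c m with hK
  set ε := K e with hε
  have hεpos : 0 < ε := div_pos hc (by rw [he]; positivity)
  obtain ⟨θ, d, hθ, hθ0, hθ1, hθnn, -⟩ := exists_truncation hεpos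
  have hCO : closedBall (0 : E) (1 / 4) ⊆ ball 0 (1 / 2) := closedBall_subset_ball (by norm_num)
  have hKC : ∀ x : E, 1 / 4 < ‖x‖ → K x < ε := fun x hx => fundK_anti hc hm he0 (by rwa [he])
  have hKz : ∀ᶠ x in 𝓝[≠] (0 : E), 2 * ε < K x :=
    (tendsto_fundK hc hm).eventually (eventually_gt_atTop _)
  have hK0 : K 0 < ε := by rw [hK, fundK_zero c hm]; exact hεpos
  have hmean : ∀ H, Harm b (ball 0 (1 / 2)) H →
      ∫ x in ball 0 (1 / 2), deriv (deriv θ) (K x) * gip b K K x * H x ∂μ = H 0 := by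
    intro H hH
    refine green_mean μ b (fun x _ hx => sm_fundK c m hx)
      (fun x _ hx => Lap_fundK b c m hdim hx) isOpen_ball (isCompact_closedBall _ _) hCO
      (by simp) (fun x _ hx => hKC x (by simpa using hx)) hKz hK0 (fun w hw hwc _ => hfund w hw hwc)
      hθ hθ0 hθ1 (fun x hx => hH.sm hx) (fun x hx => (hH x hx).2)
  have hθ2 : ∀ s < ε, deriv (deriv θ) s = 0 := by
    intro s hs
    have h1 : θ =ᶠ[𝓝 s] fun _ => 0 := by
      filter_upwards [Iio_mem_nhds hs] with t ht using hθ0 t ht.le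
    rw [h1.deriv.deriv_eq]; simp
  have hθ3 : ∀ s, 2 * ε < s → deriv (deriv θ) s = 0 := by
    intro s hs
    have h1 : θ =ᶠ[𝓝 s] fun t => t - d := by
      filter_upwards [Ioi_mem_nhds hs] with t ht using hθ1 t (le_of_lt ht)
    have h2 : deriv θ =ᶠ[𝓝 s] fun _ => 1 := by
      refine h1.deriv.trans (Eventually.of_forall fun t => ?_)
      simp
    rw [h2.deriv_eq]; simp
  set k : E → ℝ := fun x => deriv (deriv θ) (K x) * gip b K K x with hk
  have hksupp : ∀ x, 1 / 4 < ‖x‖ → k x = 0 := fun x hx => by simp [hk, hθ2 _ (hKC x hx)]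
  have hk0 : k 0 = 0 := by simp [hk, hθ2 _ hK0]
  have h_int : ∀ H, Harm b (ball 0 (1 / 2)) H → ∫ x, k x * H x ∂μ = H 0 := by
    intro H hH
    rw [← hmean H hH]
    symm
    refine setIntegral_eq_integral_of_forall_compl_eq_zero fun x hx => ?_
    rw [hk] at hksupp
    have := hksupp x (by rw [mem_ball_zero_iff, not_lt] at hx; linarith)
    simp only at this
    rw [this, zero_mul]
  refine ⟨k, ⟨fun x => ?_, fun x => mul_nonneg (hθnn _) (gip_self_nonneg b _ _), hksupp,
    fun x y hxy => ?_, h_int, ?_⟩⟩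
  · by_cases hx : x = 0
    · have : k =ᶠ[𝓝 x] fun _ => 0 := by
        subst hx
        filter_upwards [eventually_nhdsWithin_iff.1 hKz] with y hy
        by_cases h : y = 0
        · rw [h, hk0]
        · simp [hk, hθ3 _ (hy h)]
      exact contDiffAt_const.congr_of_eventuallyEq this
    · have h1 : ContDiff ℝ (⊤ : ℕ∞) (deriv (deriv θ)) :=
        (contDiff_infty_iff_deriv.1 (contDiff_infty_iff_deriv.1 hθ).2).2
      exact (h1.contDiffAt.comp x (sm_fundK c m hx)).mul
        (sm_gip b (sm_fundK c m hx) (sm_fundK c m hx))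
  · by_cases hx : x = 0
    · have hy : y = 0 := by rw [← norm_eq_zero, ← hxy, hx, norm_zero]
      rw [hx, hy]
    · have hy : y ≠ 0 := by rw [← norm_ne_zero_iff, ← hxy]; exact norm_ne_zero_iff.2 hx
      simp only [hk, hK]
      rw [gip_fundK b c m hx, gip_fundK b c m hy, fundK, fundK, hxy]
  · by_contra! h
    have h0 : ∀ x, k x = 0 := fun x => by
      by_cases hx : x = 0
      · rw [hx, hk0]
      · exact le_antisymm (h x hx) (mul_nonneg (hθnn _) (gip_self_nonneg b _ _))
    have := h_int (fun _ => 1) (Harm.const _ _)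
    simp [h0] at this

variable {b μ} {k : E → ℝ}

namespace MVKernel

variable (hk : MVKernel b μ k)
include hk

omit [BorelSpace E] [μ.IsAddHaarMeasure] in
lemma cs : HasCompactSupport k := by
  refine HasCompactSupport.of_support_subset_isCompact (isCompact_closedBall (0 : E) (1 / 4)) ?_
  intro x hx
  by_contra h
  exact hx (hk.supp x (by simpa using h))

omit [FiniteDimensional ℝ E] [BorelSpace E] [μ.IsAddHaarMeasure] in
lemma tsupport_subset : tsupport k ⊆ closedBall 0 (1 / 4) := by
  refine closure_minimal (fun x hx => ?_) isClosed_closedBall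
  by_contra h
  exact hx (hk.supp x (by simpa using h))

omit [FiniteDimensional ℝ E] [BorelSpace E] [μ.IsAddHaarMeasure] in
lemma mean_scale {x : E} {ρ : ℝ} (hρ : 0 < ρ) {H : E → ℝ} (hH : Harm b (ball x ρ) H) :
    ∫ y, k y * H (x + ρ • y) ∂μ = H x := by
  have := hk.mean (fun y => H (x + ρ • y)) ((hH.scale x ρ).mono fun y hy => ?_)
  · simpa using this
  · simp only [mem_ofPred_eq, mem_ball, dist_eq_norm, sub_zero] at hy ⊢
    rw [add_sub_cancel_left, norm_smul, Real.norm_of_nonneg hρ.le]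
    nlinarith

/-- Interior gradient estimate. -/
theorem grad_est : ∃ C, 0 ≤ C ∧ ∀ (x : E) (ρ M : ℝ) (H : E → ℝ), 0 < ρ → Harm b (ball x ρ) H →
    (∀ y ∈ ball x ρ, |H y| ≤ M) → ∀ v, |pd v H x| ≤ C * M / ρ * ‖v‖ := by
  refine ⟨∫ y, ‖fderiv ℝ k y‖ ∂μ, integral_nonneg fun _ => norm_nonneg _, ?_⟩
  intro x ρ M H hρ hH hM v
  have hmem : ∀ y ∈ ball (0 : E) (1 / 2), x + ρ • y ∈ ball x ρ := fun y hy => by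
    simp only [mem_ball, dist_eq_norm, sub_zero] at hy ⊢
    rw [add_sub_cancel_left, norm_smul, Real.norm_of_nonneg hρ.le]
    nlinarith
  set h : E → ℝ := fun y => H (x + ρ • y) with hh
  have hharm : Harm b (ball 0 (1 / 2)) h := (hH.scale x ρ).mono hmem
  have hts : tsupport k ⊆ ball 0 (1 / 2) :=
    hk.tsupport_subset.trans (closedBall_subset_ball (by norm_num))
  have h1 := hk.mean _ (hharm.pd isOpen_ball v)
  have h2 : pd v h 0 = ρ * pd v H x := by
    rw [hh, pd_scale]
    · simp
    · simpa using sm_diff (hH.sm (mem_ball_self hρ))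
  have hS : ∀ y, 𝒞 (fun y => h y * k y) y := sm_mul_supp hk.sm fun y hy => hharm.sm (hts hy)
  have h3 := integral_pd_eq_zero μ hS (cs_mul hk.cs) v
  have h4 : ∀ y, pd v (fun y => h y * k y) y = k y * pd v h y + h y * pd v k y := by
    intro y
    by_cases hy : y ∈ tsupport k
    · rw [pd_mul (sm_diff (hharm.sm (hts hy))) (sm_diff (hk.sm y))]; ring
    · rw [pd_eq_zero_of_notMem fun h' => hy (tsupport_mul_subset' _ _ h'),
        pd_eq_zero_of_notMem hy, image_eq_zero_of_notMem_tsupport hy]; ring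
  have hI1 : Integrable (fun y => k y * pd v h y) μ := by
    have : Integrable (fun y => pd v h y * k y) μ := integrable_cs μ (fun y =>
      (sm_mul_supp hk.sm (fun y hy => sm_pd (hharm.sm (hts hy)) v) y).continuousAt) (cs_mul hk.cs)
    simpa only [mul_comm] using this
  have hI2 : Integrable (fun y => h y * pd v k y) μ := integrable_cs μ (fun y =>
      (sm_mul_supp (fun y => sm_pd (hk.sm y) v)
        (fun y hy => hharm.sm (hts (tsupport_pd_subset _ _ hy))) y).continuousAt)
        (cs_mul (cs_pd hk.cs v))
  simp only [h4] at h3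
  rw [integral_add hI1 hI2, h1, h2] at h3
  have hM0 : 0 ≤ M := (abs_nonneg _).trans (hM x (mem_ball_self hρ))
  have hIf : Integrable (fun y => ‖fderiv ℝ k y‖) μ := by
    refine Continuous.integrable_of_hasCompactSupport ?_ (hk.cs.fderiv (𝕜 := ℝ)).norm
    exact (continuous_iff_continuousAt.2 fun y => (sm_fderiv (hk.sm y)).continuousAt).norm
  have h5 : |∫ y, h y * pd v k y ∂μ| ≤ ∫ y, M * ‖v‖ * ‖fderiv ℝ k y‖ ∂μ := by
    rw [← Real.norm_eq_abs]
    refine norm_integral_le_of_norm_le (hIf.const_mul _) (Eventually.of_forall fun y => ?_)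
    by_cases hy : y ∈ tsupport k
    · rw [norm_mul]
      have := hM _ (hmem y (hts hy))
      have h6 : ‖pd v k y‖ ≤ ‖fderiv ℝ k y‖ * ‖v‖ := (fderiv ℝ k y).le_opNorm v
      calc ‖h y‖ * ‖pd v k y‖ ≤ M * (‖fderiv ℝ k y‖ * ‖v‖) := by
            gcongr; exact this
        _ = _ := by ring
    · rw [pd_eq_zero_of_notMem hy, mul_zero, norm_zero]; positivity
  rw [integral_const_mul] at h5
  have h7 : |pd v H x| * ρ ≤ M * ‖v‖ * ∫ y, ‖fderiv ℝ k y‖ ∂μ := by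
    calc |pd v H x| * ρ = |ρ * pd v H x| := by rw [abs_mul, abs_of_pos hρ, mul_comm]
      _ = |∫ y, h y * pd v k y ∂μ| := by
        rw [show ρ * pd v H x = -∫ y, h y * pd v k y ∂μ by linarith, abs_neg]
      _ ≤ _ := h5
  rw [div_mul_eq_mul_div, le_div_iff₀ hρ]
  linarith

end MVKernel

end Kernel

section Domain

variable {E : Type*} [NormedAddCommGroup E] [InnerProductSpace ℝ E]
  {ι : Type*} [Fintype ι] (b : OrthonormalBasis ι ℝ E)

/-- The domain defined by `l`. -/
def Om (l : E → ℝ) : Set E := {x | 0 < l x}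

/-- `l` is a compactly supported smooth function which defines a pseudoconvex domain with a
uniform collar near its boundary; `-l` is plurisubharmonic on the domain. -/
structure Dom (J : E ≃ₗᵢ[ℝ] E) (l : E → ℝ) : Prop where
  J_sq : ∀ x, J (J x) = -x
  sm : ∀ x, 𝒞 l x
  cs : HasCompactSupport l
  conn : IsPreconnected (Om l)
  levi : ∀ x ∈ Om l, ∀ v, hess l x v v + hess l x (J v) (J v) ≤ 0
  collar : ∃ a > 0, ∃ c > 0, ∀ x ∈ Om l, l x ≤ a → c ≤ gip b l l x

variable {b} {J : E ≃ₗᵢ[ℝ] E} {l : E → ℝ}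

namespace Dom

variable (hl : Dom b J l)
include hl

lemma cont : Continuous l := continuous_iff_continuousAt.2 fun x => (hl.sm x).continuousAt

lemma isOpen : IsOpen (Om l) := isOpen_lt continuous_const hl.cont

lemma isCompact_ge {s : ℝ} (hs : 0 < s) : IsCompact {x | s ≤ l x} := by
  refine hl.cs.isCompact.of_isClosed_subset (isClosed_le continuous_const hl.cont) fun x hx => ?_
  exact subset_tsupport _ (ne_of_gt (hs.trans_le hx))

lemma isCompact_band {s : ℝ} (hs : 0 < s) (a : ℝ) : IsCompact {x | s ≤ l x ∧ l x ≤ a} :=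
  (hl.isCompact_ge hs).inter_right (isClosed_le hl.cont continuous_const)

lemma Lap_le {x : E} (hx : x ∈ Om l) : Lap b l x ≤ 0 := by
  have h := Finset.sum_nonpos fun i (_ : i ∈ Finset.univ) => hl.levi x hx (b i)
  rw [Finset.sum_add_distrib, sum_bilin_isometry b (hess l x) J, ← Lap_hess b (hl.sm x)] at h
  linarith

lemma max_Om [Nonempty ι] {O : Set E} (hO : IsOpen O) (hOm : O ⊆ Om l) {u : E → ℝ}
    (hu : ∀ x ∈ O, 𝒞 u x) (hL : ∀ x ∈ O, 0 ≤ Lap b u x)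
    (hb : ∀ ε > 0, ∃ D, IsClosed D ∧ D ∩ Om l ⊆ O ∧ ∃ s > 0, ∀ x ∈ O, x ∉ D ∨ l x < s → u x ≤ ε) :
    ∀ x ∈ O, u x ≤ 0 := by
  refine max_principle_open b hO hu hL fun ε hε => ?_
  obtain ⟨D, hD, hDO, s, hs, h⟩ := hb ε hε
  refine ⟨D ∩ {x | s ≤ l x}, fun x hx => hDO ⟨hx.1, hs.trans_le hx.2⟩,
    (hl.isCompact_ge hs).inter_left hD, fun x hx => h x hx.1 ?_⟩
  by_contra! hcon
  exact hx.2 hcon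

/-- Comparison on a band between two levels of the defining function. -/
lemma band_compare [Nonempty ι] {s a : ℝ} (hs : 0 < s) {u : E → ℝ}
    (hu : ∀ x, s ≤ l x → l x ≤ a → 𝒞 u x) (h1 : ∀ x, l x = s → u x ≤ 0)
    (h2 : ∀ x, l x = a → u x ≤ 0) (hL : ∀ x, s < l x → l x < a → 0 ≤ Lap b u x) :
    ∀ x, s ≤ l x → l x ≤ a → u x ≤ 0 := by
  intro x hx hx'
  refine max_principle b (hl.isCompact_band hs a) (u := u)
    (fun y hy => (hu y hy.1 hy.2).continuousAt.continuousWithinAt) (fun y hy => ?_) x ⟨hx, hx'⟩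
  rcases hy.1.eq_or_lt with h | h
  · exact Or.inl (h1 y h.symm)
  rcases hy.2.eq_or_lt with h' | h'
  · exact Or.inl (h2 y h')
  refine Or.inr ⟨?_, hu y hy.1 hy.2, hL y h h'⟩
  filter_upwards [hl.cont.continuousAt.eventually (lt_mem_nhds h),
    hl.cont.continuousAt.eventually (gt_mem_nhds h')] with w hw hw' using ⟨hw.le, hw'.le⟩

lemma exists_lip [FiniteDimensional ℝ E] : ∃ L > 0, ∀ x y, |l x - l y| ≤ L * ‖x - y‖ := by
  have hd : ∀ x, DifferentiableAt ℝ l x := fun x => sm_diff (hl.sm x)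
  have hc : Continuous (fderiv ℝ l) :=
    continuous_iff_continuousAt.2 fun x => (sm_fderiv (hl.sm x)).continuousAt
  obtain ⟨L, hL⟩ := hc.bounded_above_of_compact_support (hl.cs.fderiv (𝕜 := ℝ))
  refine ⟨max L 1, by positivity, fun x y => ?_⟩
  have := convex_univ.norm_image_sub_le_of_norm_fderiv_le (𝕜 := ℝ) (f := l) (C := L)
    (fun z _ => hd z) (fun z _ => hL z) (mem_univ y) (mem_univ x)
  rw [Real.norm_eq_abs] at this
  exact this.trans (by gcongr; exact le_max_left _ _)

/-- Balls of radius comparable to the defining function. -/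
lemma exists_rad [FiniteDimensional ℝ E] : ∃ κ > 0, ∀ x ∈ Om l, ∀ y ∈ ball x (κ * l x),
    l x / 2 < l y ∧ l y < 2 * l x := by
  obtain ⟨L, hL, h⟩ := hl.exists_lip
  refine ⟨1 / (2 * L), by positivity, fun x hx y hy => ?_⟩
  have hx : 0 < l x := hx
  rw [mem_ball_iff_norm] at hy
  have h1 : |l y - l x| < l x / 2 := by
    refine (h y x).trans_lt ?_
    calc L * ‖y - x‖ < L * (1 / (2 * L) * l x) := by gcongr
      _ = l x / 2 := by field_simp
  rw [abs_lt] at h1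
  constructor <;> linarith [h1.1, h1.2]

end Dom

end Domain

section GreenSystem

variable {E : Type*} [NormedAddCommGroup E] [InnerProductSpace ℝ E]
  {ι : Type*} [Fintype ι] {b : OrthonormalBasis ι ℝ E}

lemma Harm.translate {O : Set E} {H : E → ℝ} (h : Harm b O H) (a : E) :
    Harm b {y | y - a ∈ O} (fun y => H (y - a)) := by
  have := h.scale (-a) 1
  simpa [neg_add_eq_sub] using this

lemma Harm_fundK_sub (c : ℝ) (m : ℕ) (hdim : Fintype.card ι = 2 * m + 2) (z : E) :
    Harm b {z}ᶜ (fun x => fundK c m (x - z)) :=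
  ((Harm_fundK b c m hdim).translate z).mono fun _ hx => sub_ne_zero.2 hx

omit [InnerProductSpace ℝ E] in
lemma fundK_neg (c : ℝ) (m : ℕ) (x : E) : fundK c m (-x) = fundK c m x := by
  simp [fundK]

omit [InnerProductSpace ℝ E] in
lemma fundK_sub_comm (c : ℝ) (m : ℕ) (x y : E) : fundK c m (x - y) = fundK c m (y - x) := by
  rw [← fundK_neg, neg_sub]

lemma tendsto_fundK_sub {c : ℝ} (hc : 0 < c) {m : ℕ} (hm : 1 ≤ m) (z : E) :
    Tendsto (fun x => fundK c m (x - z)) (𝓝[≠] z) atTop := by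
  refine (tendsto_fundK hc hm).comp (tendsto_nhdsWithin_iff.2 ⟨?_, ?_⟩)
  · have : Tendsto (fun x => x - z) (𝓝 z) (𝓝 (z - z)) := tendsto_id.sub_const z
    rw [sub_self] at this
    exact this.mono_left nhdsWithin_le_nhds
  · filter_upwards [self_mem_nhdsWithin] with x hx using sub_ne_zero.2 hx

omit [InnerProductSpace ℝ E] in
lemma fundK_le {c : ℝ} (hc : 0 < c) {m : ℕ} {ρ : ℝ} (hρ : 0 < ρ) {x : E} (h : ρ ≤ ‖x‖) :
    fundK c m x ≤ c / ρ ^ (2 * m) := by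
  unfold fundK; gcongr

variable (b) (J : E ≃ₗᵢ[ℝ] E)
  [MeasurableSpace E] (μ : Measure E)

/-- The Green functions of the domain defined by `l`, with their harmonic parts `ψ z`. -/
structure GreenSys (l : E → ℝ) (c : ℝ) (m : ℕ) (ψ : E → E → ℝ) : Prop where
  dom : Dom b J l
  c_pos : 0 < c
  m_pos : 1 ≤ m
  dim : Fintype.card ι = 2 * m + 2
  fund : ∀ w : E → ℝ, ContDiff ℝ (⊤ : ℕ∞) w → HasCompactSupport w →
    ∫ x, -(fundK c m x) * Lap b w x ∂μ = w 0
  harm : ∀ z ∈ Om l, Harm b (Om l) (ψ z)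
  bd : ∀ z ∈ Om l, ∀ ε > 0, ∃ s > 0, ∀ x ∈ Om l, l x < s → |fundK c m (x - z) - ψ z x| ≤ ε
  int : ∀ z ∈ Om l, ∀ w : E → ℝ, ContDiff ℝ (⊤ : ℕ∞) w → HasCompactSupport w →
    tsupport w ⊆ Om l → ∫ x, -(fundK c m (x - z) - ψ z x) * Lap b w x ∂μ = w z

/-- The positive Green function. -/
def gr (c : ℝ) (m : ℕ) (ψ : E → E → ℝ) (z x : E) : ℝ := fundK c m (x - z) - ψ z x

variable {b J μ}
  {l : E → ℝ} {c : ℝ} {m : ℕ} {ψ : E → E → ℝ}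

namespace GreenSys

variable (hG : GreenSys b J μ l c m ψ)
include hG

lemma nonempty : Nonempty ι := Fintype.card_pos_iff.1 (by rw [hG.dim]; omega)

lemma nontrivial : Nontrivial E := by
  obtain ⟨i⟩ := hG.nonempty
  refine ⟨b i, 0, fun h => ?_⟩
  have := b.orthonormal.1 i
  simp [h] at this

lemma isOpen : IsOpen (Om l) := hG.dom.isOpen

lemma gr_harm {z : E} (hz : z ∈ Om l) : Harm b (Om l \ {z}) (gr c m ψ z) :=
  ((Harm_fundK_sub c m hG.dim z).mono fun _ hx => hx.2).sub ((hG.harm z hz).mono sdiff_subset)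

lemma gr_bd {z : E} (hz : z ∈ Om l) {ε : ℝ} (hε : 0 < ε) :
    ∃ s > 0, s < l z ∧ ∀ x ∈ Om l, l x < s → |gr c m ψ z x| ≤ ε := by
  obtain ⟨s, hs, h⟩ := hG.bd z hz ε hε
  have hz : 0 < l z := hz
  exact ⟨min s (l z / 2), by positivity, (min_le_right _ _).trans_lt (half_lt_self hz),
    fun x hx hx' => h x hx (hx'.trans_le (min_le_left _ _))⟩

lemma tendsto_gr {z : E} (hz : z ∈ Om l) : Tendsto (gr c m ψ z) (𝓝[≠] z) atTop := by
  refine tendsto_atTop_add_right_of_le' _ (-(ψ z z + 1)) (tendsto_fundK_sub hG.c_pos hG.m_pos z) ?_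
  have := ((hG.harm z hz).sm hz).continuousAt.eventually (gt_mem_nhds (lt_add_one (ψ z z)))
  filter_upwards [mem_nhdsWithin_of_mem_nhds this] with x hx using neg_le_neg hx.le

lemma exists_radius : ∃ R > 0, ∀ x ∈ Om l, ∀ y ∈ Om l, ‖x - y‖ ≤ R := by
  obtain ⟨R, hR⟩ := (isBounded_iff_forall_norm_le.1 hG.dom.cs.isCompact.isBounded)
  have hR' : ∀ x ∈ Om l, ‖x‖ ≤ R := fun x hx => hR x (subset_tsupport _ (ne_of_gt hx))
  refine ⟨2 * |R| + 1, by positivity, fun x hx y hy => ?_⟩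
  linarith [norm_sub_le x y, hR' x hx, hR' y hy, le_abs_self R]

lemma psi_pos {z x : E} (hz : z ∈ Om l) (hx : x ∈ Om l) : 0 < ψ z x := by
  have := hG.nonempty
  obtain ⟨R, hR, hR'⟩ := hG.exists_radius
  have hc := hG.c_pos
  have key := hG.dom.max_Om hG.isOpen subset_rfl (u := fun x => c / R ^ (2 * m) - ψ z x)
    (fun x hx => contDiffAt_const.sub ((hG.harm z hz).sm hx))
    (fun x hx => by
      rw [Lap_sub b contDiffAt_const ((hG.harm z hz).sm hx), (hG.harm z hz x hx).2, Lap_const]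
      simp) (fun ε hε => ?_) x hx
  · have : 0 < c / R ^ (2 * m) := by positivity
    linarith
  · obtain ⟨s, hs, hsz, h⟩ := hG.gr_bd hz hε
    refine ⟨univ, isClosed_univ, by simp, s, hs, fun x hx hxs => ?_⟩
    have hxs : l x < s := by simpa using hxs
    have hne : x ≠ z := by rintro rfl; linarith
    have h1 := (abs_le.1 (h x hx hxs)).2
    have h2 : c / R ^ (2 * m) ≤ fundK c m (x - z) := by
      have := norm_pos_iff.2 (sub_ne_zero.2 hne)
      unfold fundK
      gcongr
      exact hR' x hx z hz
    simp only [gr] at h1 ⊢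
    linarith

lemma gr_self {z : E} (hz : z ∈ Om l) : gr c m ψ z z < 0 := by
  have := hG.psi_pos hz hz
  simpa [gr, fundK_zero c hG.m_pos] using this

lemma gr_nonneg {z x : E} (hz : z ∈ Om l) (hx : x ∈ Om l) (hxz : x ≠ z) : 0 ≤ gr c m ψ z x := by
  have := hG.nonempty
  have hh := hG.gr_harm hz
  have key := hG.dom.max_Om (O := Om l \ {z}) (hG.isOpen.sdiff isClosed_singleton) sdiff_subset
    (u := fun x => -gr c m ψ z x)
    (fun x hx => (hh.sm hx).neg)
    (fun x hx => by rw [Lap_neg b (hh.sm hx), (hh x hx).2, neg_zero]) (fun ε hε => ?_) x ⟨hx, hxz⟩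
  · linarith
  · obtain ⟨s, hs, hsz, h⟩ := hG.gr_bd hz hε
    have h1 := (hG.tendsto_gr hz).eventually_ge_atTop 0
    rw [eventually_nhdsWithin_iff, _root_.eventually_nhds_iff] at h1
    obtain ⟨U, hU, hUo, hzU⟩ := h1
    refine ⟨Uᶜ, hUo.isClosed_compl, fun y hy => ⟨hy.2, fun hyz => hy.1 (by simpa [mem_singleton_iff.1 hyz] using hzU)⟩,
      s, hs, fun x hx hxs => ?_⟩
    rcases hxs with hxs | hxs
    · have := hU x (not_not.1 hxs) hx.2
      linarith
    · linarith [(abs_le.1 (h x hx.1 hxs)).1]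

variable [FiniteDimensional ℝ E] [BorelSpace E] [μ.IsAddHaarMeasure]

lemma exists_ker : ∃ k : E → ℝ, MVKernel b μ k := by
  have := hG.nontrivial
  exact exists_MVKernel b μ hG.c_pos hG.m_pos hG.dim hG.fund

end GreenSys

end GreenSystem

section Symmetry

variable {E : Type*} [NormedAddCommGroup E] [InnerProductSpace ℝ E]
  {ι : Type*} [Fintype ι] {b : OrthonormalBasis ι ℝ E} {J : E ≃ₗᵢ[ℝ] E}
  [MeasurableSpace E] {μ : Measure E}
  {l : E → ℝ} {c : ℝ} {m : ℕ} {ψ : E → E → ℝ}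
  [FiniteDimensional ℝ E] [BorelSpace E] [μ.IsAddHaarMeasure]

lemma deriv2_zero_left {θ : ℝ → ℝ} {ε : ℝ} (h : ∀ s ≤ ε, θ s = 0) {s : ℝ} (hs : s < ε) :
    deriv (deriv θ) s = 0 := by
  have h1 : θ =ᶠ[𝓝 s] fun _ => 0 := by
    filter_upwards [Iio_mem_nhds hs] with t ht using h t ht.le
  rw [h1.deriv.deriv_eq]; simp

lemma deriv2_zero_right {θ : ℝ → ℝ} {ε d : ℝ} (h : ∀ s, 2 * ε ≤ s → θ s = s - d) {s : ℝ}
    (hs : 2 * ε < s) : deriv (deriv θ) s = 0 := by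
  have h1 : θ =ᶠ[𝓝 s] fun t => t - d := by
    filter_upwards [Ioi_mem_nhds hs] with t ht using h t (le_of_lt ht)
  have h2 : deriv θ =ᶠ[𝓝 s] fun _ => 1 := by
    refine h1.deriv.trans (Eventually.of_forall fun t => ?_)
    simp
  rw [h2.deriv_eq]; simp

/-- A nonnegative harmonic function vanishing at a point vanishes near it. -/
lemma MVKernel.eventually_eq_zero {k : E → ℝ} (hk : MVKernel b μ k) {x : E} {ρ : ℝ} (hρ : 0 < ρ)
    {H : E → ℝ} (hH : Harm b (ball x ρ) H) (hnn : ∀ y ∈ ball x ρ, 0 ≤ H y) (hx : H x = 0) :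
    ∀ᶠ y in 𝓝 x, H y = 0 := by
  obtain ⟨e, he, hke⟩ := hk.pos
  have he' : 0 < ‖e‖ := norm_pos_iff.2 he
  have hzero : ∀ ρ', 0 < ρ' → ρ' ≤ ρ → ∀ v : E, ‖v‖ = ‖e‖ → H (x + ρ' • v) = 0 := by
    intro ρ' h0 h1 v hv
    have hH' : Harm b (ball x ρ') H := hH.mono (ball_subset_ball h1)
    have hin : ∀ y ∈ closedBall (0 : E) (1 / 4), x + ρ' • y ∈ ball x ρ' := fun y hy => by
      have : ‖y‖ ≤ 1 / 4 := by simpa using hy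
      simp only [mem_ball_iff_norm, add_sub_cancel_left, norm_smul, Real.norm_of_nonneg h0.le]
      nlinarith
    by_contra hne
    have hsm : ∀ y, 𝒞 (fun y => H (x + ρ' • y) * k y) y := fun y => by
      refine sm_mul_supp (Γ := fun y => H (x + ρ' • y)) hk.sm (fun y hy => ?_) y
      exact sm_scale (hH'.sm (hin y (hk.tsupport_subset hy)))
    have hpos := Continuous.integral_pos_of_hasCompactSupport_nonneg_nonzero (μ := μ)
      (f := fun y => H (x + ρ' • y) * k y) (x := v)
      (continuous_iff_continuousAt.2 fun y => (hsm y).continuousAt) (cs_mul hk.cs)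
      (fun y => ?_) (mul_ne_zero hne (by rw [hk.radial v e hv]; exact hke.ne'))
    · have h2 := hk.mean_scale h0 hH'
      simp only [mul_comm (k _)] at h2
      rw [h2, hx] at hpos
      exact lt_irrefl _ hpos
    · by_cases hy : y ∈ closedBall (0 : E) (1 / 4)
      · exact mul_nonneg (hnn _ (ball_subset_ball h1 (hin y hy))) (hk.nonneg y)
      · have : k y = 0 := hk.supp y (by simpa using hy)
        simp [this]
  filter_upwards [ball_mem_nhds x (mul_pos hρ he')] with y hy
  by_cases hyx : y = x
  · rw [hyx, hx]
  have hn : 0 < ‖y - x‖ := norm_pos_iff.2 (sub_ne_zero.2 hyx)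
  rw [mem_ball_iff_norm] at hy
  have := hzero (‖y - x‖ / ‖e‖) (by positivity) (by rw [div_le_iff₀ he']; exact hy.le)
    ((‖e‖ / ‖y - x‖) • (y - x)) (by rw [norm_smul, norm_div, norm_norm, norm_norm]; field_simp)
  rwa [smul_smul, div_mul_div_comm, mul_comm ‖e‖, div_self (by positivity), one_smul,
    add_sub_cancel] at this

omit [FiniteDimensional ℝ E] in
lemma fund_translate {c : ℝ} {m : ℕ}
    (hf : ∀ w : E → ℝ, ContDiff ℝ (⊤ : ℕ∞) w → HasCompactSupport w →
      ∫ x, -(fundK c m x) * Lap b w x ∂μ = w 0) (z : E) {w : E → ℝ}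
    (hw : ContDiff ℝ (⊤ : ℕ∞) w) (hc : HasCompactSupport w) :
    ∫ x, -(fundK c m (x - z)) * Lap b w x ∂μ = w z := by
  have h := hf (fun y => w (z + (1 : ℝ) • y)) (by fun_prop) (by
    simpa [Function.comp_def] using hc.comp_homeomorph (Homeomorph.addLeft z))
  simp only [smul_zero, add_zero] at h
  rw [← h, ← integral_add_left_eq_self _ z]
  refine integral_congr_ae (Eventually.of_forall fun y => ?_)
  change _ = -fundK c m y * Lap b (fun y => w (z + (1 : ℝ) • y)) y
  rw [Lap_scale b hw.contDiffAt]
  simp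

namespace GreenSys

variable (hG : GreenSys b J μ l c m ψ)
include hG

lemma gr_pos {z x : E} (hz : z ∈ Om l) (hx : x ∈ Om l) (hxz : x ≠ z) : 0 < gr c m ψ z x := by
  obtain ⟨k, hk⟩ := hG.exists_ker
  by_contra hcon
  have hx0 : gr c m ψ z x = 0 := le_antisymm (not_lt.1 hcon) (hG.gr_nonneg hz hx hxz)
  have ho : IsOpen (Om l \ {z}) := hG.isOpen.sdiff isClosed_singleton
  have hh := hG.gr_harm hz
  let U : Set E := {x | x ∈ Om l ∧ (x = z ∨ 0 < gr c m ψ z x)}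
  let Z : Set E := {x | x ∈ Om l \ {z} ∧ gr c m ψ z x = 0}
  have hU : IsOpen U := by
    rw [isOpen_iff_mem_nhds]
    rintro y ⟨hy, hy'⟩
    by_cases hyz : y = z
    · subst hyz
      have := eventually_nhdsWithin_iff.1 ((hG.tendsto_gr hy).eventually_gt_atTop 0)
      filter_upwards [hG.isOpen.mem_nhds hy, this] with w hw hw'
      exact ⟨hw, or_iff_not_imp_left.2 fun h => hw' h⟩
    · filter_upwards [hG.isOpen.mem_nhds hy, (hh.sm ⟨hy, hyz⟩).continuousAt.eventually
        (lt_mem_nhds (hy'.resolve_left hyz))] with w hw hw' using ⟨hw, Or.inr hw'⟩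
  have hZ : IsOpen Z := by
    rw [isOpen_iff_mem_nhds]
    rintro y ⟨hy, hy'⟩
    obtain ⟨ρ, hρ, hb⟩ := Metric.isOpen_iff.1 ho y hy
    filter_upwards [ho.mem_nhds hy, hk.eventually_eq_zero hρ (hh.mono hb)
      (fun w hw => hG.gr_nonneg hz (hb hw).1 (hb hw).2) hy'] with w hw hw' using ⟨hw, hw'⟩
  obtain ⟨y, -, hyU, hyZ⟩ := hG.dom.conn U Z hU hZ (fun y hy => by
    by_cases hyz : y = z
    · exact Or.inl ⟨hy, Or.inl hyz⟩
    rcases (hG.gr_nonneg hz hy hyz).eq_or_lt with h | h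
    · exact Or.inr ⟨⟨hy, hyz⟩, h.symm⟩
    · exact Or.inl ⟨hy, Or.inr h⟩) ⟨z, hz, hz, Or.inl rfl⟩ ⟨x, hx, ⟨hx, hxz⟩, hx0⟩
  rcases hyU.2 with h | h
  · exact hyZ.1.2 h
  · exact h.ne' hyZ.2

lemma repr {z : E} (hz : z ∈ Om l) {ε d : ℝ} (hε : 0 < ε) {θ : ℝ → ℝ}
    (hθ : ContDiff ℝ (⊤ : ℕ∞) θ) (hθ0 : ∀ s ≤ ε, θ s = 0)
    (hθ1 : ∀ s, 2 * ε ≤ s → θ s = s - d) {H : E → ℝ} (hH : ∀ x ∈ Om l, 𝒞 H x)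
    (hHz : ∀ᶠ x in 𝓝 z, Lap b H x = 0) :
    ∫ x in Om l, deriv (deriv θ) (gr c m ψ z x) * gip b (gr c m ψ z) (gr c m ψ z) x * H x ∂μ =
      H z + ∫ x in Om l, θ (gr c m ψ z x) * Lap b H x ∂μ := by
  have := hG.nontrivial
  obtain ⟨s, hs, hsz, h⟩ := hG.gr_bd hz (half_pos hε)
  refine green_repr μ b (C := {x | s ≤ l x}) (fun x hx hxz => (hG.gr_harm hz).sm ⟨hx, hxz⟩)
    (fun x hx hxz => (hG.gr_harm hz x ⟨hx, hxz⟩).2) hG.isOpen (hG.dom.isCompact_ge hs)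
    (fun x hx => hs.trans_le hx) hsz.le (fun x hx hxC => ?_)
    ((hG.tendsto_gr hz).eventually_gt_atTop _) ((hG.gr_self hz).trans hε) (hG.int z hz)
    hθ hθ0 hθ1 hH hHz
  linarith [le_abs_self (gr c m ψ z x), h x hx (not_le.1 hxC)]

lemma mean {z : E} (hz : z ∈ Om l) {ε d : ℝ} (hε : 0 < ε) {θ : ℝ → ℝ}
    (hθ : ContDiff ℝ (⊤ : ℕ∞) θ) (hθ0 : ∀ s ≤ ε, θ s = 0)
    (hθ1 : ∀ s, 2 * ε ≤ s → θ s = s - d) {H : E → ℝ} (hH : Harm b (Om l) H) :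
    ∫ x in Om l, deriv (deriv θ) (gr c m ψ z x) * gip b (gr c m ψ z) (gr c m ψ z) x * H x ∂μ =
      H z := by
  rw [hG.repr hz hε hθ hθ0 hθ1 (fun x hx => hH.sm hx)
    (by filter_upwards [hG.isOpen.mem_nhds hz] with x hx using (hH x hx).2),
    setIntegral_congr_fun (g := fun _ => (0 : ℝ)) hG.isOpen.measurableSet fun x hx => ?_]
  · simp
  · simp [(hH x hx).2]

open scoped Classical in
lemma psi_symm_le {z w : E} (hz : z ∈ Om l) (hw : w ∈ Om l) (hzw : z ≠ w) : ψ w z ≤ ψ z w := by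
  have hnt := hG.nontrivial
  refine le_of_forall_pos_le_add fun η hη => ?_
  have hgw := hG.gr_pos hz hw hzw.symm
  set g := gr c m ψ z with hg
  set ε := min (η / 2) (g w / 4) with hε
  have hε0 : 0 < ε := lt_min (half_pos hη) (by linarith)
  have hεg : 2 * ε < g w := by linarith [min_le_right (η / 2) (g w / 4)]
  have hεη : 2 * ε ≤ η := by linarith [min_le_left (η / 2) (g w / 4)]
  have hgh := hG.gr_harm hz
  obtain ⟨r, hr, hrb⟩ : ∃ r > 0, ∀ x ∈ ball w r, (x ∈ Om l \ {z}) ∧ 2 * ε < g x := by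
    have ho : IsOpen (Om l \ {z}) := hG.isOpen.sdiff isClosed_singleton
    exact Metric.eventually_nhds_iff_ball.1 ((ho.eventually_mem (x := w) ⟨hw, hzw.symm⟩).and
      ((hgh.sm ⟨hw, hzw.symm⟩).continuousAt.eventually (lt_mem_nhds hεg)))
  obtain ⟨θ, d, hθ, hθ0, hθ1, hθnn, hθm⟩ := exists_truncation hε0
  have hd : d ≤ 2 * ε := by
    have hmono : Monotone θ := monotone_of_deriv_nonneg (hθ.differentiable (by simp)) hθm
    have := hmono (show ε ≤ 2 * ε by linarith)
    rw [hθ0 ε le_rfl, hθ1 _ le_rfl] at this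
    linarith
  set K : E → ℝ := fun x => fundK c m (x - w) with hK
  have hKh := Harm_fundK_sub (b := b) c m hG.dim w
  obtain ⟨e, he⟩ := exists_norm_eq E (half_pos hr).le
  have he0 : e ≠ 0 := by rw [← norm_pos_iff, he]; exact half_pos hr
  set ε₁ : ℝ := fundK c m e with hε₁
  have hε₁0 : 0 < ε₁ := div_pos hG.c_pos (by rw [he]; positivity)
  obtain ⟨θ₁, d₁, hθ', hθ0', hθ1', hθnn', hθm'⟩ := exists_truncation hε₁0
  have hKC : ∀ x, r / 2 < ‖x - w‖ → K x < ε₁ := fun x hx =>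
    fundK_anti hG.c_pos hG.m_pos he0 (by rwa [he])
  have hKw : K w = 0 := by simp [hK, fundK_zero c hG.m_pos]
  have hKz : ∀ᶠ x in 𝓝[≠] w, 2 * ε₁ < K x :=
    (tendsto_fundK_sub hG.c_pos hG.m_pos w).eventually_gt_atTop _
  set L : E → ℝ := fun x => if x = w then d₁ else K x - θ₁ (K x) with hL
  have hLw : L =ᶠ[𝓝 w] fun _ => d₁ := by
    filter_upwards [eventually_nhdsWithin_iff.1 hKz] with x hx
    by_cases h : x = w
    · simp [hL, h]
    · simp [hL, h, hθ1' _ (hx h).le]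
  have hLne : ∀ x, x ≠ w → L =ᶠ[𝓝 x] fun y => K y - θ₁ (K y) := fun x hx => by
    filter_upwards [isOpen_ne.mem_nhds hx] with y hy
    simp [hL, show y ≠ w from hy]
  have hθK : ∀ x, x ≠ w → 𝒞 (fun y => θ₁ (K y)) x := fun x hx =>
    hθ'.contDiffAt.comp x (hKh.sm hx)
  have hLs : ∀ x, 𝒞 L x := fun x => by
    by_cases h : x = w
    · subst h; exact contDiffAt_const.congr_of_eventuallyEq hLw
    · exact ((hKh.sm h).sub (hθK x h)).congr_of_eventuallyEq (hLne x h)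
  have hLap : ∀ x, Lap b L x = - (deriv (deriv θ₁) (K x) * gip b K K x) := fun x => by
    by_cases h : x = w
    · subst h
      rw [Lap_congr b hLw, Lap_const, hKw, deriv2_zero_left hθ0' hε₁0]; simp
    · rw [Lap_congr b (hLne x h), Lap_sub b (hKh.sm h) (hθK x h), Lap_comp b hθ'.contDiffAt
        (hKh.sm h), (hKh x h).2]
      ring
  have hLapout : ∀ x, r / 2 < ‖x - w‖ → Lap b L x = 0 := fun x hx => by
    rw [hLap, deriv2_zero_left hθ0' (hKC x hx)]; simp
  have hzout : z ∉ ball w r := fun h => (hrb z h).1.2 rfl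
  have hLout : ∀ x, x ∉ ball w r → L x = K x := fun x hx => by
    rw [mem_ball_iff_norm, not_lt] at hx
    have hxw : x ≠ w := by rintro rfl; simp at hx; linarith
    simp [hL, hxw, hθ0' _ (hKC x (by linarith)).le]
  have hψw := hG.harm w hw
  have key := hG.repr hz hε0 hθ hθ0 hθ1 (H := fun x => L x - ψ w x)
    (fun x hx => (hLs x).sub (hψw.sm hx)) (by
      have h1 : ∀ᶠ x in 𝓝 z, r / 2 < ‖x - w‖ := by
        refine (by fun_prop : ContinuousAt (fun x => ‖x - w‖) z).eventually (lt_mem_nhds ?_)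
        rw [mem_ball_iff_norm, not_lt] at hzout
        linarith
      filter_upwards [h1, hG.isOpen.mem_nhds hz] with x hx hx'
      rw [Lap_sub b (hLs x) (hψw.sm hx'), hLapout x hx, (hψw x hx').2, sub_zero])
  have hlhs : 0 ≤ ∫ x in Om l, deriv (deriv θ) (g x) * gip b g g x * (L x - ψ w x) ∂μ := by
    refine setIntegral_nonneg hG.isOpen.measurableSet fun x hx => ?_
    by_cases hgx : 2 * ε < g x
    · rw [deriv2_zero_right hθ1 hgx]; simp
    · have hxb : x ∉ ball w r := fun h => hgx (hrb x h).2
      have hxw : x ≠ w := by rintro rfl; exact hxb (mem_ball_self hr)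
      rw [hLout x hxb]
      exact mul_nonneg (mul_nonneg (hθnn _) (gip_self_nonneg b _ _)) (hG.gr_nonneg hw hx hxw)
  have hball := green_mean μ b (O := ball w r) (z := w) (g := K) (ε := ε₁) (θ := θ₁) (d := d₁)
    (C := closedBall w (r / 2)) (H := fun x => g x - d)
    (fun x _ hx => hKh.sm hx) (fun x _ hx => (hKh x hx).2) isOpen_ball (isCompact_closedBall _ _)
    (closedBall_subset_ball (half_lt_self hr)) (mem_closedBall_self (half_pos hr).le)
    (fun x _ hx => hKC x (by rw [mem_closedBall_iff_norm] at hx; exact not_le.1 hx)) hKz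
    (by rw [hKw]; exact hε₁0) (fun φ hφ hφc _ => fund_translate hG.fund w hφ hφc) hθ' hθ0' hθ1'
    (fun x hx => (hgh.sm (hrb x hx).1).sub contDiffAt_const)
    (fun x hx => by rw [Lap_sub b (hgh.sm (hrb x hx).1) contDiffAt_const,
      (hgh x (hrb x hx).1).2, Lap_const, sub_zero])
  have hrhs : ∫ x in Om l, θ (g x) * Lap b (fun x => L x - ψ w x) x ∂μ = -(g w - d) := by
    rw [← hball, ← integral_neg,
      setIntegral_eq_of_subset_of_forall_sdiff_eq_zero (s := ball w r) (t := Om l)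
        hG.isOpen.measurableSet (fun x hx => (hrb x hx).1.1)]
    · refine setIntegral_congr_fun measurableSet_ball fun x hx => ?_
      have hx' := (hrb x hx).1.1
      change θ (g x) * Lap b (fun x => L x - ψ w x) x = _
      rw [Lap_sub b (hLs x) (hψw.sm hx'), (hψw x hx').2, hLap, hθ1 _ (hrb x hx).2.le]
      ring
    · rintro x ⟨hx, hxb⟩
      rw [mem_ball_iff_norm, not_lt] at hxb
      rw [Lap_sub b (hLs x) (hψw.sm hx), (hψw x hx).2, hLapout x (by linarith)]
      ring
  rw [key, hrhs, hLout z hzout] at hlhs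
  have : g w = K z - ψ z w := by simp only [hg, gr, hK]; rw [fundK_sub_comm]
  linarith

lemma psi_symm {z w : E} (hz : z ∈ Om l) (hw : w ∈ Om l) : ψ w z = ψ z w := by
  by_cases h : z = w
  · rw [h]
  · exact le_antisymm (hG.psi_symm_le hz hw h) (hG.psi_symm_le hw hz (Ne.symm h))

end GreenSys

end Symmetry

section JointSmooth

variable {E : Type*} [NormedAddCommGroup E] [InnerProductSpace ℝ E]
  {ι : Type*} [Fintype ι] {b : OrthonormalBasis ι ℝ E} {J : E ≃ₗᵢ[ℝ] E}
  [MeasurableSpace E] {μ : Measure E}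
  {l : E → ℝ} {c : ℝ} {m : ℕ} {ψ : E → E → ℝ}
  [FiniteDimensional ℝ E] [BorelSpace E] [μ.IsAddHaarMeasure]

/-- A continuous separately harmonic function is jointly smooth. -/
theorem MVKernel.joint_smooth {k : E → ℝ} (hk : MVKernel b μ k) {Ψ : E → E → ℝ}
    (h1 : ∀ x ∈ ball (0 : E) 1, Harm b (ball 0 1) (Ψ x))
    (h2 : ∀ y ∈ ball (0 : E) 1, Harm b (ball 0 1) (fun x => Ψ x y))
    (hc : ∀ p : E × E, p.1 ∈ ball (0 : E) 1 → p.2 ∈ ball (0 : E) 1 →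
      ContinuousAt (fun p : E × E => Ψ p.1 p.2) p) :
    ContDiffAt ℝ ((⊤ : ℕ∞) : WithTop ℕ∞) (fun p : E × E => Ψ p.1 p.2) 0 := by
  obtain ⟨η, hη, hηc, hηs, hη1, -⟩ := exists_cutoff (isCompact_closedBall (0 : E) (1 / 2))
    isOpen_ball (closedBall_subset_ball (by norm_num : (1 / 2 : ℝ) < 1))
  have hηcont : Continuous η := continuous_iff_continuousAt.2 fun x => (hη x).continuousAt
  set F : E × E → ℝ := fun p => η p.1 * η p.2 * Ψ p.1 p.2 with hF
  have hFc : Continuous F := continuous_iff_continuousAt.2 fun p => by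
    have hz : ∀ x : E, x ∉ ball (0 : E) 1 → ∀ᶠ y in 𝓝 x, η y = 0 := fun x hx =>
      notMem_tsupport_iff_eventuallyEq.1 fun h => hx (hηs h)
    by_cases hp1 : p.1 ∈ ball (0 : E) 1
    · by_cases hp2 : p.2 ∈ ball (0 : E) 1
      · exact (by fun_prop : ContinuousAt (fun p : E × E => η p.1 * η p.2) p).mul (hc p hp1 hp2)
      · refine (continuousAt_const (y := (0 : ℝ))).congr ?_
        filter_upwards [continuousAt_snd.eventually (hz _ hp2)] with q hq
        simp [hF, hq]
    · refine (continuousAt_const (y := (0 : ℝ))).congr ?_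
      filter_upwards [continuousAt_fst.eventually (hz _ hp1)] with q hq
      simp [hF, hq]
  set κ : E × E → ℝ := fun p => k p.1 * k p.2 with hκ
  have hks : ContDiff ℝ (⊤ : ℕ∞) k := contDiff_iff_contDiffAt.2 hk.sm
  have hκs : ContDiff ℝ (⊤ : ℕ∞) κ := by
    exact (hks.comp contDiff_fst).mul (hks.comp contDiff_snd)
  have hκc : HasCompactSupport κ := by
    refine HasCompactSupport.of_support_subset_isCompact
      ((isCompact_closedBall (0 : E) (1 / 4)).prod (isCompact_closedBall (0 : E) (1 / 4))) ?_
    intro p hp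
    constructor <;> refine mem_closedBall_zero_iff.2 (not_lt.1 fun h => hp ?_) <;>
      simp [hκ, hk.supp _ h]
  have : ProperSpace E := FiniteDimensional.proper_real E
  have : (μ.prod μ).IsAddHaarMeasure := inferInstance
  have : ProperSpace (E × E) := inferInstance
  have hconv := hκc.contDiff_convolution_left (ContinuousLinearMap.lsmul ℝ ℝ) hκs
    (hFc.locallyIntegrable (μ := μ.prod μ))
  have hmean : ∀ x ∈ ball (0 : E) (1 / 4), ∀ H, Harm b (ball 0 1) H →
      ∫ y, k y * H (x - y) ∂μ = H x := by
    intro x hx H hH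
    rw [← integral_neg_eq_self (fun y => k y * H (x - y)) μ]
    have h := hk.mean (fun y => H (y - -x)) ((hH.translate (-x)).mono fun y hy => ?_)
    · simp only [zero_sub, neg_neg] at h
      rw [← h]
      refine integral_congr_ae (Eventually.of_forall fun y => ?_)
      change k (-y) * H (x - -y) = k y * H (y - -x)
      rw [hk.radial (-y) y (norm_neg y), sub_neg_eq_add, sub_neg_eq_add, add_comm]
    · rw [mem_ball_zero_iff] at hx hy
      rw [mem_ofPred_eq, mem_ball_zero_iff, sub_neg_eq_add]
      linarith [norm_add_le y x]
  refine hconv.contDiffAt.congr_of_eventuallyEq ?_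
  have hnear : ∀ᶠ p : E × E in 𝓝 0, p.1 ∈ ball (0 : E) (1 / 4) ∧ p.2 ∈ ball (0 : E) (1 / 4) := by
    have : (0 : E) ∈ ball (0 : E) (1 / 4) := by simp
    exact (continuous_fst.continuousAt.eventually (isOpen_ball.mem_nhds this)).and
      (continuous_snd.continuousAt.eventually (isOpen_ball.mem_nhds this))
  filter_upwards [hnear] with p ⟨hp1, hp2⟩
  rw [convolution_def]
  simp only [ContinuousLinearMap.lsmul_apply, smul_eq_mul]
  rw [integral_prod]
  · have hin : ∀ x ∈ ball (0 : E) (1 / 4), ∀ y, k y ≠ 0 → x - y ∈ closedBall (0 : E) (1 / 2) := by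
      intro x hx y hy
      have hy' : ‖y‖ ≤ 1 / 4 := not_lt.1 fun h => hy (hk.supp y h)
      rw [mem_ball_zero_iff] at hx
      rw [mem_closedBall_zero_iff]
      linarith [norm_sub_le x y]
    have hb : closedBall (0 : E) (1 / 2) ⊆ ball 0 1 := closedBall_subset_ball (by norm_num)
    have hη1' : ∀ x ∈ closedBall (0 : E) (1 / 2), η x = 1 := fun x hx => (hη1 x hx).self_of_nhds
    have inner : ∀ y, ∫ y', κ (y, y') * F (p - (y, y')) ∂μ = k y * Ψ (p.1 - y) p.2 := by
      intro y
      by_cases hy : k y = 0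
      · simp [hκ, hy]
      have hy' := hin _ hp1 y hy
      rw [← hmean _ hp2 _ (h1 _ (hb hy')), ← integral_const_mul]
      refine integral_congr_ae (Eventually.of_forall fun w => ?_)
      by_cases hw : k w = 0
      · simp [hκ, hw]
      simp only [hκ, hF, Prod.fst_sub, Prod.snd_sub, hη1' _ hy', hη1' _ (hin _ hp2 w hw)]
      ring
    simp only [inner]
    exact (hmean _ hp1 _ (h2 _ (by
      rw [mem_ball_zero_iff] at hp2 ⊢; linarith))).symm
  · refine Continuous.integrable_of_hasCompactSupport ?_ ?_
    · exact hκs.continuous.mul (hFc.comp (by fun_prop))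
    · exact hκc.mul_right

namespace GreenSys

variable (hG : GreenSys b J μ l c m ψ)
include hG

omit [FiniteDimensional ℝ E] [BorelSpace E] [μ.IsAddHaarMeasure] in
lemma exists_ball {z₀ : E} (hz : z₀ ∈ Om l) : ∃ ρ > 0, ∃ s > 0, ∀ x, ‖x - z₀‖ ≤ ρ → s < l x := by
  have hz : 0 < l z₀ := hz
  have := hG.dom.cont.continuousAt.eventually (lt_mem_nhds (half_lt_self hz))
  obtain ⟨ρ, hρ, h⟩ := Metric.eventually_nhds_iff_ball.1 this
  exact ⟨ρ / 2, half_pos hρ, l z₀ / 2, half_pos hz, fun x hx => h x (by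
    rw [mem_ball_iff_norm]; linarith)⟩

omit [FiniteDimensional ℝ E] [BorelSpace E] [μ.IsAddHaarMeasure] in
lemma psi_le {z₀ : E} {ρ s : ℝ} (hρ : 0 < ρ) (hs : 0 < s) (h : ∀ x, ‖x - z₀‖ ≤ 2 * ρ → s < l x)
    {z x : E} (hz : ‖z - z₀‖ ≤ ρ) (hx : x ∈ Om l) : ψ z x ≤ c / ρ ^ (2 * m) := by
  have := hG.nonempty
  have hzO : z ∈ Om l := hs.trans (h z (by linarith))
  have hh := hG.harm z hzO
  have key := hG.dom.max_Om hG.isOpen subset_rfl (u := fun x => ψ z x - c / ρ ^ (2 * m))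
    (fun x hx => (hh.sm hx).sub contDiffAt_const)
    (fun x hx => by
      rw [Lap_sub b (hh.sm hx) contDiffAt_const, (hh x hx).2, Lap_const]
      simp) (fun ε hε => ?_) x hx
  · linarith
  · obtain ⟨s', hs', -, h'⟩ := hG.gr_bd hzO hε
    refine ⟨univ, isClosed_univ, by simp, min s s', lt_min hs hs', fun x hx hxs => ?_⟩
    have hxs : l x < min s s' := by simpa using hxs
    have h1 := (abs_le.1 (h' x hx (hxs.trans_le (min_le_right _ _)))).1
    have h2 : 2 * ρ < ‖x - z₀‖ := by
      by_contra! hcon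
      exact lt_asymm (h x hcon) (hxs.trans_le (min_le_left _ _))
    have h3 := fundK_le hG.c_pos (m := m) hρ (x := x - z) (by
      have := norm_sub_le_norm_sub_add_norm_sub x z z₀
      linarith)
    simp only [gr] at h1
    linarith

lemma harm_left {x : E} (hx : x ∈ Om l) : Harm b (Om l) (fun z => ψ z x) := by
  intro z hz
  have h : (fun z => ψ z x) =ᶠ[𝓝 z] ψ x := by
    filter_upwards [hG.isOpen.mem_nhds hz] with w hw using hG.psi_symm hx hw
  exact ⟨((hG.harm x hx).sm hz).congr_of_eventuallyEq h, by
    rw [Lap_congr b h, (hG.harm x hx z hz).2]⟩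

lemma psi_lip {z₀ : E} (hz : z₀ ∈ Om l) :
    ∃ ρ > 0, ∃ C, ∀ z ∈ ball z₀ ρ, ∀ x ∈ Om l, |ψ z x - ψ z₀ x| ≤ C * ‖z - z₀‖ := by
  obtain ⟨k, hk⟩ := hG.exists_ker
  obtain ⟨C, hC, hgrad⟩ := hk.grad_est
  obtain ⟨ρ, hρ, s, hs, h⟩ := hG.exists_ball hz
  set B := c / (ρ / 2) ^ (2 * m) with hB
  refine ⟨ρ / 4, by positivity, C * B / (ρ / 4), fun z hz' x hx => ?_⟩
  have hO : ∀ y ∈ ball z₀ (ρ / 2), y ∈ Om l := fun y hy => hs.trans (h y (by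
    rw [mem_ball_iff_norm] at hy; linarith))
  have hL := hG.harm_left hx
  refine (convex_ball z₀ (ρ / 4)).norm_image_sub_le_of_norm_fderiv_le (𝕜 := ℝ)
    (f := fun z => ψ z x) (fun y hy => ?_) (fun y hy => ?_) (mem_ball_self (by positivity)) hz'
  · exact sm_diff (hL.sm (hO y (ball_subset_ball (by linarith) hy)))
  · have hsub : ball y (ρ / 4) ⊆ ball z₀ (ρ / 2) := by
      intro w hw
      rw [mem_ball] at *
      linarith [dist_triangle w y z₀]
    refine ContinuousLinearMap.opNorm_le_bound _
      (by have := hG.c_pos; positivity) fun v => ?_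
    refine hgrad y (ρ / 4) B (fun z => ψ z x) (by positivity)
      (hL.mono fun w hw => hO w (hsub hw)) (fun w hw => ?_) v
    rw [abs_of_pos (hG.psi_pos (hO w (hsub hw)) hx)]
    refine hG.psi_le (z₀ := z₀) (half_pos hρ) hs (fun x hx => h x (by linarith)) ?_ hx
    have := hsub hw
    rw [mem_ball_iff_norm] at this
    exact this.le

lemma psi_cont {p : E × E} (h1 : p.1 ∈ Om l) (h2 : p.2 ∈ Om l) :
    ContinuousAt (fun p : E × E => ψ p.1 p.2) p := by
  obtain ⟨ρ, hρ, C, hC⟩ := hG.psi_lip h1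
  have hz : Tendsto (fun q : E × E => ψ q.1 q.2 - ψ p.1 q.2) (𝓝 p) (𝓝 0) := by
    refine squeeze_zero_norm' (a := fun q : E × E => C * ‖q.1 - p.1‖) ?_ ?_
    · filter_upwards [continuousAt_fst.eventually (ball_mem_nhds p.1 hρ),
        continuousAt_snd.eventually (hG.isOpen.mem_nhds h2)] with q hq hq'
      exact hC q.1 hq q.2 hq'
    · have : ContinuousAt (fun q : E × E => C * ‖q.1 - p.1‖) p := by fun_prop
      simpa [ContinuousAt] using this
  have h3 : Tendsto (fun q : E × E => ψ p.1 q.2) (𝓝 p) (𝓝 (ψ p.1 p.2)) :=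
    (((hG.harm _ h1).sm h2).continuousAt (x := p.2)).tendsto.comp continuousAt_snd
  have := hz.add h3
  simpa [ContinuousAt] using this

/-- The harmonic part of the Green function is jointly smooth. -/
theorem psi_smooth {p : E × E} (h1 : p.1 ∈ Om l) (h2 : p.2 ∈ Om l) :
    ContDiffAt ℝ ((⊤ : ℕ∞) : WithTop ℕ∞) (fun p : E × E => ψ p.1 p.2) p := by
  obtain ⟨k, hk⟩ := hG.exists_ker
  obtain ⟨ρ₁, hρ₁, s₁, hs₁, hb₁⟩ := hG.exists_ball h1
  obtain ⟨ρ₂, hρ₂, s₂, hs₂, hb₂⟩ := hG.exists_ball h2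
  set ρ := min ρ₁ ρ₂ with hρ
  have hρ0 : 0 < ρ := lt_min hρ₁ hρ₂
  have hin1 : ∀ x ∈ ball (0 : E) 1, p.1 + ρ • x ∈ Om l := fun x hx => hs₁.trans (hb₁ _ (by
    rw [mem_ball_zero_iff] at hx
    rw [add_sub_cancel_left, norm_smul, Real.norm_of_nonneg hρ0.le]
    nlinarith [min_le_left ρ₁ ρ₂]))
  have hin2 : ∀ x ∈ ball (0 : E) 1, p.2 + ρ • x ∈ Om l := fun x hx => hs₂.trans (hb₂ _ (by
    rw [mem_ball_zero_iff] at hx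
    rw [add_sub_cancel_left, norm_smul, Real.norm_of_nonneg hρ0.le]
    nlinarith [min_le_right ρ₁ ρ₂]))
  have key := hk.joint_smooth (Ψ := fun x y => ψ (p.1 + ρ • x) (p.2 + ρ • y))
    (fun x hx => ((hG.harm _ (hin1 x hx)).scale p.2 ρ).mono hin2)
    (fun y hy => ((hG.harm_left (hin2 y hy)).scale p.1 ρ).mono hin1)
    (fun q hq1 hq2 => by
      have := hG.psi_cont (p := (p.1 + ρ • q.1, p.2 + ρ • q.2)) (hin1 _ hq1) (hin2 _ hq2)
      exact ContinuousAt.comp (f := fun q : E × E => (p.1 + ρ • q.1, p.2 + ρ • q.2)) this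
        (by fun_prop))
  have h3 : ContDiffAt ℝ ((⊤ : ℕ∞) : WithTop ℕ∞)
      (fun q : E × E => ρ⁻¹ • (q - p)) p := by fun_prop
  rw [show (0 : E × E) = ρ⁻¹ • (p - p) by simp] at key
  have h4 := ContDiffAt.comp (f := fun q : E × E => ρ⁻¹ • (q - p)) p key h3
  refine h4.congr_of_eventuallyEq (Eventually.of_forall fun q => ?_)
  simp [smul_smul, hρ0.ne']

end GreenSys

end JointSmooth

section Growth

variable {E : Type*} [NormedAddCommGroup E] [InnerProductSpace ℝ E]
  {ι : Type*} [Fintype ι] {b : OrthonormalBasis ι ℝ E} {J : E ≃ₗᵢ[ℝ] E}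
  [MeasurableSpace E] {μ : Measure E}
  {l : E → ℝ} {c : ℝ} {m : ℕ} {ψ : E → E → ℝ}

omit [MeasurableSpace E] in
lemma Dom.exists_Lap_bound (hl : Dom b J l) : ∃ D, 0 ≤ D ∧ ∀ x, |Lap b l x| ≤ D := by
  have hc : Continuous (Lap b l) :=
    continuous_iff_continuousAt.2 fun x => (sm_Lap b (hl.sm x)).continuousAt
  have hs : HasCompactSupport (Lap b l) :=
    hl.cs.of_isClosed_subset (isClosed_tsupport _) (tsupport_Lap_subset b l)
  obtain ⟨D, hD⟩ := hc.bounded_above_of_compact_support hs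
  exact ⟨D, (norm_nonneg _).trans (hD 0), hD⟩

namespace GreenSys

variable (hG : GreenSys b J μ l c m ψ)
include hG

/-- The Green function is bounded above by a multiple of the defining function. -/
lemma gr_le {z : E} (hz : z ∈ Om l) : ∃ ρ > 0, ∃ a > 0, ∃ C, 0 ≤ C ∧
    (∀ w ∈ ball z ρ, a < l w) ∧
    ∀ w ∈ ball z ρ, ∀ x ∈ Om l, l x ≤ a → |gr c m ψ w x| ≤ C * l x := by
  have := hG.nonempty
  have hc := hG.c_pos
  obtain ⟨ρ, hρ, s, hs, h⟩ := hG.exists_ball hz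
  have hb : ∀ w ∈ ball z (ρ / 2), s < l w := fun w hw => h w (by
    rw [mem_ball_iff_norm] at hw; linarith)
  set B := c / (ρ / 2) ^ (2 * m) with hB
  have hB0 : 0 ≤ B := by positivity
  refine ⟨ρ / 2, half_pos hρ, s, hs, B / s, by positivity, hb, fun w hw x hx hxs => ?_⟩
  have hw' : w ∈ Om l := hs.trans (hb w hw)
  have hne : ∀ y, l y ≤ s → y ≠ w := by
    rintro y hy rfl
    exact absurd (hb y hw) (not_lt.2 hy)
  have hx0 : 0 < l x := hx
  rw [abs_of_nonneg (hG.gr_nonneg hw' hx (hne x hxs))]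
  refine le_of_forall_pos_le_add fun ε hε => ?_
  obtain ⟨s', hs', -, hbd⟩ := hG.gr_bd hw' hε
  have hh := hG.gr_harm hw'
  have hmin : min (s' / 2) (l x) < s' := (min_le_left _ _).trans_lt (half_lt_self hs')
  have hmin0 : 0 < min (s' / 2) (l x) := lt_min (half_pos hs') hx0
  have hO : ∀ y, min (s' / 2) (l x) ≤ l y → l y ≤ s → y ∈ Om l \ {w} := fun y hy hys =>
    ⟨hmin0.trans_le hy, hne y hys⟩
  have key := hG.dom.band_compare (s := min (s' / 2) (l x)) (a := s) hmin0
    (u := fun y => gr c m ψ w y - B / s * l y - ε)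
    (fun y hy hys => ((hh.sm (hO y hy hys)).sub
      (contDiffAt_const.mul (hG.dom.sm y))).sub contDiffAt_const)
    (fun y hy => by
      have hy0 : y ∈ Om l := by change 0 < l y; rw [hy]; exact hmin0
      have h1 := (abs_le.1 (hbd y hy0 (by rw [hy]; exact hmin))).2
      have : 0 ≤ B / s * l y := mul_nonneg (by positivity) (le_of_lt hy0)
      linarith)
    (fun y hy => by
      have hy0 : y ∈ Om l := by change 0 < l y; rw [hy]; exact hs
      have h1 := hG.psi_pos hw' hy0
      have h2 : fundK c m (y - w) ≤ B := fundK_le hc (half_pos hρ) (by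
        by_contra! hcon
        have := norm_sub_le_norm_sub_add_norm_sub y w z
        rw [mem_ball_iff_norm] at hw
        exact absurd (h y (by linarith)) (by rw [hy]; exact lt_irrefl _))
      rw [hy, div_mul_cancel₀ _ hs.ne']
      simp only [gr]
      linarith)
    (fun y hy hys => by
      have hyO := hO y hy.le hys.le
      have s1 := hh.sm hyO
      have s2 : 𝒞 (fun y => B / s * l y) y := contDiffAt_const.mul (hG.dom.sm y)
      rw [Lap_sub b (s1.sub s2) contDiffAt_const, Lap_sub b s1 s2, (hh y hyO).2,
        Lap_const_mul b (hG.dom.sm y), Lap_const]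
      have := hG.dom.Lap_le hyO.1
      have : 0 ≤ B / s := by positivity
      nlinarith) x (min_le_right _ _) hxs
  linarith

/-- Hopf's lemma: the Green function is bounded below by a multiple of the defining function. -/
lemma gr_ge {z : E} (hz : z ∈ Om l) [FiniteDimensional ℝ E] [BorelSpace E] [μ.IsAddHaarMeasure] :
    ∃ a > 0, ∃ C > 0, a < l z ∧ ∀ x ∈ Om l, l x ≤ a → C * l x ≤ gr c m ψ z x := by
  have := hG.nonempty
  have hz0 : 0 < l z := hz
  obtain ⟨a₀, ha₀, c₀, hc₀, hcol⟩ := hG.dom.collar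
  obtain ⟨D, hD0, hD⟩ := hG.dom.exists_Lap_bound
  set a := min a₀ (min (c₀ / (2 * D + 1)) (l z / 2)) with ha
  have ha0 : 0 < a := by positivity
  have haz : a < l z := by
    have := (min_le_right a₀ _).trans (min_le_right (c₀ / (2 * D + 1)) (l z / 2))
    linarith
  have haD : a * (2 * D + 1) ≤ c₀ := by
    rw [← le_div_iff₀ (by positivity)]
    exact (min_le_right a₀ _).trans (min_le_left _ _)
  have hh := hG.gr_harm hz
  have hO : ∀ y, 0 < l y → l y ≤ a → y ∈ Om l \ {z} := fun y hy hya =>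
    ⟨hy, by rintro rfl; linarith⟩
  obtain ⟨p, hp, hmin⟩ : ∃ p > 0, ∀ x, l x = a → p ≤ gr c m ψ z x := by
    rcases {x | a ≤ l x ∧ l x ≤ a}.eq_empty_or_nonempty with he | hne
    · exact ⟨1, one_pos, fun x hx => by
        have : x ∈ {x | a ≤ l x ∧ l x ≤ a} := ⟨hx.ge, hx.le⟩
        simp [he] at this⟩
    · obtain ⟨x, hx, hmin⟩ := (hG.dom.isCompact_band ha0 a).exists_isMinOn hne
        (f := gr c m ψ z) fun y hy =>
          (hh.sm (hO y (ha0.trans_le hy.1) hy.2)).continuousAt.continuousWithinAt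
      have hx' := hO x (ha0.trans_le hx.1) hx.2
      exact ⟨_, hG.gr_pos hz hx'.1 hx'.2, fun y hy => hmin ⟨hy.ge, hy.le⟩⟩
  set M := D / c₀ with hM
  have hM0 : 0 ≤ M := by positivity
  have hMc : M * c₀ = D := div_mul_cancel₀ _ hc₀.ne'
  set C := p / (a + M * a ^ 2) with hC
  have hC0 : 0 < C := by positivity
  refine ⟨a, ha0, C, hC0, haz, fun x hx hxa => ?_⟩
  have hx0 : 0 < l x := hx
  have hlim : Tendsto (fun s : ℝ => C * l x - C * (s + M * s ^ 2)) (𝓝[>] 0) (𝓝 (C * l x)) := by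
    have : ContinuousAt (fun s : ℝ => C * l x - C * (s + M * s ^ 2)) 0 := by fun_prop
    have h := this.tendsto
    simp only [ne_eq, OfNat.ofNat_ne_zero, not_false_eq_true, zero_pow, mul_zero, add_zero,
      sub_zero] at h
    exact h.mono_left nhdsWithin_le_nhds
  refine le_of_tendsto hlim ?_
  filter_upwards [Ioo_mem_nhdsGT hx0] with s hs
  have hsl : ∀ y, 𝒞 (fun y => l y + M * (l y * l y)) y := fun y =>
    (hG.dom.sm y).add (contDiffAt_const.mul ((hG.dom.sm y).mul (hG.dom.sm y)))
  have key := hG.dom.band_compare (s := s) (a := a) hs.1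
    (u := fun y => C * (l y + M * (l y * l y)) - C * (s + M * s ^ 2) - gr c m ψ z y)
    (fun y hy hya => ((contDiffAt_const.mul (hsl y)).sub contDiffAt_const).sub
      (hh.sm (hO y (hs.1.trans_le hy) hya)))
    (fun y hy => by
      have hy' : l y ≤ a := by rw [hy]; linarith [hs.2]
      have hyO := hO y (by rw [hy]; exact hs.1) hy'
      have := hG.gr_nonneg hz hyO.1 hyO.2
      rw [hy]
      linarith)
    (fun y hy => by
      have h1 := hmin y hy
      have h2 : C * (a + M * a ^ 2) = p := div_mul_cancel₀ _ (by positivity)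
      have h3 : 0 ≤ C * (s + M * s ^ 2) := by have := hs.1; positivity
      rw [hy]
      linarith)
    (fun y hy hya => by
      have hyO := hO y (hs.1.trans hy) hya.le
      have s1 := hsl y
      have s2 : 𝒞 (fun y => C * (l y + M * (l y * l y))) y := contDiffAt_const.mul s1
      have s3 := hG.dom.sm y
      have hy0 : 0 < l y := hyO.1
      have h1 := hcol y hyO.1 (hya.le.trans (min_le_left _ _))
      have h2 := (abs_le.1 (hD y)).1
      rw [Lap_sub b (s2.sub contDiffAt_const) (hh.sm hyO), Lap_sub b s2 contDiffAt_const,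
        (hh y hyO).2, Lap_const, Lap_const_mul b s1,
        Lap_add b s3 (contDiffAt_const.mul (s3.mul s3)), Lap_const_mul b (s3.mul s3),
        Lap_mul b s3 s3]
      have h3 : l y * D ≤ c₀ / 2 := by nlinarith
      have h4 : -(l y * D) ≤ l y * Lap b l y := by nlinarith
      have h5 : 0 ≤ Lap b l y + M * (l y * Lap b l y + 2 * gip b l l y + l y * Lap b l y) := by
        have : c₀ ≤ l y * Lap b l y + 2 * gip b l l y + l y * Lap b l y := by linarith
        nlinarith
      simpa using mul_nonneg hC0.le h5) x hs.2.le hxa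
  have h0 : 0 ≤ C * (M * (l x * l x)) := by positivity
  linarith

end GreenSys

end Growth

section Decay
variable {E F : Type*} [NormedAddCommGroup E] [InnerProductSpace ℝ E]
  [NormedAddCommGroup F] [NormedSpace ℝ F]

/-- The filter of points approaching the zero level of `l` through positive values. -/
def nb (l : E → ℝ) : Filter E := comap l (𝓝[>] 0)

omit [NormedAddCommGroup E] [InnerProductSpace ℝ E] in
lemma nb_basis (l : E → ℝ) : (nb l).HasBasis (fun a : ℝ => 0 < a) (fun a => {x | 0 < l x ∧ l x < a}) :=
  (nhdsGT_basis (0 : ℝ)).comap l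

lemma nb_iff {l : E → ℝ} {P : E → Prop} :
    (∀ᶠ x in nb l, P x) ↔ ∃ a > 0, ∀ x, 0 < l x → l x < a → P x := by
  rw [(nb_basis l).eventually_iff]
  simp only [mem_ofPred_eq, and_imp, gt_iff_lt]

lemma nb_pos (l : E → ℝ) : ∀ᶠ x in nb l, 0 < l x :=
  nb_iff.2 ⟨1, one_pos, fun _ h _ => h⟩

lemma nb_lt (l : E → ℝ) {a : ℝ} (ha : 0 < a) : ∀ᶠ x in nb l, l x < a :=
  nb_iff.2 ⟨a, ha, fun _ _ h => h⟩

lemma nb_nhds {l : E → ℝ} (hl : Continuous l) {P : E → Prop} (h : ∀ᶠ x in nb l, P x) :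
    ∀ᶠ x in nb l, ∀ᶠ y in 𝓝 x, P y := by
  obtain ⟨a, ha, h⟩ := nb_iff.1 h
  refine nb_iff.2 ⟨a, ha, fun x h1 h2 => ?_⟩
  filter_upwards [hl.continuousAt.eventually (lt_mem_nhds h1),
    hl.continuousAt.eventually (gt_mem_nhds h2)] with y h3 h4 using h y h3 h4

/-- `f` is bounded by a multiple of `l ^ p` near the zero level of `l`. -/
def Dk (l : E → ℝ) (p : ℝ) (f : E → F) : Prop := f =O[nb l] fun x => l x ^ p

variable {l : E → ℝ} {p q : ℝ} {f g : E → F}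

omit [NormedSpace ℝ F] in
lemma Dk_iff : Dk l p f ↔ ∃ C > 0, ∃ a > 0, ∀ x, 0 < l x → l x < a → ‖f x‖ ≤ C * l x ^ p := by
  constructor
  · intro h
    obtain ⟨C, hC, h⟩ := Asymptotics.IsBigO.exists_pos h
    obtain ⟨a, ha, h⟩ := nb_iff.1 h.bound
    refine ⟨C, hC, a, ha, fun x h1 h2 => ?_⟩
    have := h x h1 h2
    rwa [Real.norm_of_nonneg (Real.rpow_nonneg h1.le _)] at this
  · rintro ⟨C, _, a, ha, h⟩
    refine Asymptotics.IsBigO.of_bound C (nb_iff.2 ⟨a, ha, fun x h1 h2 => ?_⟩)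
    rw [Real.norm_of_nonneg (Real.rpow_nonneg h1.le _)]
    exact h x h1 h2

namespace Dk

omit [NormedSpace ℝ F] in
lemma of_le {C : ℝ} (h : ∀ᶠ x in nb l, ‖f x‖ ≤ C * l x ^ p) : Dk l p f := by
  refine Asymptotics.IsBigO.of_bound C ?_
  filter_upwards [h, nb_pos l] with x h h1
  rwa [Real.norm_of_nonneg (Real.rpow_nonneg h1.le _)]

omit [NormedAddCommGroup E] [InnerProductSpace ℝ E] [NormedSpace ℝ F] in
lemma congr' (h : Dk l p f) (e : ∀ᶠ x in nb l, f x = g x) : Dk l p g :=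
  Asymptotics.IsBigO.congr' h e EventuallyEq.rfl

omit [NormedAddCommGroup E] [InnerProductSpace ℝ E] [NormedSpace ℝ F] in
lemma add (hf : Dk l p f) (hg : Dk l p g) : Dk l p (fun x => f x + g x) :=
  Asymptotics.IsBigO.add hf hg

omit [NormedAddCommGroup E] [InnerProductSpace ℝ E] [NormedSpace ℝ F] in
lemma sub (hf : Dk l p f) (hg : Dk l p g) : Dk l p (fun x => f x - g x) :=
  Asymptotics.IsBigO.sub hf hg

omit [NormedAddCommGroup E] [InnerProductSpace ℝ E] [NormedSpace ℝ F] in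
lemma neg (hf : Dk l p f) : Dk l p (fun x => - f x) :=
  Asymptotics.IsBigO.neg_left hf

omit [NormedAddCommGroup E] [InnerProductSpace ℝ E] [NormedSpace ℝ F] in
lemma sum {κ : Type*} {s : Finset κ} {f : κ → E → F} (h : ∀ k ∈ s, Dk l p (f k)) :
    Dk l p (fun x => ∑ k ∈ s, f k x) :=
  Asymptotics.IsBigO.fun_sum h

lemma mono (hf : Dk l p f) (hpq : q ≤ p) : Dk l q f := by
  obtain ⟨C, hC, a, ha, h⟩ := Dk_iff.1 hf
  refine Dk_iff.2 ⟨C, hC, min a 1, lt_min ha one_pos, fun x h1 h2 => ?_⟩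
  refine (h x h1 (h2.trans_le (min_le_left _ _))).trans ?_
  gcongr 1
  exact Real.rpow_le_rpow_of_exponent_ge h1 (h2.le.trans (min_le_right _ _)) hpq

omit [NormedAddCommGroup E] [InnerProductSpace ℝ E] [NormedSpace ℝ F] in
lemma zero : Dk l p (fun _ => (0 : F)) := Asymptotics.isBigO_zero _ _

omit [NormedAddCommGroup E] [InnerProductSpace ℝ E] [NormedSpace ℝ F] in
lemma of_norm_le {G : Type*} [NormedAddCommGroup G] [NormedSpace ℝ G] {h : E → G} (hf : Dk l p f)
    (e : ∀ᶠ x in nb l, ‖h x‖ ≤ ‖f x‖) : Dk l p h :=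
  (Asymptotics.IsBigO.of_bound 1 (by simpa using e)).trans hf

lemma smul {c : E → ℝ} {r : ℝ} (hc : Dk l p c) (hf : Dk l q f) (hr : r = p + q) :
    Dk l r (fun x => c x • f x) := by
  refine (Asymptotics.IsBigO.smul hc hf).trans (Filter.EventuallyEq.isBigO ?_)
  filter_upwards [nb_pos l] with x hx
  rw [hr, Real.rpow_add hx, smul_eq_mul]

lemma mul {c d : E → ℝ} {r : ℝ} (hc : Dk l p c) (hd : Dk l q d) (hr : r = p + q) :
    Dk l r (fun x => c x * d x) := smul hc hd hr

lemma const (a : F) : Dk l 0 (fun _ => a) :=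
  of_le (C := ‖a‖) (Eventually.of_forall fun x => by simp)

lemma const_mul {c : E → ℝ} (hc : Dk l p c) (a : ℝ) : Dk l p (fun x => a * c x) :=
  mul (const a) hc (by simp)

lemma of_continuous (hl : HasCompactSupport l) (hf : Continuous f) : Dk l 0 f := by
  obtain ⟨C, hC⟩ := hl.isCompact.exists_bound_of_continuousOn hf.continuousOn
  refine of_le (C := C) ?_
  filter_upwards [nb_pos l] with x hx
  rw [Real.rpow_zero, mul_one]
  exact hC x (subset_tsupport _ (Function.mem_support.2 hx.ne'))

lemma clm {G : Type*} [NormedAddCommGroup G] [NormedSpace ℝ G] {A : E → G →L[ℝ] F} {v : E → G}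
    {r : ℝ} (hA : Dk l p A) (hv : Dk l q v) (hr : r = p + q) : Dk l r (fun x => A x (v x)) := by
  have h := mul (Asymptotics.IsBigO.norm_left hA : Dk l p fun x => ‖A x‖)
    (Asymptotics.IsBigO.norm_left hv : Dk l q fun x => ‖v x‖) hr
  refine h.of_norm_le (Eventually.of_forall fun x => ?_)
  simpa using (A x).le_opNorm (v x)

lemma inner' {v w : E → E} {r : ℝ} (hv : Dk l p v) (hw : Dk l q w) (hr : r = p + q) :
    Dk l r (fun x => inner ℝ (v x) (w x)) := by
  have h := mul (Asymptotics.IsBigO.norm_left hv : Dk l p fun x => ‖v x‖)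
    (Asymptotics.IsBigO.norm_left hw : Dk l q fun x => ‖w x‖) hr
  refine h.of_norm_le (Eventually.of_forall fun x => ?_)
  simpa using abs_real_inner_le_norm (v x) (w x)

lemma clm_const {G : Type*} [NormedAddCommGroup G] [NormedSpace ℝ G] {A : E → G →L[ℝ] F}
    (hA : Dk l p A) (v : G) : Dk l p (fun x => A x v) := clm hA (const v) (by simp)

lemma of_basis {ι : Type*} [Fintype ι] (b : OrthonormalBasis ι ℝ E) {A : E → E →L[ℝ] F}
    (h : ∀ i, Dk l p (fun x => A x (b i))) : Dk l p A := by
  have h' : Dk l p (fun x => ∑ i, ‖A x (b i)‖) := sum fun i _ => Asymptotics.IsBigO.norm_left (h i)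
  refine h'.of_norm_le (Eventually.of_forall fun x => ?_)
  rw [Real.norm_of_nonneg (Finset.sum_nonneg fun _ _ => norm_nonneg _)]
  refine (A x).opNorm_le_bound (Finset.sum_nonneg fun _ _ => norm_nonneg _) fun v => ?_
  conv_lhs => rw [← sum_inner_smul b v, map_sum]
  rw [Finset.sum_mul]
  refine norm_sum_le_of_le _ fun i _ => ?_
  rw [map_smul, norm_smul, mul_comm]
  gcongr
  simpa using norm_inner_le_norm (𝕜 := ℝ) (b i) v

/-- A function that is `O(l ^ p)` with `p > 0` tends to zero. -/
lemma ev_le {c : E → ℝ} (h : Dk l p c) (hp : 0 < p) {ε : ℝ} (hε : 0 < ε) :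
    ∀ᶠ x in nb l, |c x| ≤ ε := by
  obtain ⟨C, hC, a, ha, h⟩ := Dk_iff.1 h
  refine nb_iff.2 ⟨min a ((ε / C) ^ (1 / p)), by positivity, fun x h1 h2 => ?_⟩
  refine (h x h1 (h2.trans_le (min_le_left _ _))).trans ?_
  have h3 : l x ^ p ≤ ε / C := by
    calc l x ^ p ≤ ((ε / C) ^ (1 / p)) ^ p :=
          Real.rpow_le_rpow h1.le (h2.le.trans (min_le_right _ _)) hp.le
      _ = ε / C := by rw [← Real.rpow_mul (by positivity), one_div_mul_cancel hp.ne', Real.rpow_one]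
  calc C * l x ^ p ≤ C * (ε / C) := by gcongr
    _ = ε := by field_simp

end Dk

lemma rpow_le_of_mem {x y p : ℝ} (hx : 0 < x) (h1 : x / 2 ≤ y) (h2 : y ≤ 2 * x) :
    y ^ p ≤ 2 ^ |p| * x ^ p := by
  have hy : 0 < y := by linarith
  rcases le_total 0 p with hp | hp
  · rw [abs_of_nonneg hp, ← Real.mul_rpow (by norm_num) hx.le]
    exact Real.rpow_le_rpow hy.le h2 hp
  · rw [abs_of_nonpos hp]
    calc y ^ p ≤ (x / 2) ^ p := Real.rpow_le_rpow_of_nonpos (by positivity) h1 hp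
      _ = 2 ^ (-p) * x ^ p := by
        rw [Real.div_rpow hx.le (by norm_num), Real.rpow_neg (by norm_num)]; field_simp

lemma taylor2 {u : E → ℝ} {x y : E} {M : ℝ} (hu : ∀ z ∈ segment ℝ x y, 𝒞 u z)
    (hM : ∀ z ∈ segment ℝ x y, ‖hess u z‖ ≤ M) :
    |u y - u x - fderiv ℝ u x (y - x)| ≤ M * ‖y - x‖ ^ 2 := by
  have hc := convex_segment (𝕜 := ℝ) x y
  have hM0 : 0 ≤ M := (norm_nonneg (hess u x)).trans (hM x (left_mem_segment ℝ x y))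
  have h1 : ∀ z ∈ segment ℝ x y, ‖fderiv ℝ u z - fderiv ℝ u x‖ ≤ M * ‖y - x‖ := by
    intro z hz
    have h := hc.norm_image_sub_le_of_norm_hasFDerivWithin_le (f := fderiv ℝ u) (f' := hess u) (C := M)
      (fun w hw => (sm_diff (sm_fderiv (hu w hw))).hasFDerivAt.hasFDerivWithinAt) hM
      (left_mem_segment ℝ x y) hz
    refine h.trans ?_
    gcongr
    obtain ⟨t, ht, rfl⟩ := (segment_eq_image' ℝ x y) ▸ hz
    rw [add_sub_cancel_left, norm_smul, Real.norm_of_nonneg ht.1]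
    exact mul_le_of_le_one_left (norm_nonneg _) ht.2
  have h2 := hc.norm_image_sub_le_of_norm_hasFDerivWithin_le' (f := u) (f' := fderiv ℝ u)
    (φ := fderiv ℝ u x) (C := M * ‖y - x‖)
    (fun w hw => (sm_diff (hu w hw)).hasFDerivAt.hasFDerivWithinAt) h1
    (left_mem_segment ℝ x y) (right_mem_segment ℝ x y)
  rw [Real.norm_eq_abs] at h2
  calc _ ≤ _ := h2
    _ = _ := by ring

variable {ι : Type*} [Fintype ι] {b : OrthonormalBasis ι ℝ E} {J : E ≃ₗᵢ[ℝ] E}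

/-- Harmonicity near the zero level of `l`. -/
def HN (b : OrthonormalBasis ι ℝ E) (l : E → ℝ) (u : E → ℝ) : Prop :=
  ∀ᶠ x in nb l, 𝒞 u x ∧ Lap b u x = 0

lemma HN.pd (hl : Continuous l) {u : E → ℝ} (h : HN b l u) (v : E) : HN b l (pd v u) := by
  have h' : ∀ᶠ x in nb l, ∀ᶠ y in 𝓝 x, 𝒞 u y ∧ Lap b u y = 0 := nb_nhds hl h
  filter_upwards [h'] with x hx
  refine ⟨sm_pd hx.self_of_nhds.1 v, ?_⟩
  rw [Lap_pd b hx.self_of_nhds.1]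
  have e : Lap b u =ᶠ[𝓝 x] fun _ => 0 := hx.mono fun y hy => hy.2
  rw [pd_congr e, pd_const]; rfl

section Grad
variable [FiniteDimensional ℝ E] [MeasurableSpace E] [BorelSpace E] {μ : Measure E}
  [μ.IsAddHaarMeasure] {k : E → ℝ}

theorem Dk.grad (hk : MVKernel b μ k) (hl : Dom b J l) {u : E → ℝ} (hu : HN b l u)
    (h : Dk l p u) : Dk l (p - 1) (fderiv ℝ u) := by
  obtain ⟨C, hC, hgr⟩ := hk.grad_est
  obtain ⟨κ, hκ, hrad⟩ := hl.exists_rad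
  obtain ⟨A, hA, a, ha, h⟩ := Dk_iff.1 h
  obtain ⟨a', ha', hu⟩ := nb_iff.1 hu
  refine Dk.of_le (C := C * (A * 2 ^ |p|) / κ) (nb_iff.2 ⟨min a a' / 2, by positivity, ?_⟩)
  intro x h1 h2
  have hr : 0 < κ * l x := by positivity
  have hb : ∀ y ∈ ball x (κ * l x), 0 < l y ∧ l y < a ∧ l y < a' ∧ l y ^ p ≤ 2 ^ |p| * l x ^ p := by
    intro y hy
    obtain ⟨h3, h4⟩ := hrad x h1 y hy
    have := min_le_left a a'
    have := min_le_right a a'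
    exact ⟨by linarith, by linarith, by linarith, rpow_le_of_mem h1 h3.le h4.le⟩
  have key := hgr x (κ * l x) (A * (2 ^ |p| * l x ^ p)) u hr
    (fun y hy => hu y (hb y hy).1 (hb y hy).2.2.1)
    (fun y hy => (h y (hb y hy).1 (hb y hy).2.1).trans
      (mul_le_mul_of_nonneg_left (hb y hy).2.2.2 hA.le))
  have e : C * (A * (2 ^ |p| * l x ^ p)) / (κ * l x) = C * (A * 2 ^ |p|) / κ * l x ^ (p - 1) := by
    rw [Real.rpow_sub h1, Real.rpow_one]; field_simp
  rw [e] at key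
  exact ContinuousLinearMap.opNorm_le_bound _
    (mul_nonneg (by positivity) (Real.rpow_nonneg h1.le _)) key

/-- A second-derivative bound for a function harmonic near the zero level. -/
theorem Dk.hess_of_grad (hk : MVKernel b μ k) (hl : Dom b J l) {u : E → ℝ} (hu : HN b l u)
    (h : Dk l p (fderiv ℝ u)) : Dk l (p - 1) (hess u) := by
  refine Dk.of_basis b fun i => Dk.of_basis b fun j => ?_
  have h1 : Dk l p (pd (b j) u) := h.clm_const (b j)
  have h2 := (Dk.grad hk hl (hu.pd hl.cont (b j)) h1).clm_const (b i)
  refine h2.congr' ?_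
  filter_upwards [hu] with x hx
  exact pd_pd hx.1 (b i) (b j)

end Grad
end Decay

section Tangential
variable {E : Type*} [NormedAddCommGroup E] [InnerProductSpace ℝ E]
  {ι : Type*} [Fintype ι] {b : OrthonormalBasis ι ℝ E} {J : E ≃ₗᵢ[ℝ] E} {l : E → ℝ}

lemma pd_map_comp {u : E → ℝ} {Φ : E → E} {x : E} (hΦ : DifferentiableAt ℝ Φ x)
    (hu : DifferentiableAt ℝ u (Φ x)) (v : E) :
    pd v (fun y => u (Φ y)) x = fderiv ℝ u (Φ x) (pd v Φ x) := by
  have := (hu.hasFDerivAt.comp x hΦ.hasFDerivAt).fderiv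
  unfold pd
  rw [show (fun y => u (Φ y)) = u ∘ Φ from rfl, this]; rfl

lemma sm_map_comp {F G : Type*} [NormedAddCommGroup F] [NormedSpace ℝ F] [NormedAddCommGroup G]
    [NormedSpace ℝ G] {u : F → G} {Φ : E → F} {x : E} (hΦ : 𝒞 Φ x)
    (hu : 𝒞 u (Φ x)) : 𝒞 (fun y => u (Φ y)) x := ContDiffAt.comp x hu hΦ

lemma pd_clm_apply {X F G : Type*} [NormedAddCommGroup X] [NormedSpace ℝ X] [NormedAddCommGroup F]
    [NormedSpace ℝ F] [NormedAddCommGroup G] [NormedSpace ℝ G] {A : X → F →L[ℝ] G} {w : X → F}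
    {x : X} (hA : DifferentiableAt ℝ A x) (hw : DifferentiableAt ℝ w x) (v : X) :
    pd v (fun y => A y (w y)) x = pd v A x (w x) + A x (pd v w x) := by
  rw [pd, fderiv_clm_apply hA hw]
  simp only [_root_.add_apply, ContinuousLinearMap.comp_apply,
    ContinuousLinearMap.flip_apply, pd]
  rw [add_comm]

lemma pd_fderiv_comp {u : E → ℝ} {Φ : E → E} {x : E} (hΦ : 𝒞 Φ x) (hu : 𝒞 u (Φ x)) (v : E) :
    pd v (fun y => fderiv ℝ u (Φ y)) x = hess u (Φ x) (pd v Φ x) := by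
  have := ((sm_diff (sm_fderiv hu)).hasFDerivAt.comp x (sm_diff hΦ).hasFDerivAt).fderiv
  unfold pd
  rw [show (fun y => fderiv ℝ u (Φ y)) = fderiv ℝ u ∘ Φ from rfl, this]; rfl

lemma pd_pd_map_comp {u : E → ℝ} {Φ : E → E} {x : E} (hΦ : 𝒞 Φ x)
    (hu : 𝒞 u (Φ x)) (v : E) :
    pd v (pd v (fun y => u (Φ y))) x =
      hess u (Φ x) (pd v Φ x) (pd v Φ x) + fderiv ℝ u (Φ x) (pd v (pd v Φ) x) := by
  have e : pd v (fun y => u (Φ y)) =ᶠ[𝓝 x] fun y => fderiv ℝ u (Φ y) (pd v Φ y) := by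
    filter_upwards [sm_ev hΦ, hΦ.continuousAt.eventually (sm_ev hu)] with y h1 h2
    exact pd_map_comp h1 h2 v
  rw [pd_congr e, pd_clm_apply (sm_diff (sm_map_comp hΦ (sm_fderiv hu))) (sm_diff (sm_pd hΦ v)),
    pd_fderiv_comp hΦ hu]

/-- The sum of the second-order coefficients of the map `T` appearing in the Laplacian of a
composition. -/
def shiftBd (b : OrthonormalBasis ι ℝ E) (T : E → E) (x : E) : ℝ :=
  ∑ i, (2 * ‖pd (b i) T x‖ + ‖pd (b i) T x‖ ^ 2 + ‖pd (b i) (pd (b i) T) x‖)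

lemma Lap_shift {u : E → ℝ} {T : E → E} {x : E} {τ : ℝ} (h0 : 0 ≤ τ) (h1 : τ ≤ 1) (hT : 𝒞 T x)
    (hu : 𝒞 u (x + τ • T x)) :
    |Lap b (fun y => u (y + τ • T y)) x - Lap b u (x + τ • T x)| ≤
      τ * (shiftBd b T x * (‖hess u (x + τ • T x)‖ + ‖fderiv ℝ u (x + τ • T x)‖)) := by
  set Φ : E → E := fun y => y + τ • T y with hΦd
  have hΦ : 𝒞 Φ x := contDiffAt_id.add (contDiffAt_const.smul hT)
  have p1 : ∀ v y, DifferentiableAt ℝ T y → pd v Φ y = v + τ • pd v T y := by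
    intro v y hy
    have : pd v (fun y => τ • T y) y = τ • pd v T y := by
      unfold pd; rw [fderiv_fun_const_smul hy]; rfl
    rw [hΦd, pd_add (u := fun y => y) (w := fun y => τ • T y) differentiableAt_fun_id (hy.const_smul τ) v, this]
    simp [pd]
  have p2 : ∀ v, pd v (pd v Φ) x = τ • pd v (pd v T) x := by
    intro v
    have e : pd v Φ =ᶠ[𝓝 x] fun y => v + τ • pd v T y := (sm_ev hT).mono fun y hy => p1 v y hy
    have hd := sm_diff (sm_pd hT v)
    rw [pd_congr e]
    unfold pd at hd ⊢
    rw [fderiv_const_add, fderiv_fun_const_smul hd]; rfl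
  have e1 : Lap b (fun y => u (y + τ • T y)) x - Lap b u (x + τ • T x) =
      ∑ i, (τ * (hess u (Φ x) (b i) (pd (b i) T x) + hess u (Φ x) (pd (b i) T x) (b i))
        + τ * (τ * hess u (Φ x) (pd (b i) T x) (pd (b i) T x))
        + τ * fderiv ℝ u (Φ x) (pd (b i) (pd (b i) T) x)) := by
    rw [Lap_hess b hu]
    unfold Lap
    rw [← Finset.sum_sub_distrib]
    refine Finset.sum_congr rfl fun i _ => ?_
    rw [pd_pd_map_comp (Φ := Φ) hΦ hu, p2, p1 _ _ (sm_diff hT)]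
    simp only [map_add, map_smul, smul_eq_mul, _root_.add_apply, _root_.smul_apply]
    change _ - hess u (Φ x) (b i) (b i) = _
    ring
  rw [e1]
  have e2 : τ * (shiftBd b T x * (‖hess u (x + τ • T x)‖ + ‖fderiv ℝ u (x + τ • T x)‖)) =
      ∑ i, τ * ((2 * ‖pd (b i) T x‖ + ‖pd (b i) T x‖ ^ 2 + ‖pd (b i) (pd (b i) T) x‖) *
        (‖hess u (Φ x)‖ + ‖fderiv ℝ u (Φ x)‖)) := by
    rw [shiftBd, Finset.sum_mul, Finset.mul_sum]
  rw [e2]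
  refine (Finset.abs_sum_le_sum_abs _ _).trans (Finset.sum_le_sum fun i _ => ?_)
  set A := hess u (Φ x)
  set B := fderiv ℝ u (Φ x)
  set t := pd (b i) T x
  set s := pd (b i) (pd (b i) T) x
  have hb : ‖b i‖ = 1 := b.orthonormal.1 i
  have a1 : |A (b i) t| ≤ ‖A‖ * ‖t‖ := by
    have := A.le_opNorm₂ (b i) t; rwa [hb, mul_one] at this
  have a2 : |A t (b i)| ≤ ‖A‖ * ‖t‖ := by
    have := A.le_opNorm₂ t (b i); rwa [hb, mul_one] at this
  have a3 : |A t t| ≤ ‖A‖ * ‖t‖ ^ 2 := by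
    have := A.le_opNorm₂ t t; rw [mul_assoc, ← sq] at this; exact this
  have a4 : |B s| ≤ ‖B‖ * ‖s‖ := B.le_opNorm s
  have hA := norm_nonneg A
  have hB := norm_nonneg B
  have ht := norm_nonneg t
  have hs := norm_nonneg s
  have a5 : |τ * A t t| ≤ ‖A‖ * ‖t‖ ^ 2 := by
    rw [abs_mul, abs_of_nonneg h0]
    exact (mul_le_of_le_one_left (abs_nonneg _) h1).trans a3
  rw [show τ * (A (b i) t + A t (b i)) + τ * (τ * A t t) + τ * B s =
    τ * (A (b i) t + A t (b i) + τ * A t t + B s) by ring, abs_mul, abs_of_nonneg h0]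
  gcongr
  refine (abs_add_le _ _).trans ?_
  refine (add_le_add (abs_add_le _ _) le_rfl).trans ?_
  refine (add_le_add (add_le_add (abs_add_le _ _) le_rfl) le_rfl).trans ?_
  nlinarith [mul_nonneg hA hs, mul_nonneg hB ht, mul_nonneg hB (sq_nonneg ‖t‖)]

lemma Lap_rpow_le (hl : Dom b J l) {α : ℝ} (h0 : 0 < α) (h1 : α < 1) :
    ∃ c > 0, ∀ᶠ x in nb l, 𝒞 (fun y => l y ^ α) x ∧
      Lap b (fun y => l y ^ α) x ≤ -(c * l x ^ (α - 2)) := by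
  obtain ⟨a, ha, c, hc, hcol⟩ := hl.collar
  refine ⟨α * (1 - α) * c, mul_pos (mul_pos h0 (by linarith)) hc,
    nb_iff.2 ⟨a, ha, fun x hx hxa => ?_⟩⟩
  have hs : 𝒞 (fun s : ℝ => s ^ α) (l x) := Real.contDiffAt_rpow_const_of_ne hx.ne'
  refine ⟨sm_map_comp (hl.sm x) hs, ?_⟩
  rw [Lap_comp b hs (hl.sm x)]
  have d1 : ∀ p : ℝ, ∀ s : ℝ, 0 < s → deriv (fun s : ℝ => s ^ p) s = p * s ^ (p - 1) :=
    fun p s hs => Real.deriv_rpow_const (x := s) (p := p)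
  have d2 : deriv (deriv fun s : ℝ => s ^ α) (l x) = α * ((α - 1) * l x ^ (α - 2)) := by
    have e : deriv (fun s : ℝ => s ^ α) =ᶠ[𝓝 (l x)] fun s => α * s ^ (α - 1) := by
      filter_upwards [lt_mem_nhds hx] with s hs using d1 α s hs
    rw [e.deriv_eq, deriv_const_mul _ (Real.differentiableAt_rpow_const_of_ne _ hx.ne'), d1 _ _ hx]
    congr 3; ring
  rw [d1 _ _ hx, d2]
  have hL := hl.Lap_le hx
  have hg := hcol x hx hxa.le
  have q1 : 0 < l x ^ (α - 2) := Real.rpow_pos_of_pos hx _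
  have q2 : 0 < l x ^ (α - 1) := Real.rpow_pos_of_pos hx _
  have t1 : α * l x ^ (α - 1) * Lap b l x ≤ 0 :=
    mul_nonpos_of_nonneg_of_nonpos (by positivity) hL
  have t2 : c * (α * (1 - α) * l x ^ (α - 2)) ≤ gip b l l x * (α * (1 - α) * l x ^ (α - 2)) :=
    mul_le_mul_of_nonneg_right hg (mul_nonneg (mul_nonneg h0.le (by linarith)) q1.le)
  linarith

end Tangential

section TangentialDecay
variable {E : Type*} [NormedAddCommGroup E] [InnerProductSpace ℝ E]
  {ι : Type*} [Fintype ι] {b : OrthonormalBasis ι ℝ E} {J : E ≃ₗᵢ[ℝ] E} {l : E → ℝ}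

lemma Dk.ev {F : Type*} [NormedAddCommGroup F] [NormedSpace ℝ F] {f : E → F} {p : ℝ}
    (h : Dk l p f) : ∃ C > 0, ∀ᶠ x in nb l, ‖f x‖ ≤ C * l x ^ p := by
  obtain ⟨C, hC, a, ha, h⟩ := Dk_iff.1 h
  exact ⟨C, hC, nb_iff.2 ⟨a, ha, h⟩⟩

lemma shift_le {u : E → ℝ} {x v : E} {τ M : ℝ} (h0 : 0 ≤ τ)
    (hu : ∀ s ∈ Icc 0 τ, DifferentiableAt ℝ u (x + s • v))
    (hM : ∀ s ∈ Icc 0 τ, ‖fderiv ℝ u (x + s • v)‖ ≤ M) :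
    |u (x + τ • v) - u x| ≤ M * (τ * ‖v‖) := by
  have hs : ∀ y ∈ segment ℝ x (x + τ • v), ∃ s ∈ Icc 0 τ, y = x + s • v := by
    intro y hy
    rw [segment_eq_image'] at hy
    obtain ⟨t, ht, rfl⟩ := hy
    refine ⟨t * τ, ⟨mul_nonneg ht.1 h0, mul_le_of_le_one_left h0 ht.2⟩, ?_⟩
    simp only [add_sub_cancel_left, smul_smul]
  have := (convex_segment (𝕜 := ℝ) x (x + τ • v)).norm_image_sub_le_of_norm_fderiv_le (f := u) (C := M)
    (fun y hy => by obtain ⟨s, hs, rfl⟩ := hs y hy; exact hu s hs)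
    (fun y hy => by obtain ⟨s, hs, rfl⟩ := hs y hy; exact hM s hs)
    (left_mem_segment ℝ _ _) (right_mem_segment ℝ _ _)
  rwa [add_sub_cancel_left, norm_smul, Real.norm_of_nonneg h0] at this

lemma Dom.exists_hess_bound [FiniteDimensional ℝ E] (hl : Dom b J l) :
    ∃ M ≥ 0, ∀ x, ‖hess l x‖ ≤ M := by
  have hc : Continuous (hess l) :=
    continuous_iff_continuousAt.2 fun x => (sm_hess (hl.sm x)).continuousAt
  have hcn : Continuous fun x => ‖hess l x‖ :=
    (continuous_norm (E := E →L[ℝ] E →L[ℝ] ℝ)).comp hc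
  obtain ⟨M, hM⟩ := hl.cs.isCompact.exists_bound_of_continuousOn hcn.continuousOn
  refine ⟨max M 0, le_max_right _ _, fun x => ?_⟩
  by_cases hx : x ∈ tsupport l
  · have := hM x hx
    exact ((le_abs_self _).trans this).trans (le_max_left _ _)
  · have h0 : hess l x = 0 := by
      have e : l =ᶠ[𝓝 x] fun _ => 0 := notMem_tsupport_iff_eventuallyEq.1 hx
      have e2 : fderiv ℝ l =ᶠ[𝓝 x] fun _ => 0 := by
        filter_upwards [e.eventuallyEq_nhds] with y hy
        rw [hy.fderiv_eq, fderiv_const_apply]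
      unfold hess
      rw [e2.fderiv_eq, fderiv_const_apply]
    rw [h0, ContinuousLinearMap.opNorm_zero]
    exact le_max_right _ _

lemma sm_shiftBd {T : E → E} (hT : ∀ x, 𝒞 T x) : Continuous (shiftBd b T) := by
  have h1 : ∀ v, Continuous (pd v T) := fun v =>
    continuous_iff_continuousAt.2 fun x => (sm_pd (hT x) v).continuousAt
  have h2 : ∀ v, Continuous (pd v (pd v T)) := fun v =>
    continuous_iff_continuousAt.2 fun x => (sm_pd (sm_pd (hT x) v) v).continuousAt
  unfold shiftBd
  refine continuous_finsetSum _ fun i _ => ?_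
  have := h1 (b i)
  have := h2 (b i)
  fun_prop

theorem Dk.tangential [FiniteDimensional ℝ E] [Nonempty ι] (hl : Dom b J l) {α : ℝ} (hα : 1 / 2 < α)
    (hα1 : α < 1) {T : E → E} (hT : ∀ x, 𝒞 T x) (hTl : ∀ x, pd (T x) l x = 0) {v : E → ℝ}
    (hv : ∀ᶠ x in nb l, 𝒞 v x) (d0 : Dk l α v) (d1 : Dk l (α - 2) (fderiv ℝ v))
    (d2 : Dk l (α - 2) (hess v)) (d3 : Dk l (α - 2) (fderiv ℝ (Lap b v))) :
    Dk l α (fun x => pd (T x) v x) := by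
  obtain ⟨C0, hC0, d0⟩ := d0.ev
  obtain ⟨C1, hC1, d1⟩ := d1.ev
  obtain ⟨C2, hC2, d2⟩ := d2.ev
  obtain ⟨C3, hC3, d3⟩ := d3.ev
  obtain ⟨c, hc, hbar⟩ := Lap_rpow_le hl (by linarith) hα1
  obtain ⟨a, ha, H⟩ := nb_iff.1 (hv.and (d0.and (d1.and (d2.and (d3.and hbar)))))
  obtain ⟨M, hM0, hM⟩ := hl.exists_hess_bound
  obtain ⟨B1, hB1⟩ := hl.cs.isCompact.exists_bound_of_continuousOn
    (continuous_iff_continuousAt.2 fun x => (hT x).continuousAt).continuousOn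
  obtain ⟨B2, hB2⟩ := hl.cs.isCompact.exists_bound_of_continuousOn (sm_shiftBd (b := b) hT).continuousOn
  have hsub : ∀ x, 0 < l x → x ∈ tsupport l := fun x hx =>
    subset_tsupport _ (Function.mem_support.2 hx.ne')
  obtain ⟨B, hB, hBT, hBS⟩ : ∃ B > 0, (∀ x, 0 < l x → ‖T x‖ ≤ B) ∧ ∀ x, 0 < l x → |shiftBd b T x| ≤ B := by
    refine ⟨max 1 (max B1 B2), by positivity, fun x hx => ?_, fun x hx => ?_⟩
    · exact (hB1 x (hsub x hx)).trans ((le_max_left _ _).trans (le_max_right _ _))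
    · exact (hB2 x (hsub x hx)).trans ((le_max_right _ _).trans (le_max_right _ _))
  obtain ⟨K, hK, hKs⟩ : ∃ K > 0, ∀ x, 0 < l x → ∀ s : ℝ, |l (x + s • T x) - l x| ≤ K * s ^ 2 := by
    refine ⟨M * B ^ 2 + 1, by positivity, fun x hx s => ?_⟩
    have h := taylor2 (u := l) (x := x) (y := x + s • T x) (M := M) (fun z _ => hl.sm z) (fun z _ => hM z)
    have h0 : fderiv ℝ l x (T x) = 0 := hTl x
    rw [add_sub_cancel_left, map_smul, h0, smul_zero, sub_zero, norm_smul, mul_pow,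
      Real.norm_eq_abs, sq_abs] at h
    have h2 : ‖T x‖ ^ 2 ≤ B ^ 2 := by gcongr; exact hBT x hx
    calc _ ≤ _ := h
      _ ≤ M * (s ^ 2 * B ^ 2) := by gcongr
      _ ≤ (M * B ^ 2 + 1) * s ^ 2 := by nlinarith [sq_nonneg s]
  set C := max C1 (max C2 C3) with hCd
  have hC : 0 < C := by positivity
  set Q := (2 : ℝ) ^ |α| with hQ
  set P := (2 : ℝ) ^ |α - 2| with hP
  have hQ0 : 0 < Q := by positivity
  have hP0 : 0 < P := by positivity
  set a1 := a / 4 with ha1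
  have ha1' : 0 < a1 := by positivity
  set A := 3 * B * C * P / c + B * C * P * a1 ^ (-2 : ℝ) with hA
  have hA0 : 0 < A := by positivity
  set D : ℝ → ℝ := fun τ => τ⁻¹ * (C0 * (Q + 1) * (2 * K * τ ^ 2) ^ α) with hD
  have main : ∀ τ : ℝ, 0 < τ → τ ≤ 1 → 2 * K * τ ^ 2 ≤ a1 → ∀ σ : ℝ, |σ| = 1 → ∀ x, 2 * K * τ ^ 2 ≤ l x → l x ≤ a1 →
      σ * (τ⁻¹ * (v (x + τ • T x) - v x)) - A * l x ^ α - D τ ≤ 0 := by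
    intro τ hτ hτ1 hτa σ hσ
    have hs : 0 < 2 * K * τ ^ 2 := by positivity
    have hD0 : 0 < D τ := by positivity
    have near : ∀ x, 2 * K * τ ^ 2 ≤ l x → ∀ s ∈ Icc 0 τ,
        l x / 2 ≤ l (x + s • T x) ∧ l (x + s • T x) ≤ 2 * l x := by
      intro x hx s hs'
      have h1 := abs_le.1 (hKs x (hs.trans_le hx) s)
      have h2 : K * s ^ 2 ≤ K * τ ^ 2 := by have := hs'.1; have := hs'.2; gcongr
      constructor <;> linarith [h1.1, h1.2]
    have nearH : ∀ x, 2 * K * τ ^ 2 ≤ l x → l x ≤ a1 → ∀ s ∈ Icc 0 τ, 𝒞 v (x + s • T x) ∧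
        ‖v (x + s • T x)‖ ≤ C0 * (Q * l x ^ α) ∧ ‖fderiv ℝ v (x + s • T x)‖ ≤ C * (P * l x ^ (α - 2)) ∧
        ‖hess v (x + s • T x)‖ ≤ C * (P * l x ^ (α - 2)) ∧
        ‖fderiv ℝ (Lap b v) (x + s • T x)‖ ≤ C * (P * l x ^ (α - 2)) := by
      intro x hx hxa s hs'
      obtain ⟨h1, h2⟩ := near x hx s hs'
      have hx0 := hs.trans_le hx
      have hy0 : 0 < l (x + s • T x) := by linarith
      obtain ⟨g1, g2, g3, g4, g5, -⟩ := H _ hy0 (by linarith)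
      have r1 := rpow_le_of_mem (p := α) hx0 h1 h2
      have r2 := rpow_le_of_mem (p := α - 2) hx0 h1 h2
      have p1 : 0 ≤ l (x + s • T x) ^ (α - 2) := Real.rpow_nonneg hy0.le _
      refine ⟨g1, g2.trans (by gcongr), ?_, ?_, ?_⟩
      · exact g3.trans (mul_le_mul (le_max_left _ _) r2 p1 hC.le)
      · exact g4.trans (mul_le_mul ((le_max_left _ _).trans (le_max_right _ _)) r2 p1 hC.le)
      · exact g5.trans (mul_le_mul ((le_max_right _ _).trans (le_max_right _ _)) r2 p1 hC.le)
    have z0 : (0 : ℝ) ∈ Icc 0 τ := ⟨le_rfl, hτ.le⟩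
    have zτ : τ ∈ Icc 0 τ := ⟨hτ.le, le_rfl⟩
    have sg : ∀ y : ℝ, σ * y ≤ |y| := fun y => by
      calc σ * y ≤ |σ * y| := le_abs_self _
        _ = |y| := by rw [abs_mul, hσ, one_mul]
    have sg' : ∀ y : ℝ, -|y| ≤ σ * y := fun y => by
      calc σ * y ≥ -|σ * y| := neg_abs_le _
        _ = -|y| := by rw [abs_mul, hσ, one_mul]
    have smw : ∀ x, 2 * K * τ ^ 2 ≤ l x → l x ≤ a1 →
        𝒞 (fun y => v (y + τ • T y)) x ∧ 𝒞 v x ∧ 𝒞 (fun y => l y ^ α) x := by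
      intro x hx hxa
      have h0 := (nearH x hx hxa 0 z0).1
      rw [zero_smul, add_zero] at h0
      exact ⟨sm_map_comp (Φ := fun y => y + τ • T y) (contDiffAt_id.add (contDiffAt_const.smul (hT x)))
        (nearH x hx hxa τ zτ).1, h0, (H x (hs.trans_le hx) (by linarith)).2.2.2.2.2.1⟩
    refine hl.band_compare hs ?_ ?_ ?_ ?_
    · intro x hx hxa
      obtain ⟨s1, s2, s3⟩ := smw x hx hxa
      exact ((contDiffAt_const.mul (contDiffAt_const.mul (s1.sub s2))).sub
        (contDiffAt_const.mul s3)).sub contDiffAt_const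
    · intro x hx
      have hxa : l x ≤ a1 := hx.le.trans hτa
      · have h1 := (nearH x hx.ge hxa τ zτ).2.1
        have h0 := (H x (hs.trans_le hx.ge) (by linarith)).2.1
        have h2 : |v (x + τ • T x) - v x| ≤ C0 * (Q + 1) * l x ^ α := by
          rw [Real.norm_eq_abs] at h1 h0
          calc _ ≤ |v (x + τ • T x)| + |v x| := abs_sub _ _
            _ ≤ C0 * (Q * l x ^ α) + C0 * l x ^ α := add_le_add h1 h0
            _ = _ := by ring
        have h3 := sg (τ⁻¹ * (v (x + τ • T x) - v x))
        rw [abs_mul, abs_of_pos (inv_pos.2 hτ)] at h3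
        have h4 : τ⁻¹ * |v (x + τ • T x) - v x| ≤ D τ := by
          rw [hD]; beta_reduce; rw [← hx]; gcongr
        have : 0 ≤ A * l x ^ α := mul_nonneg hA0.le (Real.rpow_nonneg (hs.le.trans hx.ge) _)
        linarith
    · intro x hx
      have hxs : 2 * K * τ ^ 2 ≤ l x := hτa.trans hx.ge
      · have hx0 := hs.trans_le hxs
        have h1 := shift_le (u := v) (x := x) (v := T x) hτ.le
          (fun s hs' => sm_diff (nearH x hxs hx.le s hs').1)
          (fun s hs' => (nearH x hxs hx.le s hs').2.2.1)
        have h3 := sg (τ⁻¹ * (v (x + τ • T x) - v x))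
        rw [abs_mul, abs_of_pos (inv_pos.2 hτ)] at h3
        have p0 : 0 ≤ l x ^ (α - 2) := Real.rpow_nonneg hx0.le _
        have h4 : τ⁻¹ * |v (x + τ • T x) - v x| ≤ C * (P * l x ^ (α - 2)) * B := by
          rw [inv_mul_le_iff₀ hτ]
          refine h1.trans ?_
          have := hBT x hx0
          calc _ ≤ C * (P * l x ^ (α - 2)) * (τ * B) := by gcongr
            _ = _ := by ring
        have h5 : C * (P * l x ^ (α - 2)) * B = B * C * P * a1 ^ (-2 : ℝ) * l x ^ α := by
          rw [hx, sub_eq_add_neg, Real.rpow_add ha1']; ring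
        have h6 : 0 ≤ 3 * B * C * P / c * l x ^ α := by positivity
        have h7 : A * l x ^ α = 3 * B * C * P / c * l x ^ α + B * C * P * a1 ^ (-2 : ℝ) * l x ^ α := by
          rw [hA]; ring
        linarith
    · intro x hx hxa
      obtain ⟨s1, s2, s3⟩ := smw x hx.le hxa.le
      have hx0 := hs.trans hx
      have e : Lap b (fun x => σ * (τ⁻¹ * (v (x + τ • T x) - v x)) - A * l x ^ α - D τ) x =
          σ * (τ⁻¹ * (Lap b (fun y => v (y + τ • T y)) x - Lap b v x)) - A * Lap b (fun y => l y ^ α) x := by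
        rw [Lap_sub b ((contDiffAt_const.mul (contDiffAt_const.mul (s1.sub s2))).sub
          (contDiffAt_const.mul s3)) contDiffAt_const, Lap_const, sub_zero,
          Lap_sub b (contDiffAt_const.mul (contDiffAt_const.mul (s1.sub s2))) (contDiffAt_const.mul s3),
          Lap_const_mul b s3, Lap_const_mul b (contDiffAt_const.mul (s1.sub s2)),
          Lap_const_mul b (s1.sub s2), Lap_sub b s1 s2]
      rw [e]
      obtain ⟨g1, g2, g3, g4, g5⟩ := nearH x hx.le hxa.le τ zτ
      have h1 := shift_le (u := Lap b v) (x := x) (v := T x) hτ.le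
          (fun s hs' => sm_diff (sm_Lap b (nearH x hx.le hxa.le s hs').1))
          (fun s hs' => (nearH x hx.le hxa.le s hs').2.2.2.2)
      have h2 := Lap_shift (b := b) hτ.le hτ1 (hT x) g1
      have hb := (H x hx0 (by linarith)).2.2.2.2.2.2
      have p0 : 0 < l x ^ (α - 2) := Real.rpow_pos_of_pos hx0 _
      have h3 : |Lap b (fun y => v (y + τ • T y)) x - Lap b v x| ≤ τ * (3 * B * C * P * l x ^ (α - 2)) := by
        have t1 : τ * (shiftBd b T x * (‖hess v (x + τ • T x)‖ + ‖fderiv ℝ v (x + τ • T x)‖)) ≤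
            τ * (B * (C * (P * l x ^ (α - 2)) + C * (P * l x ^ (α - 2)))) := by
          have := (le_abs_self _).trans (hBS x hx0)
          gcongr
        have t2 : C * (P * l x ^ (α - 2)) * (τ * ‖T x‖) ≤ C * (P * l x ^ (α - 2)) * (τ * B) := by
          have := hBT x hx0
          gcongr
        have t3 := abs_add_le (Lap b (fun y => v (y + τ • T y)) x - Lap b v (x + τ • T x))
          (Lap b v (x + τ • T x) - Lap b v x)
        rw [sub_add_sub_cancel] at t3
        linarith
      have h4 := sg' (τ⁻¹ * (Lap b (fun y => v (y + τ • T y)) x - Lap b v x))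
      rw [abs_mul, abs_of_pos (inv_pos.2 hτ)] at h4
      have h5 : τ⁻¹ * |Lap b (fun y => v (y + τ • T y)) x - Lap b v x| ≤ 3 * B * C * P * l x ^ (α - 2) := by
        rw [inv_mul_le_iff₀ hτ]; exact h3
      have h6 : 3 * B * C * P * l x ^ (α - 2) ≤ A * (c * l x ^ (α - 2)) := by
        have : 0 ≤ B * C * P * a1 ^ (-2 : ℝ) := by positivity
        have h7 : 3 * B * C * P ≤ A * c := by
          rw [hA, add_mul, div_mul_cancel₀ _ hc.ne']
          have := mul_nonneg this hc.le
          linarith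
        calc _ ≤ A * c * l x ^ (α - 2) := by gcongr
          _ = _ := by ring
      have h8 : A * Lap b (fun y => l y ^ α) x ≤ A * -(c * l x ^ (α - 2)) := by gcongr
      linarith
  have hDlim : Tendsto D (𝓝[>] 0) (𝓝 0) := by
    have e : ∀ τ : ℝ, 0 < τ → D τ = C0 * (Q + 1) * (2 * K) ^ α * τ ^ (2 * α - 1) := by
      intro τ hτ
      rw [hD]; beta_reduce
      rw [Real.mul_rpow (by positivity) (by positivity), ← Real.rpow_natCast τ 2, ← Real.rpow_mul hτ.le,
        Real.rpow_sub hτ, Real.rpow_one]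
      push_cast
      field_simp
    have h1 : Tendsto (fun τ : ℝ => τ ^ (2 * α - 1)) (𝓝 0) (𝓝 0) := by
      have := (Real.continuousAt_rpow_const (0 : ℝ) (2 * α - 1) (Or.inr (by linarith))).tendsto
      rwa [Real.zero_rpow (by linarith)] at this
    have h2 := (h1.const_mul (C0 * (Q + 1) * (2 * K) ^ α)).mono_left (nhdsWithin_le_nhds (s := Ioi 0))
    rw [mul_zero] at h2
    refine h2.congr' ?_
    filter_upwards [self_mem_nhdsWithin] with τ hτ using (e τ hτ).symm
  refine Dk.of_le (C := A) (nb_iff.2 ⟨a1, ha1', fun x hx hxa => ?_⟩)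
  have hvx : 𝒞 v x := (H x hx (by linarith)).1
  have hw := ((sm_diff hvx).hasFDerivAt.hasLineDerivAt (T x)).tendsto_slope_zero_right
  change Tendsto _ _ (𝓝 (pd (T x) v x)) at hw
  have hsm : ∀ᶠ τ : ℝ in 𝓝[>] 0, 0 < τ ∧ τ ≤ 1 ∧ 2 * K * τ ^ 2 ≤ l x := by
    have h1 : Tendsto (fun τ : ℝ => 2 * K * τ ^ 2) (𝓝 0) (𝓝 0) := by
      have : Continuous fun τ : ℝ => 2 * K * τ ^ 2 := by fun_prop
      simpa using this.tendsto 0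
    filter_upwards [self_mem_nhdsWithin, nhdsWithin_le_nhds (Iio_mem_nhds one_pos),
      nhdsWithin_le_nhds (h1.eventually (gt_mem_nhds hx))] with τ h1 h2 h3 using ⟨h1, h2.le, h3.le⟩
  have lim : ∀ σ : ℝ, |σ| = 1 → σ * pd (T x) v x ≤ A * l x ^ α := by
    intro σ hσ
    have h1 : Tendsto (fun τ => A * l x ^ α + D τ) (𝓝[>] 0) (𝓝 (A * l x ^ α + 0)) := hDlim.const_add _
    rw [add_zero] at h1
    refine le_of_tendsto_of_tendsto (hw.const_mul σ) h1 ?_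
    filter_upwards [hsm] with τ hτ
    have := main τ hτ.1 hτ.2.1 (hτ.2.2.trans hxa.le) σ hσ x hτ.2.2 hxa.le
    rw [smul_eq_mul]
    linarith
  rw [Real.norm_eq_abs, abs_le]
  constructor
  · have := lim (-1) (by simp); linarith
  · have := lim 1 (by simp); linarith

end TangentialDecay

section Chain
variable {E : Type*} [NormedAddCommGroup E] [InnerProductSpace ℝ E]
  {ι : Type*} [Fintype ι] (b : OrthonormalBasis ι ℝ E) {J : E ≃ₗᵢ[ℝ] E} {l : E → ℝ}

/-- The gradient in the orthonormal basis `b`. -/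
def grd (u : E → ℝ) (x : E) : E := ∑ i, pd (b i) u x • b i

lemma inner_grd (u : E → ℝ) (x v : E) : inner ℝ (grd b u x) v = fderiv ℝ u x v := by
  unfold grd pd
  rw [sum_inner]
  conv_rhs => rw [← sum_inner_smul b v, map_sum]
  exact Finset.sum_congr rfl fun i _ => by rw [real_inner_smul_left, map_smul, smul_eq_mul, mul_comm]

lemma sm_grd {u : E → ℝ} {x : E} (h : 𝒞 u x) : 𝒞 (grd b u) x :=
  ContDiffAt.sum fun i _ => (sm_pd h (b i)).smul contDiffAt_const

lemma norm_grd_sq (u : E → ℝ) (x : E) : ‖grd b u x‖ ^ 2 = gip b u u x := by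
  rw [← real_inner_self_eq_norm_sq, inner_grd]
  unfold grd gip
  rw [map_sum]
  exact Finset.sum_congr rfl fun i _ => by rw [map_smul]; rfl

/-- The tangential part of the constant vector `v`, scaled by the squared gradient of `l`. -/
def tanF (l : E → ℝ) (v x : E) : E := ‖grd b l x‖ ^ 2 • v - inner ℝ (grd b l x) v • grd b l x

lemma sm_tanF (hl : Dom b J l) (v x : E) : 𝒞 (tanF b l v) x := by
  have := sm_grd b (hl.sm x)
  exact ((this.norm_sq ℝ).smul contDiffAt_const).sub ((this.inner ℝ contDiffAt_const).smul this)

lemma tanF_tangent (v x : E) : pd (tanF b l v x) l x = 0 := by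
  change fderiv ℝ l x _ = 0
  rw [← inner_grd b, tanF, inner_sub_right, inner_smul_right, inner_smul_right,
    real_inner_self_eq_norm_sq]
  ring

variable {b}

lemma inv_norm_grd (hl : Dom b J l) : Dk l 0 (fun x => (‖grd b l x‖ ^ 2)⁻¹) := by
  obtain ⟨a, ha, c, hc, h⟩ := hl.collar
  refine Dk.of_le (C := c⁻¹) (nb_iff.2 ⟨a, ha, fun x h1 h2 => ?_⟩)
  have := h x h1 h2.le
  rw [norm_grd_sq, Real.rpow_zero, mul_one, norm_inv, Real.norm_of_nonneg (hc.le.trans this)]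
  gcongr

lemma grd_ne (hl : Dom b J l) : ∀ᶠ x in nb l, ‖grd b l x‖ ^ 2 ≠ 0 := by
  obtain ⟨a, ha, c, hc, h⟩ := hl.collar
  refine nb_iff.2 ⟨a, ha, fun x h1 h2 => ?_⟩
  rw [norm_grd_sq]
  exact (hc.trans_le (h x h1 h2.le)).ne'

lemma Dk.smooth {F : Type*} [NormedAddCommGroup F] [NormedSpace ℝ F] (hl : Dom b J l) {f : E → F}
    (h : ∀ x, 𝒞 f x) : Dk l 0 f :=
  Dk.of_continuous hl.cs (continuous_iff_continuousAt.2 fun x => (h x).continuousAt)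

/-- A function smooth near the zero level which, with its gradient, is `O(l ^ p)`. -/
structure D1 (l : E → ℝ) (p : ℝ) (f : E → ℝ) : Prop where
  sm : ∀ᶠ x in nb l, 𝒞 f x
  val : Dk l p f
  der : Dk l p (fderiv ℝ f)

namespace D1
variable {p : ℝ} {f g : E → ℝ}

lemma add (hf : D1 l p f) (hg : D1 l p g) : D1 l p (fun x => f x + g x) := by
  refine ⟨(hf.sm.and hg.sm).mono fun x h => h.1.add h.2, hf.val.add hg.val,
    (hf.der.add hg.der).congr' ?_⟩
  filter_upwards [hf.sm, hg.sm] with x h1 h2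
  exact (fderiv_fun_add (sm_diff h1) (sm_diff h2)).symm

lemma zero : D1 l p (fun _ : E => (0 : ℝ)) := by
  refine ⟨Eventually.of_forall fun x => contDiffAt_const, Dk.zero, ?_⟩
  refine (Dk.zero (F := E →L[ℝ] ℝ)).congr' (Eventually.of_forall fun x => ?_)
  rw [fderiv_fun_const]; rfl

lemma sum {κ : Type*} (s : Finset κ) {f : κ → E → ℝ} (h : ∀ k ∈ s, D1 l p (f k)) :
    D1 l p (fun x => ∑ k ∈ s, f k x) := by
  classical
  induction s using Finset.induction_on with
  | empty => simpa using zero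
  | insert k s hk ih =>
    simp only [Finset.sum_insert hk]
    exact (h k (Finset.mem_insert_self _ _)).add (ih fun j hj => h j (Finset.mem_insert_of_mem hj))

lemma smul (hl : Dom b J l) {τ : E → ℝ} (hτ : ∀ x, 𝒞 τ x) (hf : D1 l p f) :
    D1 l p (fun x => τ x * f x) := by
  have h0 := Dk.smooth hl hτ
  have h1 := Dk.smooth hl fun x => sm_fderiv (hτ x)
  refine ⟨hf.sm.mono fun x h => (hτ x).mul h, h0.mul hf.val (by simp), ?_⟩
  have h2 : Dk l p fun x => τ x • fderiv ℝ f x := h0.smul hf.der (by simp)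
  have h3 : Dk l p fun x => f x • fderiv ℝ τ x := hf.val.smul h1 (by simp)
  refine (h2.add h3).congr' ?_
  filter_upwards [hf.sm] with x hx
  exact (fderiv_fun_mul (sm_diff (hτ x)) (sm_diff hx)).symm

lemma congr (hl : Dom b J l) (hf : D1 l p f) (e : ∀ᶠ x in nb l, f x = g x) : D1 l p g := by
  have e' : ∀ᶠ x in nb l, f =ᶠ[𝓝 x] g := nb_nhds hl.cont e
  refine ⟨?_, hf.val.congr' e, hf.der.congr' (e'.mono fun x h => h.fderiv_eq)⟩
  filter_upwards [hf.sm, e'] with x h1 h2 using h1.congr_of_eventuallyEq h2.symm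

end D1

variable [FiniteDimensional ℝ E] [MeasurableSpace E] [BorelSpace E] {μ : Measure E}
  [μ.IsAddHaarMeasure] {k : E → ℝ} {u : E → ℝ}

section First
variable (hk : MVKernel b μ k) (hl : Dom b J l) (hu : HN b l u) (h1 : Dk l 1 u)
include hk hl hu h1

lemma grad_bd : Dk l 0 (fderiv ℝ u) := (Dk.grad hk hl hu h1).mono (by norm_num)

lemma tangent_bd [Nonempty ι] {T : E → E} (hT : ∀ x, 𝒞 T x) (hTl : ∀ x, pd (T x) l x = 0) :
    Dk l (3 / 4) (fun x => fderiv ℝ u x (T x)) := by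
  have h2 := grad_bd hk hl hu h1
  refine Dk.tangential hl (by norm_num) (by norm_num) hT hTl (hu.mono fun x h => h.1)
    (h1.mono (by norm_num)) (h2.mono (by norm_num))
    ((Dk.hess_of_grad hk hl hu h2).mono (by norm_num)) ?_
  refine (Dk.zero (F := E →L[ℝ] ℝ)).congr' ?_
  have := nb_nhds hl.cont hu
  filter_upwards [this] with x hx
  have e : Lap b u =ᶠ[𝓝 x] fun _ => 0 := hx.mono fun y hy => hy.2
  rw [e.fderiv_eq, fderiv_fun_const]; rfl

lemma frozen_bd [Nonempty ι] {T : E → E} (hT : ∀ x, 𝒞 T x) (hTl : ∀ x, pd (T x) l x = 0) :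
    Dk l (-1 / 4) (fun x => hess u x (T x)) := by
  obtain ⟨C, hC, hgr⟩ := hk.grad_est
  obtain ⟨κ, hκ, hrad⟩ := hl.exists_rad
  obtain ⟨A, hA, a, ha, hA'⟩ := Dk_iff.1 (tangent_bd hk hl hu h1 hT hTl)
  obtain ⟨G, hG, a2, ha2, hG'⟩ := Dk_iff.1 (grad_bd hk hl hu h1)
  obtain ⟨a', ha', hu'⟩ := nb_iff.1 hu
  obtain ⟨B0, hB0⟩ := hl.cs.isCompact.exists_bound_of_continuousOn
    (continuous_iff_continuousAt.2 fun x => (sm_fderiv (hT x)).continuousAt).continuousOn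
  obtain ⟨B, hB, hBT⟩ : ∃ B > 0, ∀ x, 0 < l x → ‖fderiv ℝ T x‖ ≤ B :=
    ⟨max 1 B0, by positivity, fun x hx => (hB0 x (subset_tsupport _
      (Function.mem_support.2 hx.ne'))).trans (le_max_right _ _)⟩
  refine Dk.of_le (C := C * (A * 2 ^ |(3 / 4 : ℝ)| + G * (B * κ)) / κ)
    (nb_iff.2 ⟨min 1 (min a (min a2 a')) / 2, by positivity, ?_⟩)
  intro x h3 h4
  have hr : 0 < κ * l x := by positivity
  have m1 := min_le_left 1 (min a (min a2 a'))
  have m2 := (min_le_right 1 (min a (min a2 a'))).trans (min_le_left _ _)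
  have m3 := (min_le_right 1 (min a (min a2 a'))).trans ((min_le_right _ _).trans (min_le_left _ _))
  have m4 := (min_le_right 1 (min a (min a2 a'))).trans ((min_le_right _ _).trans (min_le_right _ _))
  have hb : ∀ y ∈ ball x (κ * l x), 0 < l y ∧ l y < a ∧ l y < a2 ∧ l y < a' ∧
      l y ^ (3 / 4 : ℝ) ≤ 2 ^ |(3 / 4 : ℝ)| * l x ^ (3 / 4 : ℝ) := by
    intro y hy
    obtain ⟨h5, h6⟩ := hrad x h3 y hy
    exact ⟨by linarith, by linarith, by linarith, by linarith, rpow_le_of_mem h3 h5.le h6.le⟩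
  have hx1 : l x ≤ l x ^ (3 / 4 : ℝ) := by
    conv_lhs => rw [← Real.rpow_one (l x)]
    exact Real.rpow_le_rpow_of_exponent_ge h3 (by linarith) (by norm_num)
  have hlip : ∀ y ∈ ball x (κ * l x), ‖T x - T y‖ ≤ B * (κ * l x) := by
    intro y hy
    have := (convex_ball x (κ * l x)).norm_image_sub_le_of_norm_fderiv_le (𝕜 := ℝ) (f := T) (C := B)
      (fun y _ => sm_diff (hT y)) (fun y hy => hBT y (hb y hy).1) hy (mem_ball_self hr)
    refine this.trans ?_
    gcongr
    rw [← dist_eq_norm, dist_comm]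
    exact (mem_ball.1 hy).le
  have key := hgr x (κ * l x) ((A * 2 ^ |(3 / 4 : ℝ)| + G * (B * κ)) * l x ^ (3 / 4 : ℝ)) (pd (T x) u) hr
    (Harm.pd isOpen_ball (fun y hy => hu' y (hb y hy).1 (hb y hy).2.2.2.1) _) (fun y hy => by
      have e : pd (T x) u y = fderiv ℝ u y (T y) + fderiv ℝ u y (T x - T y) := by
        rw [map_sub]; simp [pd]
      have h5 := hA' y (hb y hy).1 (hb y hy).2.1
      have h6 := hG' y (hb y hy).1 (hb y hy).2.2.1
      rw [Real.rpow_zero, mul_one] at h6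
      rw [Real.norm_eq_abs] at h5
      have h7 : |fderiv ℝ u y (T x - T y)| ≤ G * (B * (κ * l x)) :=
        ((fderiv ℝ u y).le_opNorm _).trans (by gcongr; exact hlip y hy)
      rw [e]
      calc _ ≤ _ := abs_add_le _ _
        _ ≤ A * (2 ^ |(3 / 4 : ℝ)| * l x ^ (3 / 4 : ℝ)) + G * (B * (κ * l x ^ (3 / 4 : ℝ))) := by
          refine add_le_add (h5.trans ?_) (h7.trans ?_)
          · exact mul_le_mul_of_nonneg_left (hb y hy).2.2.2.2 hA.le
          · gcongr
        _ = _ := by ring)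
  have hux : 𝒞 u x := (hu' x h3 (by linarith)).1
  have e : C * ((A * 2 ^ |(3 / 4 : ℝ)| + G * (B * κ)) * l x ^ (3 / 4 : ℝ)) / (κ * l x) =
      C * (A * 2 ^ |(3 / 4 : ℝ)| + G * (B * κ)) / κ * l x ^ (-1 / 4 : ℝ) := by
    rw [show (-1 / 4 : ℝ) = 3 / 4 - 1 by norm_num, Real.rpow_sub h3, Real.rpow_one]; field_simp
  rw [e] at key
  refine ContinuousLinearMap.opNorm_le_bound _
    (mul_nonneg (by positivity) (Real.rpow_nonneg h3.le _)) fun v => ?_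
  have := key v
  rw [pd_pd hux, hess_symm hux] at this
  exact this

end First
end Chain

section Chain2
variable {E : Type*} [NormedAddCommGroup E] [InnerProductSpace ℝ E]
  {ι : Type*} [Fintype ι] {b : OrthonormalBasis ι ℝ E} {J : E ≃ₗᵢ[ℝ] E} {l : E → ℝ}

/-- The ratio of the normal derivatives of `u` and `l`. -/
def kap (b : OrthonormalBasis ι ℝ E) (l u : E → ℝ) (x : E) : ℝ :=
  (‖grd b l x‖ ^ 2)⁻¹ * fderiv ℝ u x (grd b l x)

lemma tanF_split (v x : E) :
    ‖grd b l x‖ ^ 2 • v = tanF b l v x + inner ℝ (grd b l x) v • grd b l x := by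
  rw [tanF, sub_add_cancel]

variable [FiniteDimensional ℝ E] [MeasurableSpace E] [BorelSpace E] {μ : Measure E}
  [μ.IsAddHaarMeasure] {k : E → ℝ} {u : E → ℝ}
variable (hk : MVKernel b μ k) (hl : Dom b J l) (hu : HN b l u) (h1 : Dk l 1 u)
include hk hl hu h1

lemma normal_bd [Nonempty ι] :
    Dk l (3 / 4) (fun x => fderiv ℝ u x - kap b l u x • fderiv ℝ l x) := by
  refine Dk.of_basis b fun i => ?_
  have h2 := (inv_norm_grd hl).mul (tangent_bd hk hl hu h1 (sm_tanF b hl (b i)) (tanF_tangent b (b i)))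
    (r := 3 / 4) (by norm_num)
  refine h2.congr' ?_
  filter_upwards [grd_ne hl] with x hx
  have e : fderiv ℝ u x (tanF b l (b i) x) = ‖grd b l x‖ ^ 2 * fderiv ℝ u x (b i)
      - fderiv ℝ l x (b i) * fderiv ℝ u x (grd b l x) := by
    rw [tanF, map_sub, map_smul, map_smul, inner_grd]; rfl
  rw [e, _root_.sub_apply, _root_.smul_apply, smul_eq_mul, kap,
    mul_sub, inv_mul_cancel_left₀ hx]
  ring

lemma kap_bd : Dk l 0 (kap b l u) := by
  have h2 := grad_bd hk hl hu h1
  have h3 : Dk l 0 (grd b l) := Dk.smooth hl fun x => sm_grd b (hl.sm x)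
  exact (inv_norm_grd hl).mul (h2.clm h3 (r := 0) (by norm_num)) (by norm_num)

lemma hess_bd [Nonempty ι] : Dk l (-1 / 4) (hess u) := by
  set R := grd b l
  set ρ : E → ℝ := fun x => ‖R x‖ ^ 2
  have sR : ∀ x, 𝒞 R x := fun x => sm_grd b (hl.sm x)
  have dR : Dk l 0 R := Dk.smooth hl sR
  have di : Dk l 0 fun x => (ρ x)⁻¹ := inv_norm_grd hl
  have hT : ∀ v, Dk l (-1 / 4) fun x => hess u x (tanF b l v x) := fun v =>
    frozen_bd hk hl hu h1 (sm_tanF b hl v) (tanF_tangent b v)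
  have dl : ∀ v, Dk l 0 fun x => fderiv ℝ l x v := fun v =>
    Dk.smooth hl fun x => sm_pd (hl.sm x) v
  have hsum : Dk l (-1 / 4) fun x => ∑ i, hess u x (tanF b l (b i) x) (b i) :=
    Dk.sum fun i _ => (hT (b i)).clm_const (b i)
  have hRR : Dk l (-1 / 4) fun x => hess u x (R x) (R x) := by
    refine hsum.neg.congr' ?_
    filter_upwards [hu] with x hx
    have e1 : ∀ i, hess u x (tanF b l (b i) x) (b i) =
        ρ x * hess u x (b i) (b i) - hess u x (R x) (inner ℝ (R x) (b i) • b i) := by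
      intro i
      rw [tanF, map_sub, map_smul, map_smul, map_smul]; rfl
    have e2 : ∑ i, inner ℝ (R x) (b i) • b i = R x := by
      conv_rhs => rw [← sum_inner_smul b (R x)]
      exact Finset.sum_congr rfl fun i _ => by rw [real_inner_comm]
    simp only [e1]
    rw [Finset.sum_sub_distrib, ← Finset.mul_sum, ← Lap_hess b hx.1, hx.2, ← map_sum, e2]
    ring
  have hRb : ∀ v, Dk l (-1 / 4) fun x => hess u x (R x) v := by
    intro v
    have t1 : Dk l (-1 / 4) fun x => hess u x (tanF b l v x) (R x) := (hT v).clm dR (by norm_num)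
    have t2 := (dl v).mul hRR (r := -1 / 4) (by norm_num)
    refine (di.mul (t1.add t2) (r := -1 / 4) (by norm_num)).congr' ?_
    filter_upwards [hu, grd_ne hl] with x hx hn
    have e := congrArg (fun w => hess u x (R x) w) (tanF_split (b := b) (l := l) v x)
    simp only [map_add, map_smul, inner_grd, smul_eq_mul] at e
    rw [hess_symm hx.1 (tanF b l v x), inv_mul_eq_iff_eq_mul₀ hn]
    exact e.symm
  refine Dk.of_basis b fun i => ?_
  have t2 : Dk l (-1 / 4) fun x => hess u x (R x) := Dk.of_basis b fun j => hRb (b j)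
  have t3 := (dl (b i)).smul t2 (r := -1 / 4) (by norm_num)
  refine (di.smul ((hT (b i)).add t3) (r := -1 / 4) (by norm_num)).congr' ?_
  filter_upwards [grd_ne hl] with x hn
  have e := congrArg (fun w => hess u x w) (tanF_split (b := b) (l := l) (b i) x)
  simp only [map_add, map_smul, inner_grd] at e
  rw [← e]
  exact inv_smul_smul₀ hn _

lemma levi_bd [Nonempty ι] {S T : E → E} (hT : ∀ x, 𝒞 T x) (hTl : ∀ x, pd (T x) l x = 0)
    (hS : ∀ x, 𝒞 S x) (hSl : ∀ x, pd (S x) l x = 0) :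
    Dk l (3 / 4) (fun x => hess u x (S x) (T x) - kap b l u x * hess l x (S x) (T x)) := by
  have d0 := grad_bd hk hl hu h1
  have d1 := hess_bd hk hl hu h1
  have sm : ∀ᶠ x in nb l, 𝒞 u x := hu.mono fun x h => h.1
  have w1 : ∀ i, D1 l (-5 / 4) (pd (b i) u) := fun i => by
    have hd : Dk l (-1 / 4) (fderiv ℝ (pd (b i) u)) := by
      refine Dk.of_basis b fun j => ((d1.clm_const (b j)).clm_const (b i)).congr' ?_
      filter_upwards [sm] with x hx using (pd_pd hx (b j) (b i)).symm
    exact ⟨sm.mono fun x h => sm_pd h _, (d0.clm_const (b i)).mono (by norm_num), hd.mono (by norm_num)⟩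
  have w2 : ∀ i j, D1 l (-5 / 4) (pd (b j) (pd (b i) u)) := fun i j => by
    have hd : Dk l (-1 / 4) (pd (b j) (pd (b i) u)) := by
      refine ((d1.clm_const (b j)).clm_const (b i)).congr' ?_
      filter_upwards [sm] with x hx using (pd_pd hx (b j) (b i)).symm
    refine ⟨sm.mono fun x h => sm_pd (sm_pd h _) _, hd.mono (by norm_num), ?_⟩
    have := Dk.grad hk hl ((hu.pd hl.cont (b i)).pd hl.cont (b j)) hd
    exact this.mono (by norm_num)
  set t : ι → E → ℝ := fun i x => inner ℝ (b i) (T x)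
  have st : ∀ i x, 𝒞 (t i) x := fun i x => contDiffAt_const.inner ℝ (hT x)
  set v : E → ℝ := fun x => ∑ i, t i x * pd (b i) u x
  have ev : ∀ x, v x = fderiv ℝ u x (T x) := by
    intro x
    conv_rhs => rw [← sum_inner_smul b (T x), map_sum]
    exact Finset.sum_congr rfl fun i _ => by rw [map_smul]; rfl
  have ev' : v = fun x => fderiv ℝ u x (T x) := funext ev
  have D1v : D1 l (-5 / 4) v := D1.sum _ fun i _ => (w1 i).smul hl (st i)
  have D1p : ∀ j, D1 l (-5 / 4) (pd (b j) v) := by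
    intro j
    have h : D1 l (-5 / 4) fun x => ∑ i, (t i x * pd (b j) (pd (b i) u) x + pd (b j) (t i) x * pd (b i) u x) :=
      D1.sum _ fun i _ => ((w2 i j).smul hl (st i)).add ((w1 i).smul hl fun x => sm_pd (st i x) _)
    refine h.congr hl ?_
    filter_upwards [sm] with x hx
    have e : pd (b j) v x = ∑ i, pd (b j) (fun y => t i y * pd (b i) u y) x := by
      have := fderiv_fun_sum (𝕜 := ℝ) (u := Finset.univ) (A := fun i y => t i y * pd (b i) u y) (x := x)
        fun i _ => (sm_diff (st i x)).mul (sm_diff (sm_pd hx (b i)))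
      change fderiv ℝ v x (b j) = _
      rw [this, _root_.sum_apply]
      rfl
    rw [e]
    refine Finset.sum_congr rfl fun i _ => ?_
    rw [pd_mul (sm_diff (st i x)) (sm_diff (sm_pd hx (b i))) (b j), mul_comm (pd (b i) u x)]
  have D1L : D1 l (-5 / 4) (Lap b v) := by
    have h : D1 l (-5 / 4) fun x => ∑ i, (∑ j, (2 * pd (b j) (t i) x) * pd (b j) (pd (b i) u) x +
        Lap b (t i) x * pd (b i) u x) :=
      D1.sum _ fun i _ => (D1.sum _ fun j _ => (w2 i j).smul hl
        (fun x => contDiffAt_const.mul (sm_pd (st i x) _))).add ((w1 i).smul hl fun x => sm_Lap b (st i x))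
    refine h.congr hl ?_
    have hp : ∀ᶠ x in nb l, ∀ i, Lap b (pd (b i) u) x = 0 :=
      eventually_all.2 fun i => (hu.pd hl.cont (b i)).mono fun x h => h.2
    filter_upwards [sm, hp] with x hx hp
    rw [Lap_sum b _ fun i _ => (st i x).mul (sm_pd hx (b i))]
    refine Finset.sum_congr rfl fun i _ => ?_
    rw [Lap_mul b (st i x) (sm_pd hx (b i)), hp i, mul_zero, zero_add, gip, Finset.mul_sum,
      mul_comm (pd (b i) u x)]
    simp only [mul_assoc]
  have hv : Dk l (3 / 4) fun x => pd (S x) v x := by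
    refine Dk.tangential hl (by norm_num) (by norm_num) hS hSl D1v.sm ?_ ?_ ?_ ?_
    · rw [ev']; exact tangent_bd hk hl hu h1 hT hTl
    · exact D1v.der.mono (by norm_num)
    · refine Dk.of_basis b fun i => Dk.of_basis b fun j => ?_
      have := (D1p j).der.clm_const (b i)
      refine (this.congr' ?_ : Dk l (-5 / 4) _).mono (by norm_num)
      filter_upwards [D1v.sm] with x hx using pd_pd hx (b i) (b j)
    · exact D1L.der.mono (by norm_num)
  have dST : Dk l 0 fun x => pd (S x) T x := by
    have := Dk.smooth hl fun x => sm_fderiv (hT x)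
    exact this.clm (Dk.smooth hl hS) (by norm_num)
  have hn := (normal_bd hk hl hu h1).clm dST (r := 3 / 4) (by norm_num)
  refine (hv.sub hn).congr' ?_
  filter_upwards [sm] with x hx
  have e1 : pd (S x) v x = hess u x (S x) (T x) + fderiv ℝ u x (pd (S x) T x) := by
    rw [ev', pd_clm_apply (sm_diff (sm_fderiv hx)) (sm_diff (hT x))]; rfl
  have e2 : hess l x (S x) (T x) + fderiv ℝ l x (pd (S x) T x) = 0 := by
    have h0 : (fun y => fderiv ℝ l y (T y)) = fun _ => 0 := funext fun y => hTl y
    have := pd_clm_apply (sm_diff (sm_fderiv (hl.sm x))) (sm_diff (hT x)) (S x)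
    rw [h0, pd_const] at this
    exact this.symm
  rw [e1, _root_.sub_apply, _root_.smul_apply, smul_eq_mul]
  linear_combination (kap b l u x) * e2

end Chain2

section NormalDeriv
variable {E : Type*} [NormedAddCommGroup E] [InnerProductSpace ℝ E]
  {ι : Type*} [Fintype ι] {b : OrthonormalBasis ι ℝ E} {J : E ≃ₗᵢ[ℝ] E} {l : E → ℝ}
variable [FiniteDimensional ℝ E] [MeasurableSpace E] [BorelSpace E] {μ : Measure E}
  [μ.IsAddHaarMeasure] {k : E → ℝ} {u : E → ℝ}

lemma kap_ge [Nonempty ι] (hk : MVKernel b μ k) (hl : Dom b J l) (hu : HN b l u) (h1 : Dk l 1 u)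
    {c : ℝ} (hc : 0 < c) (hge : ∀ᶠ x in nb l, c * l x ≤ u x) :
    ∃ c' > 0, ∀ᶠ x in nb l, c' ≤ kap b l u x := by
  obtain ⟨C, hC, e1⟩ := h1.ev
  obtain ⟨C4, hC4, e2⟩ := (hess_bd hk hl hu h1).ev
  obtain ⟨a0, ha0, c0, hc0, hcol⟩ := hl.collar
  obtain ⟨M, hM0, hM⟩ := hl.exists_hess_bound
  set δ := min (1 / 2) (c / (4 * C)) with hδ
  have hδ0 : 0 < δ := by positivity
  have hδ1 : δ ≤ 1 / 2 := min_le_left _ _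
  have hδ2 : 2 * C * δ ≤ c / 2 := by
    have : δ ≤ c / (4 * C) := min_le_right _ _
    calc 2 * C * δ ≤ 2 * C * (c / (4 * C)) := by gcongr
      _ = c / 2 := by field_simp; norm_num
  set M1 := M / c0 with hM1
  have hM10 : 0 ≤ M1 := by positivity
  set C5 := C4 * (δ / 2) ^ (-1 / 4 : ℝ) / c0 with hC5
  have hC50 : 0 < C5 := by positivity
  have e3 : ∀ᶠ x in nb l, l x ^ (3 / 4 : ℝ) ≤ c / 4 / C5 := by
    have h : Dk l (3 / 4) fun x => l x ^ (3 / 4 : ℝ) := Asymptotics.isBigO_refl _ _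
    exact (h.ev_le (by norm_num) (ε := c / 4 / C5) (by positivity)).mono fun x hx =>
      (le_abs_self _).trans hx
  obtain ⟨a, ha, H⟩ := nb_iff.1 (hu.and (e1.and (e2.and (hge.and e3))))
  refine ⟨c / 4, by positivity, nb_iff.2 ⟨min (a / 2) (min a0 (δ / (2 * (M1 + 1)))), by positivity, ?_⟩⟩
  intro x hx hxa
  have i1 := hxa.trans_le (min_le_left _ _)
  have i2 := (hxa.trans_le (min_le_right _ _)).trans_le (min_le_left _ _)
  have i3 := (hxa.trans_le (min_le_right _ _)).trans_le (min_le_right _ _)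
  have i4 : M1 * l x ≤ δ / 2 := by
    calc M1 * l x ≤ (M1 + 1) * (δ / (2 * (M1 + 1))) := by gcongr; linarith
      _ = δ / 2 := by field_simp
  set R := grd b l x with hR
  have hρ : c0 ≤ ‖R‖ ^ 2 := by rw [hR, norm_grd_sq]; exact hcol x hx i2.le
  have hρ0 : 0 < ‖R‖ ^ 2 := hc0.trans_le hρ
  set d : E := -((‖R‖ ^ 2)⁻¹ • R) with hd
  have hdl : fderiv ℝ l x d = -1 := by
    rw [hd, map_neg, map_smul, ← inner_grd b, ← hR, real_inner_self_eq_norm_sq, smul_eq_mul,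
      inv_mul_cancel₀ hρ0.ne']
  have hdu : fderiv ℝ u x d = -kap b l u x := by
    rw [hd, map_neg, map_smul, smul_eq_mul]; rfl
  have hdn : ‖d‖ ^ 2 ≤ c0⁻¹ := by
    rw [hd, norm_neg, norm_smul, mul_pow, norm_inv, Real.norm_of_nonneg hρ0.le, inv_pow, sq (‖R‖ ^ 2),
      mul_inv, mul_assoc, inv_mul_cancel₀ hρ0.ne', mul_one]
    gcongr
  set s := (1 - δ) * l x with hs
  have hs0 : 0 < s := mul_pos (by linarith) hx
  have hsl : s ≤ l x := mul_le_of_le_one_left hx.le (by linarith)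
  have path : ∀ σ, 0 ≤ σ → σ ≤ s → |l (x + σ • d) - l x + σ| ≤ δ / 2 * l x := by
    intro σ h0 h2
    have h := taylor2 (u := l) (x := x) (y := x + σ • d) (M := M) (fun z _ => hl.sm z) (fun z _ => hM z)
    rw [add_sub_cancel_left, map_smul, hdl, norm_smul, mul_pow, Real.norm_of_nonneg h0, smul_eq_mul] at h
    have h3 : σ ^ 2 ≤ l x * l x := by rw [sq]; have := h2.trans hsl; gcongr
    rw [show l (x + σ • d) - l x + σ = l (x + σ • d) - l x - σ * -1 by ring]
    calc _ ≤ _ := h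
      _ ≤ M * ((l x * l x) * c0⁻¹) := by gcongr
      _ = M1 * l x * l x := by rw [hM1]; ring
      _ ≤ _ := by gcongr
  have pos : ∀ σ, 0 ≤ σ → σ ≤ s → δ / 2 * l x ≤ l (x + σ • d) ∧ l (x + σ • d) < a := by
    intro σ h0 h2
    have := abs_le.1 (path σ h0 h2)
    have h3 : δ / 2 * l x ≤ l x := by nlinarith
    constructor
    · have : s = l x - δ * l x := by rw [hs]; ring
      linarith
    · linarith
  have seg : ∀ z ∈ segment ℝ x (x + s • d), 𝒞 u z ∧ ‖hess u z‖ ≤ C4 * (δ / 2 * l x) ^ (-1 / 4 : ℝ) := by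
    intro z hz
    rw [segment_eq_image'] at hz
    obtain ⟨t, ht, rfl⟩ := hz
    simp only [add_sub_cancel_left, smul_smul]
    obtain ⟨p1, p2⟩ := pos (t * s) (mul_nonneg ht.1 hs0.le) (mul_le_of_le_one_left hs0.le ht.2)
    have q : 0 < δ / 2 * l x := by positivity
    obtain ⟨r1, -, r2, -⟩ := H _ (q.trans_le p1) p2
    refine ⟨r1.1, r2.trans ?_⟩
    gcongr 1
    exact Real.rpow_le_rpow_of_nonpos q p1 (by norm_num)
  have T := taylor2 (fun z hz => (seg z hz).1) fun z hz => (seg z hz).2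
  rw [add_sub_cancel_left, map_smul, hdu, norm_smul, mul_pow, Real.norm_of_nonneg hs0.le, smul_eq_mul] at T
  have T1 : C4 * (δ / 2 * l x) ^ (-1 / 4 : ℝ) * (s ^ 2 * ‖d‖ ^ 2) ≤ c / 4 * l x := by
    have h3 : l x ^ (3 / 4 : ℝ) ≤ c / 4 / C5 := (H x hx (by linarith)).2.2.2.2
    calc _ ≤ C4 * (δ / 2 * l x) ^ (-1 / 4 : ℝ) * (l x ^ 2 * c0⁻¹) := by gcongr
      _ = C5 * (l x ^ (-1 / 4 : ℝ) * l x) * l x := by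
        rw [Real.mul_rpow (by positivity) hx.le, hC5]; ring
      _ = C5 * l x ^ (3 / 4 : ℝ) * l x := by
        conv_lhs => rw [show l x ^ (-1 / 4 : ℝ) * l x = l x ^ (-1 / 4 : ℝ) * l x ^ (1 : ℝ) by
          rw [Real.rpow_one], ← Real.rpow_add hx]
        norm_num
      _ ≤ C5 * (c / 4 / C5) * l x := by gcongr
      _ = _ := by field_simp
  have hy := pos s hs0.le le_rfl
  have hy0 : 0 < l (x + s • d) := lt_of_lt_of_le (by positivity) hy.1
  have u1 : u (x + s • d) ≤ c / 2 * l x := by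
    have h4 := (H _ hy0 hy.2).2.1
    rw [Real.rpow_one] at h4
    have h5 := abs_le.1 (path s hs0.le le_rfl)
    have h6 : l (x + s • d) ≤ 2 * δ * l x := by
      have : s = l x - δ * l x := by rw [hs]; ring
      have : 0 < δ * l x := by positivity
      linarith
    calc _ ≤ _ := le_abs_self _
      _ ≤ C * l (x + s • d) := h4
      _ ≤ C * (2 * δ * l x) := by gcongr
      _ = 2 * C * δ * l x := by ring
      _ ≤ _ := by gcongr
  have u2 := (H x hx (by linarith)).2.2.2.1
  have T2 := abs_le.1 (T.trans T1)
  by_contra hcon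
  push Not at hcon
  have : s * kap b l u x < s * (c / 4) := by gcongr
  have : s * (c / 4) ≤ l x * (c / 4) := by gcongr
  linarith [T2.1, T2.2]

end NormalDeriv

section Algebra
variable {E : Type*} [NormedAddCommGroup E] [InnerProductSpace ℝ E]
  {ι : Type*} [Fintype ι] (b : OrthonormalBasis ι ℝ E) {J : E ≃ₗᵢ[ℝ] E}

def tanC (J : E ≃ₗᵢ[ℝ] E) (R v : E) : E :=
  ‖R‖ ^ 2 • v - inner ℝ R v • R - inner ℝ (J R) v • J R

lemma inner_J_right (hJ : ∀ x, J (J x) = -x) (v w : E) : inner ℝ v (J w) = - inner ℝ (J v) w := by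
  rw [← J.inner_map_map v (J w), hJ, inner_neg_right]

lemma inner_J_self (hJ : ∀ x, J (J x) = -x) (v : E) : inner ℝ v (J v) = 0 := by
  have := inner_J_right hJ v v
  rw [real_inner_comm v (J v)] at this
  linarith

lemma inner_tanC (hJ : ∀ x, J (J x) = -x) (R v : E) : inner ℝ R (tanC J R v) = 0 := by
  simp only [tanC, inner_sub_right, inner_smul_right, inner_J_self hJ, real_inner_self_eq_norm_sq]
  ring

lemma J_tanC (hJ : ∀ x, J (J x) = -x) (R v : E) :
    J (tanC J R v) = ‖R‖ ^ 2 • J v - inner ℝ R v • J R + inner ℝ (J R) v • R := by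
  simp only [tanC, map_sub, map_smul, hJ, smul_neg, sub_neg_eq_add]

lemma inner_J_tanC (hJ : ∀ x, J (J x) = -x) (R v : E) : inner ℝ R (J (tanC J R v)) = 0 := by
  simp only [J_tanC hJ, inner_sub_right, inner_add_right, inner_smul_right, inner_J_self hJ,
    real_inner_self_eq_norm_sq, inner_J_right hJ]
  ring

lemma expand_tanC (hJ : ∀ x, J (J x) = -x) (A : E →L[ℝ] E →L[ℝ] ℝ) (hA : ∀ v w, A v w = A w v)
    (p1 p2 : E →L[ℝ] ℝ) (q : ℝ) (R V : E) :
    ‖R‖ ^ 2 * (‖R‖ ^ 2 * (q + 2 * p1 V + 2 * p2 (J V) + A V V + A (J V) (J V))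
      - 2 * inner ℝ R V * (p1 R + p2 (J R) + A R V + A (J R) (J V))
      + 2 * inner ℝ (J R) V * (p2 R - p1 (J R) + A R (J V) - A (J R) V)) =
    ‖R‖ ^ 2 * (‖R‖ ^ 2 * q + 2 * p1 (tanC J R V) + 2 * p2 (J (tanC J R V)))
      + (A (tanC J R V) (tanC J R V) + A (J (tanC J R V)) (J (tanC J R V)))
      - (inner ℝ R V ^ 2 + inner ℝ (J R) V ^ 2) * (A R R + A (J R) (J R)) := by
  rw [J_tanC hJ]
  simp only [tanC, map_sub, map_add, map_smul, _root_.sub_apply,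
    _root_.add_apply, _root_.smul_apply, smul_eq_mul]
  rw [hA V R, hA V (J R), hA (J V) (J R), hA (J V) R, hA (J R) R]
  ring

include b in
lemma trace_tanC_aux (hJ : ∀ x, J (J x) = -x) (A : E →L[ℝ] E →L[ℝ] ℝ) (R : E) :
    ∑ i, A (tanC J R (b i)) (tanC J R (b i)) =
      ‖R‖ ^ 2 * (‖R‖ ^ 2 * ∑ i, A (b i) (b i) - A R R - A (J R) (J R)) := by
  have s1 : ∀ v : E, ∀ L : E →L[ℝ] ℝ, ∑ i, inner ℝ v (b i) * L (b i) = L v := by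
    intro v L
    conv_rhs => rw [← sum_inner_smul b v]
    simp [map_sum, real_inner_comm]
  have s2 : ∀ v w : E, ∑ i, inner ℝ v (b i) * inner ℝ w (b i) = inner ℝ w v := fun v w =>
    s1 v (innerSL ℝ w)
  have e : ∀ i, A (tanC J R (b i)) (tanC J R (b i)) =
      ‖R‖ ^ 2 * ‖R‖ ^ 2 * A (b i) (b i)
      - ‖R‖ ^ 2 * (inner ℝ R (b i) * A R (b i)) - ‖R‖ ^ 2 * (inner ℝ R (b i) * A.flip R (b i))
      - ‖R‖ ^ 2 * (inner ℝ (J R) (b i) * A (J R) (b i))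
      - ‖R‖ ^ 2 * (inner ℝ (J R) (b i) * A.flip (J R) (b i))
      + A R R * (inner ℝ R (b i) * inner ℝ R (b i))
      + A (J R) (J R) * (inner ℝ (J R) (b i) * inner ℝ (J R) (b i))
      + (A R (J R) + A (J R) R) * (inner ℝ (J R) (b i) * inner ℝ R (b i)) := by
    intro i
    simp only [tanC, map_sub, map_smul, _root_.sub_apply,
      _root_.smul_apply, smul_eq_mul, ContinuousLinearMap.flip_apply]
    ring
  rw [Finset.sum_congr rfl fun i _ => e i]
  simp only [Finset.sum_add_distrib, Finset.sum_sub_distrib, ← Finset.mul_sum, s1, s2,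
    inner_J_self hJ, real_inner_self_eq_norm_sq, LinearIsometryEquiv.norm_map]
  simp only [ContinuousLinearMap.flip_apply]
  ring

include b in
lemma trace_tanC (hJ : ∀ x, J (J x) = -x) (A : E →L[ℝ] E →L[ℝ] ℝ) (hA : ∑ i, A (b i) (b i) = 0)
    (R : E) :
    ∑ i, (A (tanC J R (b i)) (tanC J R (b i)) + A (J (tanC J R (b i))) (J (tanC J R (b i)))) =
      -(2 * ‖R‖ ^ 2 * (A R R + A (J R) (J R))) := by
  set A' : E →L[ℝ] E →L[ℝ] ℝ := (A.bilinearComp (J : E →L[ℝ] E) (J : E →L[ℝ] E)) with hA'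
  have e : ∀ v w, A' v w = A (J v) (J w) := fun v w => rfl
  have h1 := trace_tanC_aux b hJ A R
  have h2 := trace_tanC_aux b hJ A' R
  simp only [e] at h2
  rw [sum_bilin_isometry, hA] at h2
  rw [Finset.sum_add_distrib, h1, h2, hA, hJ]
  simp only [map_neg, _root_.neg_apply]
  ring
end Algebra

section Pointwise
variable {E : Type*} [NormedAddCommGroup E] [InnerProductSpace ℝ E]
  {ι : Type*} [Fintype ι] {b : OrthonormalBasis ι ℝ E} {J : E ≃ₗᵢ[ℝ] E} {l : E → ℝ}

def opF (g p : E → ℝ) (V : E → E) (x : E) : ℝ := p x + fderiv ℝ g x (V x)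

def opM (J : E ≃ₗᵢ[ℝ] E) (g p q : E → ℝ) (V : E → E) (x r : E) : ℝ :=
  fderiv ℝ p x r + fderiv ℝ q x (J r) + hess g x r (V x) + hess g x (J r) (J (V x))

def opN (J : E ≃ₗᵢ[ℝ] E) (g p q : E → ℝ) (V : E → E) (x r : E) : ℝ :=
  fderiv ℝ q x r - fderiv ℝ p x (J r) + hess g x r (J (V x)) - hess g x (J r) (V x)

def opU (J : E ≃ₗᵢ[ℝ] E) (g p q s : E → ℝ) (V : E → E) (x : E) : ℝ :=
  s x + 2 * fderiv ℝ p x (V x) + 2 * fderiv ℝ q x (J (V x)) + hess g x (V x) (V x)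
    + hess g x (J (V x)) (J (V x))

lemma opM_add (g p q : E → ℝ) (V : E → E) (x r s : E) (c : ℝ) :
    opM J g p q V x (c • r + s) = c * opM J g p q V x r + opM J g p q V x s := by
  simp only [opM, map_add, map_smul, _root_.add_apply,
    _root_.smul_apply, smul_eq_mul]
  ring

lemma opN_add (g p q : E → ℝ) (V : E → E) (x r s : E) (c : ℝ) :
    opN J g p q V x (c • r + s) = c * opN J g p q V x r + opN J g p q V x s := by
  simp only [opN, map_add, map_smul, _root_.add_apply,
    _root_.smul_apply, smul_eq_mul]
  ring

lemma sm_J {V : E → E} (hV : ∀ x, 𝒞 V x) (x : E) : 𝒞 (fun x => J (V x)) x :=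
  (J : E →L[ℝ] E).contDiff.contDiffAt.comp x (hV x)

variable [FiniteDimensional ℝ E] [MeasurableSpace E] [BorelSpace E] {μ : Measure E}
  [μ.IsAddHaarMeasure] {k : E → ℝ} {g p q s : E → ℝ}

omit [FiniteDimensional ℝ E] [MeasurableSpace E] [BorelSpace E] in
lemma sm_tanC (hl : Dom b J l) {V : E → E} (hV : ∀ x, 𝒞 V x) (x : E) :
    𝒞 (fun x => tanC J (grd b l x) (V x)) x := by
  have hR := sm_grd b (hl.sm x)
  have hJR : 𝒞 (fun x => J (grd b l x)) x := (J : E →L[ℝ] E).contDiff.contDiffAt.comp x hR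
  unfold tanC
  exact (((hR.norm_sq ℝ).smul (hV x)).sub ((hR.inner ℝ (hV x)).smul hR)).sub
    ((hJR.inner ℝ (hV x)).smul hJR)

omit [FiniteDimensional ℝ E] [MeasurableSpace E] [BorelSpace E] in
lemma tanC_tangent (hl : Dom b J l) (v x : E) : pd (tanC J (grd b l x) v) l x = 0 := by
  rw [pd, ← inner_grd b, inner_tanC hl.J_sq]

omit [FiniteDimensional ℝ E] [MeasurableSpace E] [BorelSpace E] in
lemma J_tanC_tangent (hl : Dom b J l) (v x : E) : pd (J (tanC J (grd b l x) v)) l x = 0 := by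
  rw [pd, ← inner_grd b, inner_J_tanC hl.J_sq]

set_option maxHeartbeats 2000000 in
theorem pointwise [Nonempty ι] (hk : MVKernel b μ k) (hl : Dom b J l) (hg : HN b l g)
    (hg1 : Dk l 1 g) (hp : HN b l p) (hp1 : Dk l 1 p) (hq : HN b l q) (hq1 : Dk l 1 q)
    (hs1 : Dk l 1 s) {c : ℝ} (hc : 0 < c) (hge : ∀ᶠ x in nb l, c * l x ≤ g x)
    {V : E → E} (hV : ∀ x, 𝒞 V x) {δ : ℝ} (hδ : 0 < δ) :
    ∀ᶠ x in nb l, ‖grd b g x‖ ^ 2 * opU J g p q s V x ≤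
      2 * (opF g p V x * opM J g p q V x (grd b g x)
        + opF g q (fun x => J (V x)) x * opN J g p q V x (grd b g x))
      + δ * ‖grd b g x‖ ^ 2 := by
  obtain ⟨c', hc', hkap⟩ := kap_ge hk hl hg hg1 hc hge
  have hJV := sm_J (J := J) hV
  set R : E → E := fun x => grd b l x with hR
  set N : E → E := fun x => grd b g x with hN
  set κ : E → ℝ := kap b l g with hκ
  set X : E → E := fun x => tanC J (R x) (V x) with hX
  set e : E → E := fun x => N x - κ x • R x with he
  have sR : ∀ x, 𝒞 R x := fun x => sm_grd b (hl.sm x)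
  have dR : Dk l 0 R := Dk.smooth hl sR
  have dJR : Dk l 0 (fun x => J (R x)) := Dk.smooth hl (sm_J sR)
  have dV : Dk l 0 V := Dk.smooth hl hV
  have dJV : Dk l 0 (fun x => J (V x)) := Dk.smooth hl hJV
  have sX : ∀ x, 𝒞 X x := sm_tanC hl hV
  have dρ : Dk l 0 (fun x => ‖R x‖ ^ 2) := Dk.smooth hl fun x => (sR x).norm_sq ℝ
  have dα : Dk l 0 (fun x => inner ℝ (R x) (V x)) := dR.inner' dV (by norm_num)
  have dβ : Dk l 0 (fun x => inner ℝ (J (R x)) (V x)) := dJR.inner' dV (by norm_num)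
  have dκ : Dk l 0 κ := kap_bd hk hl hg hg1
  have dB := hess_bd hk hl hg hg1
  have dp := grad_bd hk hl hp hp1
  have dq := grad_bd hk hl hq hq1
  have dn := normal_bd hk hl hg hg1
  have dg := grad_bd hk hl hg hg1
  have de : Dk l (3 / 4) e := by
    refine (Dk.sum (s := Finset.univ) (f := fun i x => ((fderiv ℝ g x - κ x • fderiv ℝ l x) (b i)) • b i)
      fun i _ => (dn.clm_const (b i)).smul (Dk.const (b i)) (by norm_num)).congr'
      (Eventually.of_forall fun x => ?_)
    simp only [he, hN, hR, grd, pd, Finset.smul_sum, ← Finset.sum_sub_distrib, smul_smul,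
      _root_.sub_apply, _root_.smul_apply, smul_eq_mul, sub_smul]
  have dN : Dk l 0 N := by
    refine (Dk.sum (s := Finset.univ) (f := fun i x => (fderiv ℝ g x (b i)) • b i)
      fun i _ => (dg.clm_const (b i)).smul (Dk.const (b i)) (by norm_num)).congr'
      (Eventually.of_forall fun x => rfl)
  have dJe : Dk l (3 / 4) (fun x => J (e x)) := by
    refine de.of_norm_le (Eventually.of_forall fun x => ?_)
    rw [LinearIsometryEquiv.norm_map]
  set n : E → ℝ := fun x => inner ℝ (e x) (N x + κ x • R x) with hn
  have dnn : Dk l (3 / 4) n := de.inner' (dN.add (dκ.smul dR (by norm_num))) (by norm_num)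
  set f1 : E → ℝ := fun x => p x + (fderiv ℝ g x - κ x • fderiv ℝ l x) (V x) with hf1
  set f2 : E → ℝ := fun x => q x + (fderiv ℝ g x - κ x • fderiv ℝ l x) (J (V x)) with hf2
  have df1 : Dk l (3 / 4) f1 := (hp1.mono (by norm_num)).add (dn.clm dV (by norm_num))
  have df2 : Dk l (3 / 4) f2 := (hq1.mono (by norm_num)).add (dn.clm dJV (by norm_num))
  have dM : ∀ {r : ℝ} (v : E → E), Dk l r v → Dk l r (fun x => J (v x)) →
      Dk l (r - 1 / 4) (fun x => opM J g p q V x (v x)) ∧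
      Dk l (r - 1 / 4) (fun x => opN J g p q V x (v x)) := by
    intro r v hv hJv
    have a1 : Dk l (r - 1 / 4) (fun x => fderiv ℝ p x (v x)) :=
      (dp.clm hv (r := r) (by ring)).mono (by linarith)
    have a2 : Dk l (r - 1 / 4) (fun x => fderiv ℝ p x (J (v x))) :=
      (dp.clm hJv (r := r) (by ring)).mono (by linarith)
    have a3 : Dk l (r - 1 / 4) (fun x => fderiv ℝ q x (v x)) :=
      (dq.clm hv (r := r) (by ring)).mono (by linarith)
    have a4 : Dk l (r - 1 / 4) (fun x => fderiv ℝ q x (J (v x))) :=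
      (dq.clm hJv (r := r) (by ring)).mono (by linarith)
    have b1 := dB.clm hv (r := r - 1 / 4) (by ring)
    have b2 := dB.clm hJv (r := r - 1 / 4) (by ring)
    exact ⟨((a1.add a4).add (b1.clm dV (by ring))).add (b2.clm dJV (by ring)),
      ((a3.sub a2).add (b1.clm dJV (by ring))).sub (b2.clm dV (by ring))⟩
  obtain ⟨dMN, dNN⟩ := dM N dN (dN.of_norm_le (Eventually.of_forall fun x => by
    rw [LinearIsometryEquiv.norm_map]))
  obtain ⟨dMe, dNe⟩ := dM e de dJe
  have dU : Dk l (-1 / 4) (opU J g p q s V) := by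
    have m : ∀ {f : E → ℝ}, Dk l 0 f → Dk l (-1 / 4) f := fun h => h.mono (by norm_num)
    exact (((((hs1.mono (by norm_num)).add (m ((dp.clm dV (by norm_num)).const_mul 2))).add
      (m ((dq.clm dJV (by norm_num)).const_mul 2))).add
      ((dB.clm dV (r := -1 / 4) (by norm_num)).clm dV (by norm_num))).add
      ((dB.clm dJV (r := -1 / 4) (by norm_num)).clm dJV (by norm_num)))
  set ℓ : (E → E) → E → ℝ := fun T x => (hess g x (T x) (T x) - κ x * hess l x (T x) (T x))
    + (hess g x (J (T x)) (J (T x)) - κ x * hess l x (J (T x)) (J (T x))) with hℓ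
  have dℓ : ∀ W : E → E, (∀ x, 𝒞 W x) → Dk l (3 / 4) (ℓ fun x => tanC J (R x) (W x)) := by
    intro W hW
    have hS := sm_tanC hl hW
    have hSt : ∀ x, pd (tanC J (R x) (W x)) l x = 0 := fun x => tanC_tangent hl (W x) x
    have hJt : ∀ x, pd (J (tanC J (R x) (W x))) l x = 0 := fun x => J_tanC_tangent hl (W x) x
    exact (levi_bd hk hl hg hg1 hS hSt hS hSt).add
      (levi_bd hk hl hg hg1 (sm_J hS) hJt (sm_J hS) hJt)
  set Err : E → ℝ := fun x => n x * opU J g p q s V x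
    - 2 * (f1 x * opM J g p q V x (N x)) - 2 * (f2 x * opN J g p q V x (N x))
    - 2 * (κ x * inner ℝ (R x) (V x) * opM J g p q V x (e x))
    + 2 * (κ x * inner ℝ (J (R x)) (V x) * opN J g p q V x (e x))
    + κ x * κ x * (‖R x‖ ^ 2 * s x + 2 * fderiv ℝ p x (X x) + 2 * fderiv ℝ q x (J (X x)))
    + κ x * κ x * ((‖R x‖ ^ 2)⁻¹ * (ℓ X x +
      (inner ℝ (R x) (V x) * inner ℝ (R x) (V x) + inner ℝ (J (R x)) (V x) * inner ℝ (J (R x)) (V x))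
        * ((‖R x‖ ^ 2)⁻¹ * ((1 / 2) * ∑ i, ℓ (fun x => tanC J (R x) (b i)) x)))) with hErr
  have dinv : Dk l 0 (fun x => (‖R x‖ ^ 2)⁻¹) := inv_norm_grd hl
  have dErr : Dk l (1 / 2) Err := by
    have t1 : Dk l (1 / 2) (fun x => n x * opU J g p q s V x) := dnn.mul dU (by norm_num)
    have t2 : Dk l (1 / 2) (fun x => f1 x * opM J g p q V x (N x)) := df1.mul dMN (by norm_num)
    have t3 : Dk l (1 / 2) (fun x => f2 x * opN J g p q V x (N x)) := df2.mul dNN (by norm_num)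
    have t4 : Dk l (1 / 2) (fun x => κ x * inner ℝ (R x) (V x) * opM J g p q V x (e x)) :=
      (dκ.mul dα (r := 0) (by norm_num)).mul dMe (by norm_num)
    have t5 : Dk l (1 / 2) (fun x => κ x * inner ℝ (J (R x)) (V x) * opN J g p q V x (e x)) :=
      (dκ.mul dβ (r := 0) (by norm_num)).mul dNe (by norm_num)
    have dκκ := dκ.mul dκ (r := 0) (by norm_num)
    have t6 : Dk l (3 / 4) (fun x => ‖R x‖ ^ 2 * s x + 2 * fderiv ℝ p x (X x)
        + 2 * fderiv ℝ q x (J (X x))) :=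
      (((dρ.mul hs1 (r := 1) (by norm_num)).mono (by norm_num)).add
        ((tangent_bd hk hl hp hp1 sX fun x => tanC_tangent hl (V x) x).const_mul 2)).add
        ((tangent_bd hk hl hq hq1 (sm_J sX) fun x => J_tanC_tangent hl (V x) x).const_mul 2)
    have t7 : Dk l (3 / 4) (fun x => ∑ i, ℓ (fun x => tanC J (R x) (b i)) x) :=
      Dk.sum fun i _ => dℓ (fun _ => b i) fun x => contDiffAt_const
    have t8 := dinv.mul ((dℓ V hV).add (((dα.mul dα (r := 0) (by norm_num)).add
      (dβ.mul dβ (by norm_num))).mul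
      (dinv.mul (t7.const_mul (1 / 2)) (r := 3 / 4) (by norm_num)) (by norm_num))) (r := 3 / 4)
      (by norm_num)
    exact (((((t1.sub (t2.const_mul 2)).sub (t3.const_mul 2)).sub (t4.const_mul 2)).add
      (t5.const_mul 2)).add (dκκ.mul (t6.mono (q := 1 / 2) (by norm_num)) (by norm_num))).add
      (dκκ.mul (t8.mono (q := 1 / 2) (by norm_num)) (by norm_num))
  obtain ⟨a0, ha0, c0, hc0, hcol⟩ := hl.collar
  filter_upwards [dErr.ev_le (by norm_num) (ε := δ * (c' ^ 2 * c0 / 4)) (by positivity),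
    hkap, nb_pos l, nb_lt l ha0, hg, dnn.ev_le (by norm_num) (ε := c' ^ 2 * c0 / 2) (by positivity)]
    with x hx1 hx2 hx3 hx4 hx5 hx6
  have hρ : c0 ≤ ‖R x‖ ^ 2 := by
    simp only [hR]; rw [norm_grd_sq]; exact hcol x hx3 hx4.le
  have hρ0 := hc0.trans_le hρ
  have hκ0 : 0 < κ x := hc'.trans_le hx2
  have eN : N x = κ x • R x + e x := by simp [he]
  have nN : ‖N x‖ ^ 2 = κ x ^ 2 * ‖R x‖ ^ 2 + n x := by
    simp only [hn, he, inner_sub_left, inner_add_right, inner_smul_left, inner_smul_right,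
      real_inner_self_eq_norm_sq, real_inner_comm (R x) (N x), RCLike.conj_to_real]
    ring
  have nlow : c' ^ 2 * c0 / 2 ≤ ‖N x‖ ^ 2 := by
    have : c' ^ 2 * c0 ≤ κ x ^ 2 * ‖R x‖ ^ 2 := by gcongr
    have := (abs_le.1 hx6).1
    linarith
  have F1e : opF g p V x = f1 x + κ x * inner ℝ (R x) (V x) := by
    simp only [opF, hf1, hR, inner_grd, _root_.sub_apply,
      _root_.smul_apply, smul_eq_mul]
    ring
  have F2e : opF g q (fun x => J (V x)) x = f2 x - κ x * inner ℝ (J (R x)) (V x) := by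
    have := inner_J_right hl.J_sq (R x) (V x)
    simp only [hR, inner_grd] at this
    simp only [opF, hf2, _root_.sub_apply,
      _root_.smul_apply, smul_eq_mul, this, hR]
    ring
  have M1e : opM J g p q V x (N x) = κ x * opM J g p q V x (R x) + opM J g p q V x (e x) := by
    rw [← opM_add, ← eN]
  have N1e : opN J g p q V x (N x) = κ x * opN J g p q V x (R x) + opN J g p q V x (e x) := by
    rw [← opN_add, ← eN]
  have hsym := hess_symm hx5.1
  have A1 := expand_tanC hl.J_sq (hess g x) hsym (fderiv ℝ p x) (fderiv ℝ q x) (s x) (R x) (V x)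
  have A2 := trace_tanC b hl.J_sq (hess g x) (by rw [← Lap_hess b hx5.1]; exact hx5.2) (R x)
  have key : ∀ T : E → E, hess g x (T x) (T x) + hess g x (J (T x)) (J (T x)) ≤ ℓ T x := by
    intro T
    have := mul_nonpos_of_nonneg_of_nonpos hκ0.le (hl.levi x hx3 (T x))
    simp only [hℓ]; linarith
  have k1 := key X
  have k2 := Finset.sum_le_sum fun i (_ : i ∈ Finset.univ) => key fun x => tanC J (R x) (b i)
  have main : ‖N x‖ ^ 2 * opU J g p q s V x -
      2 * (opF g p V x * opM J g p q V x (N x)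
        + opF g q (fun x => J (V x)) x * opN J g p q V x (N x)) ≤ Err x := by
    rw [A2] at k2
    have hQ := A1
    change _ * (_ * opU J g p q s V x - 2 * inner ℝ (R x) (V x) * opM J g p q V x (R x)
      + 2 * inner ℝ (J (R x)) (V x) * opN J g p q V x (R x)) = _ at hQ
    rw [F1e, F2e, nN, M1e, N1e]
    simp only [hErr, M1e, N1e]
    set ρ := ‖R x‖ ^ 2
    set α : ℝ := inner ℝ (R x) (V x)
    set β : ℝ := inner ℝ (J (R x)) (V x)
    set LR := hess g x (R x) (R x) + hess g x (J (R x)) (J (R x))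
    set S := ∑ i, ℓ (fun x => tanC J (R x) (b i)) x
    set U := opU J g p q s V x
    set MR := opM J g p q V x (R x)
    set NR := opN J g p q V x (R x)
    set T := ρ * s x + 2 * fderiv ℝ p x (X x) + 2 * fderiv ℝ q x (J (X x))
    set Q := ρ * U - 2 * α * MR + 2 * β * NR with hQd
    have h1 : -LR ≤ ρ⁻¹ * (1 / 2 * S) := by
      rw [← div_eq_inv_mul, le_div_iff₀ hρ0]; linarith
    have h2 : Q ≤ T + ρ⁻¹ * (ℓ X x + (α * α + β * β) * (ρ⁻¹ * (1 / 2 * S))) := by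
      have h3 : ρ * Q ≤ ρ * T + (ℓ X x + (α * α + β * β) * (ρ⁻¹ * (1 / 2 * S))) := by
        have h4 := mul_le_mul_of_nonneg_left h1
            (add_nonneg (mul_self_nonneg α) (mul_self_nonneg β))
        have h5 : ρ * Q = ρ * T + (hess g x (X x) (X x) + hess g x (J (X x)) (J (X x)))
          - (α ^ 2 + β ^ 2) * LR := hQ
        rw [h5]; linarith
      refine le_of_mul_le_mul_left (h3.trans_eq ?_) hρ0
      rw [mul_add ρ T, mul_inv_cancel_left₀ hρ0.ne']
    have h6 := mul_le_mul_of_nonneg_left h2 (mul_self_nonneg (κ x))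
    have h7 : κ x * κ x * Q = κ x * κ x * (ρ * U - 2 * α * MR + 2 * β * NR) := rfl
    linarith
  have : Err x ≤ δ * ‖N x‖ ^ 2 := by
    calc Err x ≤ δ * (c' ^ 2 * c0 / 4) := (le_abs_self _).trans hx1
      _ ≤ δ * ‖N x‖ ^ 2 := by gcongr; nlinarith [sq_nonneg c']
  linarith
end Pointwise

section JointCalculus
variable {E : Type*} [NormedAddCommGroup E] [InnerProductSpace ℝ E]
  {ι : Type*} [Fintype ι] {b : OrthonormalBasis ι ℝ E} {J : E ≃ₗᵢ[ℝ] E}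

lemma pd_slice {F : Type*} [NormedAddCommGroup F] [NormedSpace ℝ F] {u : E × E → F} {p : E × E}
    (h : DifferentiableAt ℝ u p) (v : E) :
    pd v (fun x => u (p.1, x)) p.2 = pd (0, v) u p := by
  have h1 : HasFDerivAt (fun x : E => (p.1, x)) (ContinuousLinearMap.inr ℝ E E) p.2 :=
    hasFDerivAt_prodMk_right p.1 p.2
  have h2 : HasFDerivAt u (fderiv ℝ u p) (p.1, p.2) := h.hasFDerivAt
  have := h2.comp p.2 h1
  rw [pd, pd, show (fun x => u (p.1, x)) = u ∘ fun x : E => (p.1, x) from rfl, this.fderiv]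
  rfl

lemma pd_slice_left {F : Type*} [NormedAddCommGroup F] [NormedSpace ℝ F] {u : E × E → F}
    {p : E × E} (h : DifferentiableAt ℝ u p) (v : E) :
    pd v (fun z => u (z, p.2)) p.1 = pd (v, 0) u p := by
  have h1 : HasFDerivAt (fun z : E => (z, p.2)) (ContinuousLinearMap.inl ℝ E E) p.1 :=
    hasFDerivAt_prodMk_left p.1 p.2
  have h2 : HasFDerivAt u (fderiv ℝ u p) (p.1, p.2) := h.hasFDerivAt
  have := h2.comp p.1 h1
  rw [pd, pd, show (fun z => u (z, p.2)) = u ∘ fun z : E => (z, p.2) from rfl, this.fderiv]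
  rfl

lemma pd_diag {F : Type*} [NormedAddCommGroup F] [NormedSpace ℝ F] {u : E × E → F} {z : E}
    (h : DifferentiableAt ℝ u (z, z)) (v : E) :
    pd v (fun z => u (z, z)) z = pd (v, v) u (z, z) := by
  have h1 : HasFDerivAt (fun x : E => (x, x))
      ((ContinuousLinearMap.id ℝ E).prod (ContinuousLinearMap.id ℝ E)) z :=
    (hasFDerivAt_id z).prodMk (hasFDerivAt_id z)
  have := HasFDerivAt.comp (g := u) (f := fun x : E => (x, x)) z h.hasFDerivAt h1
  rw [pd, pd, show (fun z => u (z, z)) = u ∘ fun z : E => (z, z) from rfl, this.fderiv]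
  rfl

lemma sm_slice {u : E × E → ℝ} {p : E × E} (h : 𝒞 u p) : 𝒞 (fun x => u (p.1, x)) p.2 :=
  h.comp p.2 (contDiff_prodMk_right p.1).contDiffAt

lemma sm_diag {u : E × E → ℝ} {z : E} (h : 𝒞 u (z, z)) : 𝒞 (fun z => u (z, z)) z :=
  sm_map_comp (Φ := fun z : E => (z, z)) (contDiffAt_id.prodMk contDiffAt_id) h

omit [InnerProductSpace ℝ E] in
lemma ev_slice {P : E × E → Prop} {p : E × E} (h : ∀ᶠ q in 𝓝 p, P q) :
    ∀ᶠ x in 𝓝 p.2, P (p.1, x) :=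
  (Continuous.tendsto (by fun_prop : Continuous fun x : E => (p.1, x)) p.2).eventually h

omit [InnerProductSpace ℝ E] in
lemma ev_diag {P : E × E → Prop} {z : E} (h : ∀ᶠ q in 𝓝 (z, z), P q) :
    ∀ᶠ x in 𝓝 z, P (x, x) :=
  (Continuous.tendsto (by fun_prop : Continuous fun x : E => (x, x)) z).eventually h

lemma hess_slice {u : E × E → ℝ} {p : E × E} (h : 𝒞 u p) (v w : E) :
    hess (fun x => u (p.1, x)) p.2 v w = hess u p (0, v) (0, w) := by
  rw [← pd_pd (sm_slice h), ← pd_pd h]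
  have : pd w (fun x => u (p.1, x)) =ᶠ[𝓝 p.2] fun x => pd (0, w) u (p.1, x) :=
    (ev_slice (sm_ev h)).mono fun x hx => pd_slice (p := (p.1, x)) hx w
  rw [pd_congr this, pd_slice (sm_diff (sm_pd h _))]

variable (b) in
def Harm2 (O : Set (E × E)) (u : E × E → ℝ) : Prop :=
  ∀ p ∈ O, 𝒞 u p ∧ Lap b (fun x => u (p.1, x)) p.2 = 0

lemma Lap_slice {u : E × E → ℝ} {p : E × E} (h : 𝒞 u p) :
    Lap b (fun x => u (p.1, x)) p.2 = ∑ i, pd (0, b i) (pd (0, b i) u) p := by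
  rw [Lap_hess b (sm_slice h)]
  exact Finset.sum_congr rfl fun i _ => by rw [hess_slice h, pd_pd h]

lemma Harm2.pd {O : Set (E × E)} (hO : IsOpen O) {u : E × E → ℝ} (h : Harm2 b O u) (v : E × E) :
    Harm2 b O (pd v u) := by
  intro p hp
  have hs := (h p hp).1
  refine ⟨sm_pd hs v, ?_⟩
  rw [Lap_slice (sm_pd hs v)]
  have e : (fun q => ∑ i, Berndtsson.pd (0, b i) (Berndtsson.pd (0, b i) u) q) =ᶠ[𝓝 p]
      fun _ => (0 : ℝ) := by
    filter_upwards [hO.mem_nhds hp] with q hq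
    rw [← Lap_slice (h q hq).1]
    exact (h q hq).2
  have e1 := pd_congr e v
  rw [pd_const] at e1
  have e2 : Berndtsson.pd v (fun q => ∑ i, Berndtsson.pd (0, b i) (Berndtsson.pd (0, b i) u) q) p =
      ∑ i, Berndtsson.pd v (Berndtsson.pd (0, b i) (Berndtsson.pd (0, b i) u)) p := by
    unfold Berndtsson.pd
    have := fderiv_fun_sum (𝕜 := ℝ) (u := Finset.univ)
      (A := fun i => Berndtsson.pd (0, b i) (Berndtsson.pd (0, b i) u)) (x := p)
      fun i _ => sm_diff (sm_pd (sm_pd hs _) _)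
    change (fderiv ℝ (fun q => ∑ i, Berndtsson.pd (0, b i) (Berndtsson.pd (0, b i) u) q) p) v = _
    rw [this, _root_.sum_apply]
    rfl
  rw [e2] at e1
  rw [← Pi.zero_apply (M := fun _ : E × E => ℝ) p, ← e1]
  refine Finset.sum_congr rfl fun i _ => ?_
  rw [pd_comm (sm_pd hs _) v]
  refine pd_congr ?_ _
  have hev : ∀ᶠ q in 𝓝 p, 𝒞 u q := by
    filter_upwards [hO.mem_nhds hp] with q hq using (h q hq).1
  exact hev.mono fun q hq => pd_comm hq (0, b i) v

def yf (J : E ≃ₗᵢ[ℝ] E) (σ τ : ℝ) (w : E) (p : E × E) : E × E :=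
  (w, w + (σ • (p.2 - p.1) + τ • J (p.2 - p.1)))

lemma hasFDerivAt_yf (σ τ : ℝ) (w : E) (p : E × E) :
    HasFDerivAt (yf J σ τ w) ((0 : E × E →L[ℝ] E).prod
      (σ • (ContinuousLinearMap.snd ℝ E E - ContinuousLinearMap.fst ℝ E E)
      + τ • (J : E →L[ℝ] E).comp
        (ContinuousLinearMap.snd ℝ E E - ContinuousLinearMap.fst ℝ E E))) p := by
  refine (hasFDerivAt_const w p).prodMk (HasFDerivAt.const_add w ?_)
  exact ContinuousLinearMap.hasFDerivAt (σ • (ContinuousLinearMap.snd ℝ E E -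
    ContinuousLinearMap.fst ℝ E E) + τ • (J : E →L[ℝ] E).comp
    (ContinuousLinearMap.snd ℝ E E - ContinuousLinearMap.fst ℝ E E))

lemma pd_yf (σ τ : ℝ) (w : E) (p v : E × E) :
    pd v (yf J σ τ w) p = (0, σ • (v.2 - v.1) + τ • J (v.2 - v.1)) := by
  rw [pd, (hasFDerivAt_yf σ τ w p).fderiv]
  rfl

lemma sm_yf (σ τ : ℝ) (w : E) (p : E × E) : 𝒞 (yf J σ τ w) p := by
  have h1 : ContDiff ℝ ((⊤ : ℕ∞) : WithTop ℕ∞) (fun q : E × E => J (q.2 - q.1)) :=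
    (J : E →L[ℝ] E).contDiff.comp (contDiff_snd.sub contDiff_fst)
  exact (contDiff_const.prodMk (contDiff_const.add
    ((contDiff_const.smul (contDiff_snd.sub contDiff_fst)).add (contDiff_const.smul h1)))).contDiffAt

def op (J : E ≃ₗᵢ[ℝ] E) (β σ τ : ℝ) (w : E) (u : E × E → ℝ) (p : E × E) : ℝ :=
  β * u p + fderiv ℝ u p (yf J σ τ w p)

lemma sm_op {u : E × E → ℝ} {p : E × E} (h : 𝒞 u p) (β σ τ : ℝ) (w : E) :
    𝒞 (op J β σ τ w u) p :=
  (contDiffAt_const.mul h).add ((sm_fderiv h).clm_apply (sm_yf σ τ w p))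

lemma op_congr {u v : E × E → ℝ} {p : E × E} (h : u =ᶠ[𝓝 p] v) (β σ τ : ℝ) (w : E) :
    op J β σ τ w u p = op J β σ τ w v p := by
  rw [op, op, h.fderiv_eq, h.eq_of_nhds]

lemma op_sub {u v : E × E → ℝ} {p : E × E} (hu : DifferentiableAt ℝ u p)
    (hv : DifferentiableAt ℝ v p) (β σ τ : ℝ) (w : E) :
    op J β σ τ w (fun q => u q - v q) p = op J β σ τ w u p - op J β σ τ w v p := by
  rw [op, op, op, fderiv_fun_sub hu hv, _root_.sub_apply]
  ring

lemma op_op {u : E × E → ℝ} {p : E × E} (h : 𝒞 u p) (β σ τ : ℝ) (w : E) :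
    op J β σ τ w (op J β σ τ w u) p = β * (β * u p + fderiv ℝ u p (yf J σ τ w p))
      + (β * fderiv ℝ u p (yf J σ τ w p) + (hess u p (yf J σ τ w p) (yf J σ τ w p)
      + fderiv ℝ u p (pd (yf J σ τ w p) (yf J σ τ w) p))) := by
  have hf := sm_diff (sm_fderiv h)
  have hy := sm_diff (sm_yf (J := J) σ τ w p)
  rw [op]
  congr 1
  change pd _ (fun q => β * u q + fderiv ℝ u q (yf J σ τ w q)) p = _
  rw [pd_add (u := fun q => β * u q) ((sm_diff h).const_mul β) (hf.clm_apply hy),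
    pd_const_mul _ _ (sm_diff h), pd_clm_apply hf hy]
  rfl

lemma Harm2.op (hJ : ∀ x, J (J x) = -x) {O : Set (E × E)} (hO : IsOpen O) {u : E × E → ℝ}
    (h : Harm2 b O u) (β σ τ : ℝ) (w : E) : Harm2 b O (op J β σ τ w u) := by
  intro p hp
  have hs := (h p hp).1
  refine ⟨sm_op hs β σ τ w, ?_⟩
  set a : ι → E → ℝ := fun i x => inner ℝ (b i) (w + (σ • (x - p.1) + τ • J (x - p.1))) with ha
  have sa : ∀ i x, 𝒞 (a i) x := fun i x => contDiffAt_const.inner ℝ (contDiffAt_const.add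
    ((contDiffAt_const.smul (contDiffAt_id.sub contDiffAt_const)).add (contDiffAt_const.smul
    (sm_J (V := fun x => x - p.1) (fun x => contDiffAt_id.sub contDiffAt_const) x))))
  have da : ∀ i j x, Berndtsson.pd (b j) (a i) x = inner ℝ (b i) (σ • b j + τ • J (b j)) := by
    intro i j x
    have h1 : HasFDerivAt (a i) ((innerSL ℝ (b i)).comp (σ • ContinuousLinearMap.id ℝ E
        + τ • (J : E →L[ℝ] E))) x := by
      have e : a i = fun x => ((innerSL ℝ (b i)).comp (σ • ContinuousLinearMap.id ℝ E
        + τ • (J : E →L[ℝ] E))) x + inner ℝ (b i) (w - (σ • p.1 + τ • J p.1)) := by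
        funext x
        simp only [ha, map_sub, smul_sub, ContinuousLinearMap.comp_apply, innerSL_apply_apply,
          _root_.add_apply, _root_.smul_apply,
          ContinuousLinearMap.id_apply, ← inner_add_right]
        congr 1
        change _ = σ • x + τ • J x + _
        abel
      rw [e]
      exact (ContinuousLinearMap.hasFDerivAt _).add_const _
    rw [Berndtsson.pd, h1.fderiv]
    rfl
  have e : (fun x => Berndtsson.op J β σ τ w u (p.1, x)) = fun x =>
      (β * u (p.1, x) + Berndtsson.pd (w, 0) u (p.1, x))
      + ∑ i, a i x * Berndtsson.pd (0, b i) u (p.1, x) := by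
    funext x
    have e1 : yf J σ τ w (p.1, x) = (w, 0) + ∑ i, a i x • ((0 : E), b i) := by
      have h1 := sum_inner_smul b (w + (σ • (x - p.1) + τ • J (x - p.1)))
      have h2 : ∑ i, a i x • ((0 : E), b i) = (0, ∑ i, a i x • b i) := by
        rw [Prod.ext_iff, Prod.fst_sum, Prod.snd_sum]
        simp
      rw [h2, h1]
      simp [yf]
    rw [Berndtsson.op, e1, map_add, map_sum, add_assoc]
    simp only [map_smul, smul_eq_mul]
    rfl
  have hpd := fun v => h.pd hO v p hp
  have hpds := fun v => sm_slice (hpd v).1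
  rw [e, Lap_add b ((contDiffAt_const.mul (sm_slice hs)).add (hpds _))
    (ContDiffAt.sum fun i _ => (sa i _).mul (hpds _)),
    Lap_add b (contDiffAt_const.mul (sm_slice hs)) (hpds _), Lap_const_mul b (sm_slice hs),
    (h p hp).2, (hpd _).2, Lap_sum b _ fun i _ => (sa i _).mul (hpds _)]
  set A : E →L[ℝ] E →L[ℝ] ℝ := (hess u p).bilinearComp (ContinuousLinearMap.inr ℝ E E)
    (ContinuousLinearMap.inr ℝ E E) with hA
  have e2 : ∀ i, Lap b (fun x => a i x * Berndtsson.pd (0, b i) u (p.1, x)) p.2 =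
      2 * ∑ j, inner ℝ (b i) (σ • b j + τ • J (b j)) * A (b j) (b i) := by
    intro i
    have h0 : Lap b (a i) p.2 = 0 := by
      have : ∀ j, Berndtsson.pd (b j) (a i) = fun _ => inner ℝ (b i) (σ • b j + τ • J (b j)) :=
        fun j => funext fun x => da i j x
      simp only [Lap, this, pd_const]
      simp
    rw [Lap_mul b (sa i _) (hpds _), (hpd _).2, h0, mul_zero, mul_zero, zero_add, add_zero]
    congr 1
    refine Finset.sum_congr rfl fun j _ => ?_
    rw [da, pd_slice (sm_diff (hpd (0, b i)).1), pd_pd hs]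
    rfl
  rw [Finset.sum_congr rfl fun i _ => e2 i, ← Finset.mul_sum, Finset.sum_comm]
  have e3 : ∀ j, ∑ i, inner ℝ (b i) (σ • b j + τ • J (b j)) * A (b j) (b i) =
      σ * A (b j) (b j) + τ * A (b j) (J (b j)) := by
    intro j
    have := congrArg (A (b j)) (sum_inner_smul b (σ • b j + τ • J (b j)))
    simpa only [map_sum, map_smul, map_add, smul_eq_mul] using this
  rw [Finset.sum_congr rfl fun j _ => e3 j, Finset.sum_add_distrib, ← Finset.mul_sum,
    ← Finset.mul_sum]
  have hsymm : ∀ v w, A v w = A w v := fun v w => hess_symm hs _ _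
  have e4 := sum_bilin_J b A J hJ
  rw [Finset.sum_congr rfl fun j _ => hsymm (J (b j)) (b j)] at e4
  have e5 : ∑ i, A (b i) (b i) = 0 := by
    rw [← (h p hp).2, Lap_slice hs]
    exact Finset.sum_congr rfl fun i _ => (pd_pd hs _ _).symm
  have e6 : ∑ i, A (b i) (J (b i)) = 0 := by linarith
  rw [e5, e6]
  ring

lemma op_fundK (c : ℝ) (m : ℕ) (hJ : ∀ x, J (J x) = -x) {p : E × E} (hp : p.2 ≠ p.1)
    (σ τ : ℝ) (w : E) :
    op J (2 * m * σ) σ τ w (fun q => fundK c m (q.2 - q.1)) p = 0 := by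
  have hy : p.2 - p.1 ≠ 0 := sub_ne_zero.2 hp
  have hn : ‖p.2 - p.1‖ ^ 2 ≠ 0 := by positivity
  have h1 : fderiv ℝ (fun q : E × E => fundK c m (q.2 - q.1)) p (yf J σ τ w p) =
      pd (σ • (p.2 - p.1) + τ • J (p.2 - p.1)) (fundK c m) (p.2 - p.1) := by
    have := (sm_diff (sm_fundK c m hy)).hasFDerivAt.comp p
      ((ContinuousLinearMap.snd ℝ E E - ContinuousLinearMap.fst ℝ E E).hasFDerivAt)
    have e : (fun q : E × E => fundK c m (q.2 - q.1)) =
      (fundK c m) ∘ (ContinuousLinearMap.snd ℝ E E - ContinuousLinearMap.fst ℝ E E) := rfl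
    rw [e, this.fderiv, pd]
    simp [yf]
  rw [op, h1, fundK_eq, pd_comp (u := fun y : E => ‖y‖ ^ 2) (sm_diff (sm_invpow c m hn))
    (sm_diff (sm_norm_sq _)), deriv_invpow c m hn, pd_sq_norm, inner_add_right, inner_smul_right,
    inner_smul_right, inner_J_self hJ, real_inner_self_eq_norm_sq]
  field_simp
  ring

lemma op_diag {u : E × E → ℝ} {z : E} (h : DifferentiableAt ℝ u (z, z)) (β σ τ : ℝ) (w : E) :
    op J β σ τ w u (z, z) = β * u (z, z) + pd w (fun z => u (z, z)) z := by
  rw [op, pd_diag h]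
  simp [yf, pd]

lemma op_op_diag {u : E × E → ℝ} {z : E} (h : 𝒞 u (z, z)) (β σ τ : ℝ) (w : E) :
    op J β σ τ w (op J β σ τ w u) (z, z) = β ^ 2 * u (z, z)
      + 2 * β * pd w (fun z => u (z, z)) z + hess (fun z => u (z, z)) z w w := by
  have hd := sm_diag h
  have e : (fun z => op J β σ τ w u (z, z)) =ᶠ[𝓝 z]
      fun z => β * u (z, z) + pd w (fun z => u (z, z)) z :=
    (ev_diag (sm_ev h)).mono fun x hx => op_diag hx β σ τ w
  rw [op_diag (sm_diff (sm_op h β σ τ w)), pd_congr e, op_diag (sm_diff h),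
    pd_add (u := fun z => β * u (z, z)) ((sm_diff hd).const_mul β) (sm_diff (sm_pd hd w)),
    pd_const_mul _ _ (sm_diff hd), pd_pd hd]
  ring
end JointCalculus

section SliceOperators
variable {E : Type*} [NormedAddCommGroup E] [InnerProductSpace ℝ E] {J : E ≃ₗᵢ[ℝ] E}

lemma pd_op {u : E × E → ℝ} {p : E × E} (h : 𝒞 u p) (β σ τ : ℝ) (w : E) (v : E × E) :
    pd v (op J β σ τ w u) p = β * fderiv ℝ u p v + hess u p v (yf J σ τ w p)
      + fderiv ℝ u p (0, σ • (v.2 - v.1) + τ • J (v.2 - v.1)) := by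
  have hf := sm_diff (sm_fderiv h)
  have hy := sm_diff (sm_yf (J := J) σ τ w p)
  change pd _ (fun q => β * u q + fderiv ℝ u q (yf J σ τ w q)) p = _
  rw [pd_add (u := fun q => β * u q) ((sm_diff h).const_mul β) (hf.clm_apply hy),
    pd_const_mul _ _ (sm_diff h), pd_clm_apply hf hy, pd_yf, add_assoc]
  rfl

def aff (J : E ≃ₗᵢ[ℝ] E) (σ τ : ℝ) (w z x : E) : E := w + (σ • (x - z) + τ • J (x - z))

lemma yf_eq (σ τ : ℝ) (w z x : E) : yf J σ τ w (z, x) = (w, 0) + (0, aff J σ τ w z x) := by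
  simp [yf, aff]

lemma yf_J (hJ : ∀ x, J (J x) = -x) (σ τ : ℝ) (w z x : E) :
    yf J (-τ) σ (J w) (z, x) = (J w, 0) + (0, J (aff J σ τ w z x)) := by
  simp only [yf, aff, map_add, map_smul, hJ, Prod.mk_add_mk, add_zero, zero_add, Prod.mk.injEq,
    true_and, smul_neg, neg_smul]
  abel

lemma sm_aff (σ τ : ℝ) (w z x : E) : 𝒞 (aff J σ τ w z) x :=
  contDiffAt_const.add ((contDiffAt_const.smul (contDiffAt_id.sub contDiffAt_const)).add
    (contDiffAt_const.smul
      (sm_J (V := fun x => x - z) (fun x => contDiffAt_id.sub contDiffAt_const) x)))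

def zop (β : ℝ) (w : E) (u : E × E → ℝ) (p : E × E) : ℝ := β * u p + fderiv ℝ u p (w, 0)

def zop2 (β₁ β₂ : ℝ) (w w' : E) (u : E × E → ℝ) (p : E × E) : ℝ :=
  (β₁ * (β₁ * u p + 2 * fderiv ℝ u p (w, 0)) + hess u p (w, 0) (w, 0))
    + (β₂ * (β₂ * u p + 2 * fderiv ℝ u p (w', 0)) + hess u p (w', 0) (w', 0))

lemma sm_zop {u : E × E → ℝ} {p : E × E} (h : 𝒞 u p) (β : ℝ) (w : E) : 𝒞 (zop β w u) p :=
  (contDiffAt_const.mul h).add (sm_pd h (w, 0))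

lemma fderiv_slice {u : E × E → ℝ} {z x : E} (h : DifferentiableAt ℝ u (z, x)) (r : E) :
    fderiv ℝ (fun x => u (z, x)) x r = fderiv ℝ u (z, x) (0, r) :=
  pd_slice (p := (z, x)) h r

lemma fderiv_slice_zop {u : E × E → ℝ} {z x : E} (h : 𝒞 u (z, x)) (β : ℝ) (w r : E) :
    fderiv ℝ (fun x => zop β w u (z, x)) x r =
      β * fderiv ℝ u (z, x) (0, r) + hess u (z, x) (0, r) (w, 0) := by
  rw [fderiv_slice (sm_diff (sm_zop h β w))]
  change pd (0, r) (fun q => β * u q + pd (w, 0) u q) (z, x) = _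
  rw [pd_add (u := fun q => β * u q) ((sm_diff h).const_mul β) (sm_diff (sm_pd h _)),
    pd_const_mul _ _ (sm_diff h), pd_pd h]
  rfl

variable (hJ : ∀ x, J (J x) = -x) {u : E × E → ℝ} {z x : E} (h : 𝒞 u (z, x))
include h

lemma opF_fst (β σ τ : ℝ) (w : E) :
    opF (fun x => u (z, x)) (fun x => zop β w u (z, x)) (aff J σ τ w z) x =
      op J β σ τ w u (z, x) := by
  rw [opF, fderiv_slice (sm_diff h), op, yf_eq, map_add, ← add_assoc]
  rfl

include hJ in
lemma opF_snd (β σ τ : ℝ) (w : E) :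
    opF (fun x => u (z, x)) (fun x => zop β (J w) u (z, x)) (fun x => J (aff J σ τ w z x)) x =
      op J β (-τ) σ (J w) u (z, x) := by
  rw [opF, fderiv_slice (sm_diff h), op, yf_J hJ, map_add, ← add_assoc]
  rfl

include hJ in
lemma opM_eq (β₁ β₂ σ τ : ℝ) (w r : E) :
    opM J (fun x => u (z, x)) (fun x => zop β₁ w u (z, x)) (fun x => zop β₂ (J w) u (z, x))
      (aff J σ τ w z) x r =
      pd r (fun x => op J β₁ σ τ w u (z, x)) x
      + pd (J r) (fun x => op J β₂ (-τ) σ (J w) u (z, x)) x := by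
  have h1 := sm_diff (sm_op (J := J) h β₁ σ τ w)
  have h2 := sm_diff (sm_op (J := J) h β₂ (-τ) σ (J w))
  rw [pd_slice (p := (z, x)) h1, pd_slice (p := (z, x)) h2, pd_op h, pd_op h, yf_eq, yf_J hJ, opM,
    fderiv_slice_zop h, fderiv_slice_zop h, hess_slice (p := (z, x)) h,
    hess_slice (p := (z, x)) h]
  have e : ((0 : E), -τ • (J r - 0) + σ • J (J r - 0)) = -((0 : E), σ • (r - 0) + τ • J (r - 0)) := by
    simp only [sub_zero, hJ, neg_smul, smul_neg, Prod.neg_mk, neg_zero, Prod.mk.injEq, true_and]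
    abel
  dsimp only
  rw [e, map_neg, map_add, map_add]
  ring

include hJ in
lemma opN_eq (β₁ β₂ σ τ : ℝ) (w r : E) :
    opN J (fun x => u (z, x)) (fun x => zop β₁ w u (z, x)) (fun x => zop β₂ (J w) u (z, x))
      (aff J σ τ w z) x r =
      pd r (fun x => op J β₂ (-τ) σ (J w) u (z, x)) x
      - pd (J r) (fun x => op J β₁ σ τ w u (z, x)) x := by
  have h1 := sm_diff (sm_op (J := J) h β₁ σ τ w)
  have h2 := sm_diff (sm_op (J := J) h β₂ (-τ) σ (J w))
  rw [pd_slice (p := (z, x)) h1, pd_slice (p := (z, x)) h2, pd_op h, pd_op h, yf_J hJ, yf_eq, opN,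
    fderiv_slice_zop h, fderiv_slice_zop h, hess_slice (p := (z, x)) h,
    hess_slice (p := (z, x)) h]
  have e : ((0 : E), σ • (J r - 0) + τ • J (J r - 0)) = ((0 : E), -τ • (r - 0) + σ • J (r - 0)) := by
    simp only [sub_zero, hJ, neg_smul, smul_neg, Prod.mk.injEq, true_and]
    abel
  dsimp only
  rw [e, map_add, map_add]
  ring

include hJ in
lemma opU_eq (β₁ β₂ σ τ : ℝ) (w : E) :
    opU J (fun x => u (z, x)) (fun x => zop β₁ w u (z, x)) (fun x => zop β₂ (J w) u (z, x))
      (fun x => zop2 β₁ β₂ w (J w) u (z, x)) (aff J σ τ w z) x =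
      op J β₁ σ τ w (op J β₁ σ τ w u) (z, x)
      + op J β₂ (-τ) σ (J w) (op J β₂ (-τ) σ (J w) u) (z, x) := by
  have hsym := hess_symm h
  rw [opU, op_op h, op_op h, pd_yf, pd_yf, fderiv_slice_zop h, fderiv_slice_zop h,
    hess_slice (p := (z, x)) h, hess_slice (p := (z, x)) h]
  have e : ((0 : E), -τ • ((yf J (-τ) σ (J w) (z, x)).2 - (yf J (-τ) σ (J w) (z, x)).1)
      + σ • J ((yf J (-τ) σ (J w) (z, x)).2 - (yf J (-τ) σ (J w) (z, x)).1)) =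
      -((0 : E), σ • ((yf J σ τ w (z, x)).2 - (yf J σ τ w (z, x)).1)
      + τ • J ((yf J σ τ w (z, x)).2 - (yf J σ τ w (z, x)).1)) := by
    simp only [yf, add_sub_cancel_left, Prod.neg_mk, neg_zero, Prod.mk.injEq, true_and, map_add,
      map_smul, hJ, smul_add, smul_neg, neg_smul, neg_add, neg_neg, map_neg]
    rw [smul_comm σ τ (J (x - z))]
    abel
  rw [e, map_neg, yf_eq, yf_J hJ]
  simp only [map_add, _root_.add_apply, zop2]
  rw [hsym (0, aff J σ τ w z x) (w, 0), hsym (0, J (aff J σ τ w z x)) (J w, 0)]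
  ring
end SliceOperators

section PoleVariation
variable {E : Type*} [NormedAddCommGroup E] [InnerProductSpace ℝ E] {ι : Type*} [Fintype ι]
  {b : OrthonormalBasis ι ℝ E} {J : E ≃ₗᵢ[ℝ] E} [MeasurableSpace E] {μ : Measure E}
  {l : E → ℝ} {c : ℝ} {m : ℕ} {ψ : E → E → ℝ} [FiniteDimensional ℝ E] [BorelSpace E]
  [μ.IsAddHaarMeasure]

/-- Pairs of distinct points of `Om l`. -/
def Of (l : E → ℝ) : Set (E × E) := {p | p.1 ∈ Om l ∧ p.2 ∈ Om l ∧ p.2 ≠ p.1}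

/-- `gr` as a function of the pole and the variable jointly. -/
def ug (c : ℝ) (m : ℕ) (ψ : E → E → ℝ) (p : E × E) : ℝ := gr c m ψ p.1 p.2

omit [InnerProductSpace ℝ E] [MeasurableSpace E] [FiniteDimensional ℝ E] [BorelSpace E] in
lemma ug_eq (c : ℝ) (m : ℕ) (ψ : E → E → ℝ) :
    ug c m ψ = fun p => fundK c m (p.2 - p.1) - ψ p.1 p.2 := rfl

omit [MeasurableSpace E] [FiniteDimensional ℝ E] [BorelSpace E] in
lemma sm_fund2 (c : ℝ) (m : ℕ) {p : E × E} (hp : p.2 ≠ p.1) :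
    𝒞 (fun q : E × E => fundK c m (q.2 - q.1)) p :=
  ContDiffAt.comp (g := fundK c m) (f := fun q : E × E => q.2 - q.1) p
    (sm_fundK c m (sub_ne_zero.2 hp)) (contDiffAt_snd.sub contDiffAt_fst)

omit [MeasurableSpace E] [FiniteDimensional ℝ E] [BorelSpace E] in
lemma Harm2.hn_slice {u : E × E → ℝ} (h : Harm2 b (Of l) u) {z : E} (hz : z ∈ Om l) :
    HN b l (fun x => u (z, x)) := by
  filter_upwards [nb_pos l, nb_lt l (show 0 < l z from hz)] with x h1 h2
  have hx : (z, x) ∈ Of l := ⟨hz, h1, fun e => by dsimp at e; rw [e] at h2; exact lt_irrefl _ h2⟩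
  exact ⟨sm_slice (h _ hx).1, (h _ hx).2⟩

namespace GreenSys
variable (hG : GreenSys b J μ l c m ψ)
include hG

omit [FiniteDimensional ℝ E] [BorelSpace E] [μ.IsAddHaarMeasure] in
lemma isOpen_prod : IsOpen (Om l ×ˢ Om l) := hG.isOpen.prod hG.isOpen

omit [FiniteDimensional ℝ E] [BorelSpace E] [μ.IsAddHaarMeasure] in
lemma isOpen_Of : IsOpen (Of l) := by
  have : Of l = (Om l ×ˢ Om l) ∩ {p | p.2 ≠ p.1} := by
    ext p; simp [Of, and_assoc]
  rw [this]
  exact hG.isOpen_prod.inter (isOpen_ne_fun continuous_snd continuous_fst)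

lemma harm2_psi : Harm2 b (Om l ×ˢ Om l) (fun p => ψ p.1 p.2) :=
  fun _ hp => ⟨hG.psi_smooth hp.1 hp.2, ((hG.harm _ hp.1) _ hp.2).2⟩

lemma harm2_ug : Harm2 b (Of l) (ug c m ψ) := fun p hp =>
  ⟨(sm_fund2 c m hp.2.2).sub (hG.psi_smooth hp.1 hp.2.1), (hG.gr_harm hp.1 p.2 ⟨hp.2.1, hp.2.2⟩).2⟩

lemma ug_decay {z : E} (hz : z ∈ Om l) (w : E) :
    Dk l 1 (gr c m ψ z) ∧ Dk l 1 (fun x => fderiv ℝ (ug c m ψ) (z, x) (w, 0)) ∧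
      Dk l 1 (fun x => hess (ug c m ψ) (z, x) (w, 0) (w, 0)) := by
  obtain ⟨k, hk⟩ := hG.exists_ker
  obtain ⟨ρ, hρ, a, ha, C, hC, hal, hle⟩ := hG.gr_le hz
  obtain ⟨K, hK, hgrad⟩ := hk.grad_est
  have hnear : ∀ᶠ x in nb l, 0 < l x ∧ l x < a := by
    filter_upwards [nb_pos l, nb_lt l ha] with x h1 h2 using ⟨h1, h2⟩
  have hzb : z ∈ ball z ρ := mem_ball_self hρ
  have hmem : ∀ x, 0 < l x → l x < a → ∀ y ∈ ball z ρ, (y, x) ∈ Of l := fun x h1 h2 y hy =>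
    ⟨ha.trans (hal y hy), h1, fun e => by
      have := hal y hy; dsimp at e; rw [← e] at this; linarith⟩
  have hH : ∀ x, 0 < l x → l x < a → Harm b (ball z ρ) (fun y => ug c m ψ (y, x)) := by
    intro x h1 h2
    have e : (fun y => ug c m ψ (y, x)) = fun y => fundK c m (y - x) - ψ y x := by
      funext y; rw [ug_eq]; dsimp only; rw [fundK_sub_comm]
    rw [e]
    refine ((Harm_fundK_sub c m hG.dim x).mono fun y hy => ?_).sub
      ((hG.harm_left h1).mono fun y hy => ha.trans (hal y hy))
    exact fun e => (hmem x h1 h2 y hy).2.2 (by simpa using e.symm)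
  have hfst : ∀ x, 0 < l x → l x < a → ∀ y ∈ ball z ρ,
      pd w (fun y => ug c m ψ (y, x)) y = pd (w, 0) (ug c m ψ) (y, x) := fun x h1 h2 y hy =>
    pd_slice_left (p := (y, x)) (sm_diff (hG.harm2_ug _ (hmem x h1 h2 y hy)).1) w
  have hsnd : ∀ x, 0 < l x → l x < a →
      pd w (pd w (fun y => ug c m ψ (y, x))) z = hess (ug c m ψ) (z, x) (w, 0) (w, 0) := by
    intro x h1 h2
    have hs := (hG.harm2_ug _ (hmem x h1 h2 z hzb)).1
    rw [← pd_pd hs, ← pd_slice_left (p := (z, x)) (sm_diff (sm_pd hs _))]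
    refine pd_congr ?_ _
    filter_upwards [isOpen_ball.mem_nhds hzb] with y hy using hfst x h1 h2 y hy
  have hb1 : ∀ x, 0 < l x → l x < a → ∀ y ∈ ball z (ρ / 2),
      |pd w (fun y => ug c m ψ (y, x)) y| ≤ K * (C * l x) / (ρ / 2) * ‖w‖ := by
    intro x h1 h2 y hy
    have hsub : ball y (ρ / 2) ⊆ ball z ρ := ball_subset_ball' (by
      rw [mem_ball] at hy; linarith)
    exact hgrad y (ρ / 2) _ _ (by positivity) ((hH x h1 h2).mono hsub)
      (fun v hv => hle v (hsub hv) x h1 h2.le) w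
  refine ⟨Dk.of_le (C := C) ?_, Dk.of_le (C := K * C / (ρ / 2) * ‖w‖) ?_,
    Dk.of_le (C := K * (K * C / (ρ / 2) * ‖w‖) / (ρ / 2) * ‖w‖) ?_⟩
  · filter_upwards [hnear] with x ⟨h1, h2⟩
    rw [Real.rpow_one]
    exact hle z hzb x h1 h2.le
  · filter_upwards [hnear] with x ⟨h1, h2⟩
    rw [Real.rpow_one]
    have := hb1 x h1 h2 z (mem_ball_self (by positivity))
    rw [hfst x h1 h2 z hzb] at this
    refine (this.trans_eq ?_)
    ring
  · filter_upwards [hnear] with x ⟨h1, h2⟩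
    rw [Real.rpow_one]
    have := hgrad z (ρ / 2) (K * (C * l x) / (ρ / 2) * ‖w‖) _ (by positivity)
      (((hH x h1 h2).pd isOpen_ball w).mono (ball_subset_ball (by linarith))) (hb1 x h1 h2) w
    rw [hsnd x h1 h2] at this
    refine (this.trans_eq ?_)
    ring

lemma zop_decay {z : E} (hz : z ∈ Om l) (β : ℝ) (w : E) :
    Dk l 1 (fun x => zop β w (ug c m ψ) (z, x)) := by
  obtain ⟨h0, h1, -⟩ := hG.ug_decay hz w
  exact (h0.const_mul β).add h1

lemma zop2_decay {z : E} (hz : z ∈ Om l) (β₁ β₂ : ℝ) (w w' : E) :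
    Dk l 1 (fun x => zop2 β₁ β₂ w w' (ug c m ψ) (z, x)) := by
  obtain ⟨h0, h1, h2⟩ := hG.ug_decay hz w
  obtain ⟨-, h1', h2'⟩ := hG.ug_decay hz w'
  exact ((((h0.const_mul β₁).add (h1.const_mul 2)).const_mul β₁).add h2).add
    ((((h0.const_mul β₂).add (h1'.const_mul 2)).const_mul β₂).add h2')

lemma zop_hn {z : E} (hz : z ∈ Om l) (β : ℝ) (w : E) :
    HN b l (fun x => zop β w (ug c m ψ) (z, x)) := by
  have h0 := hG.harm2_ug.hn_slice hz
  have h1 := (hG.harm2_ug.pd hG.isOpen_Of (w, 0)).hn_slice hz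
  filter_upwards [h0, h1] with x h0 h1
  refine ⟨(contDiffAt_const.mul h0.1).add h1.1, ?_⟩
  change Lap b (fun x => β * ug c m ψ (z, x) + pd (w, 0) (ug c m ψ) (z, x)) x = 0
  rw [Lap_add b (u := fun x => β * ug c m ψ (z, x)) (contDiffAt_const.mul h0.1) h1.1,
    Lap_const_mul b h0.1, h0.2, h1.2]
  simp
end GreenSys
end PoleVariation

section LevelCutoff
variable {E : Type*} [NormedAddCommGroup E] [InnerProductSpace ℝ E] {ι : Type*} [Fintype ι]
  {b : OrthonormalBasis ι ℝ E} {J : E ≃ₗᵢ[ℝ] E} [MeasurableSpace E] {μ : Measure E}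
  {l : E → ℝ} {c : ℝ} {m : ℕ} {ψ : E → E → ℝ}

open scoped Classical in
lemma GreenSys.exists_level_cutoff (hG : GreenSys b J μ l c m ψ) {z : E} (hz : z ∈ Om l) {ε κ : ℝ}
    (hε : 0 < ε) (hκ : 0 ≤ κ) {χ : ℝ → ℝ} (hχ : ∀ s, 𝒞 χ s) (hχ0 : ∀ s, s < ε → χ s = 0)
    (hχ1 : ∀ s, 2 * ε < s → χ s = κ) (hnn : ∀ s, 0 ≤ χ s) :
    ∃ T : E → ℝ, (∀ x, 𝒞 T x) ∧ HasCompactSupport T ∧ tsupport T ⊆ Om l ∧ (∀ x, 0 ≤ T x) ∧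
      (∀ x ∈ Om l, x ≠ z → T x = χ (gr c m ψ z x)) ∧ (∀ᶠ x in 𝓝 z, T x = κ) ∧
      ∀ x ∈ Om l, ∀ v, pd v T x = deriv χ (gr c m ψ z x) * pd v (gr c m ψ z) x := by
  set g := gr c m ψ z with hg
  set T : E → ℝ := fun x => if x = z then κ else if x ∈ Om l then χ (g x) else 0 with hT
  obtain ⟨s, hs, hsz, hsb⟩ := hG.gr_bd hz (half_pos hε)
  have hTz : ∀ᶠ x in 𝓝 z, T x = κ := by
    filter_upwards [eventually_nhdsWithin_iff.1 ((hG.tendsto_gr hz).eventually_gt_atTop (2 * ε)),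
      hG.isOpen.mem_nhds hz] with x hx hxO
    by_cases h : x = z
    · simp [hT, h]
    · simp only [hT, if_neg h, if_pos hxO]
      exact hχ1 _ (hx h)
  have hTeq : ∀ x ∈ Om l, x ≠ z → T x = χ (g x) := fun x hx h => by
    simp only [hT, if_neg h, if_pos hx]
  have hTg : ∀ x ∈ Om l, x ≠ z → T =ᶠ[𝓝 x] fun y => χ (g y) := fun x hx h => by
    filter_upwards [hG.isOpen.mem_nhds hx, isOpen_ne.mem_nhds h] with y h1 h2 using hTeq y h1 h2
  have hTout : ∀ x, l x < s → T x = 0 := fun x hx => by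
    have hxz : x ≠ z := by rintro rfl; linarith
    by_cases hxO : x ∈ Om l
    · rw [hTeq x hxO hxz]
      refine hχ0 _ ?_
      linarith [le_abs_self (g x), hsb x hxO hx]
    · simp only [hT, if_neg hxz, if_neg hxO]
  have hsupp : tsupport T ⊆ {x | s ≤ l x} := closure_minimal
    (fun x hx => not_lt.1 fun h => hx (hTout x h)) (isClosed_le continuous_const hG.dom.cont)
  have hgs : ∀ x ∈ Om l, x ≠ z → 𝒞 g x := fun x hx h => (hG.gr_harm hz).sm ⟨hx, h⟩
  refine ⟨T, fun x => ?_, (hG.dom.isCompact_ge hs).of_isClosed_subset (isClosed_tsupport _) hsupp,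
    fun x hx => hs.trans_le (hsupp hx), fun x => ?_, hTeq, hTz, fun x hx v => ?_⟩
  · by_cases hxz : x = z
    · subst hxz; exact contDiffAt_const.congr_of_eventuallyEq hTz
    by_cases hxO : x ∈ Om l
    · exact ((hχ _).comp x (hgs x hxO hxz)).congr_of_eventuallyEq (hTg x hxO hxz)
    · refine contDiffAt_const (c := (0 : ℝ)).congr_of_eventuallyEq ?_
      have : l x < s := (not_lt.1 hxO).trans_lt hs
      filter_upwards [hG.dom.cont.continuousAt.eventually (gt_mem_nhds this)] with y hy
        using hTout y hy
  · simp only [hT]; split_ifs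
    exacts [hκ, hnn _, le_rfl]
  · by_cases hxz : x = z
    · subst hxz
      rw [pd_congr hTz, pd_const]
      have : deriv χ (g x) = 0 := by
        have h0 : χ =ᶠ[𝓝 (g x)] fun _ => 0 := by
          filter_upwards [gt_mem_nhds ((hG.gr_self hz).trans hε)] with t ht using hχ0 t ht
        rw [h0.deriv_eq, deriv_const]
      rw [this, zero_mul, Pi.zero_apply]
    · rw [pd_congr (hTg x hx hxz), pd_comp (sm_diff (hχ _)) (sm_diff (hgs x hx hxz))]
end LevelCutoff

section FluxInequality
variable {E : Type*} [NormedAddCommGroup E] [InnerProductSpace ℝ E] {ι : Type*} [Fintype ι]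
  {b : OrthonormalBasis ι ℝ E} {J : E ≃ₗᵢ[ℝ] E}

/-- The flux of the pair `f₁, f₂` in the direction `v`. -/
def flux (J : E ≃ₗᵢ[ℝ] E) (f₁ f₂ : E → ℝ) (v x : E) : ℝ :=
  f₁ x * (pd v f₁ x + pd (J v) f₂ x) + f₂ x * (pd v f₂ x - pd (J v) f₁ x)

lemma flux_sum (f₁ f₂ : E → ℝ) (x : E) (a : ι → ℝ) :
    flux J f₁ f₂ (∑ i, a i • b i) x = ∑ i, a i * flux J f₁ f₂ (b i) x := by
  simp only [flux, pd, map_sum, map_smul, smul_eq_mul]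
  rw [← Finset.sum_add_distrib, ← Finset.sum_sub_distrib, Finset.mul_sum, Finset.mul_sum,
    ← Finset.sum_add_distrib]
  exact Finset.sum_congr rfl fun i _ => by ring

lemma sm_flux {f₁ f₂ : E → ℝ} {x : E} (h1 : 𝒞 f₁ x) (h2 : 𝒞 f₂ x) (v : E) :
    𝒞 (flux J f₁ f₂ v) x :=
  (h1.mul ((sm_pd h1 _).add (sm_pd h2 _))).add (h2.mul ((sm_pd h2 _).sub (sm_pd h1 _)))

lemma sum_hess_J (hJ : ∀ x, J (J x) = -x) {f : E → ℝ} {x : E} (h : 𝒞 f x) :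
    ∑ i, hess f x (b i) (J (b i)) = 0 := by
  have h1 := sum_bilin_J b (hess f x) J hJ
  have h2 : ∑ i, hess f x (J (b i)) (b i) = ∑ i, hess f x (b i) (J (b i)) :=
    Finset.sum_congr rfl fun i _ => hess_symm h _ _
  linarith

lemma div_flux_nonneg (hJ : ∀ x, J (J x) = -x) {f₁ f₂ : E → ℝ} {x : E} (h1 : 𝒞 f₁ x)
    (h2 : 𝒞 f₂ x) (hL1 : Lap b f₁ x = 0) (hL2 : Lap b f₂ x = 0) :
    0 ≤ ∑ i, pd (b i) (flux J f₁ f₂ (b i)) x := by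
  have hd : ∀ v, pd v (flux J f₁ f₂ v) x =
      (pd v f₁ x * (pd v f₁ x + pd (J v) f₂ x) + pd v f₂ x * (pd v f₂ x - pd (J v) f₁ x))
      + f₁ x * (hess f₁ x v v + hess f₂ x v (J v)) + f₂ x * (hess f₂ x v v - hess f₁ x v (J v)) := by
    intro v
    have a1 := sm_pd h1 v
    have a2 := sm_pd h2 v
    have b1 := sm_pd h1 (J v)
    have b2 := sm_pd h2 (J v)
    change pd v (fun x => f₁ x * (pd v f₁ x + pd (J v) f₂ x)
      + f₂ x * (pd v f₂ x - pd (J v) f₁ x)) x = _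
    rw [pd_add (u := fun x => f₁ x * (pd v f₁ x + pd (J v) f₂ x))
      (sm_diff (h1.mul (a1.add b2))) (sm_diff (h2.mul (a2.sub b1))),
      pd_mul (sm_diff h1) (sm_diff (a1.add b2)), pd_mul (sm_diff h2) (sm_diff (a2.sub b1)),
      pd_add (sm_diff a1) (sm_diff b2), pd_sub (sm_diff a2) (sm_diff b1), pd_pd h1, pd_pd h1,
      pd_pd h2, pd_pd h2]
    ring
  rw [Finset.sum_congr rfl fun i _ => hd (b i), Finset.sum_add_distrib, Finset.sum_add_distrib,
    ← Finset.mul_sum, ← Finset.mul_sum, Finset.sum_add_distrib (f := fun i => hess f₁ x (b i) (b i)),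
    Finset.sum_sub_distrib (f := fun i => hess f₂ x (b i) (b i)), sum_hess_J hJ h1,
    sum_hess_J hJ h2, ← Lap_hess b h1, ← Lap_hess b h2, hL1, hL2]
  have hc := sum_bilin_J b ((fderiv ℝ f₁ x).smulRight (fderiv ℝ f₂ x)) J hJ
  have hi := sum_bilin_isometry b ((fderiv ℝ f₂ x).smulRight (fderiv ℝ f₂ x)) J
  simp only [ContinuousLinearMap.smulRight_apply, _root_.smul_apply, smul_eq_mul] at hc hi
  have hs : 0 ≤ ∑ i, (pd (b i) f₁ x + pd (J (b i)) f₂ x) ^ 2 :=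
    Finset.sum_nonneg fun _ _ => sq_nonneg _
  refine hs.trans_eq ?_
  have e : ∑ i, (pd (b i) f₁ x + pd (J (b i)) f₂ x) ^ 2 -
      ∑ i, (pd (b i) f₁ x * (pd (b i) f₁ x + pd (J (b i)) f₂ x)
        + pd (b i) f₂ x * (pd (b i) f₂ x - pd (J (b i)) f₁ x)) =
      (∑ i, fderiv ℝ f₁ x (b i) * fderiv ℝ f₂ x (J (b i))
        + ∑ i, fderiv ℝ f₁ x (J (b i)) * fderiv ℝ f₂ x (b i))
      + (∑ i, fderiv ℝ f₂ x (J (b i)) * fderiv ℝ f₂ x (J (b i))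
        - ∑ i, fderiv ℝ f₂ x (b i) * fderiv ℝ f₂ x (b i)) := by
    rw [← Finset.sum_sub_distrib, ← Finset.sum_add_distrib, ← Finset.sum_sub_distrib,
      ← Finset.sum_add_distrib]
    exact Finset.sum_congr rfl fun i _ => by simp only [pd]; ring
  rw [hc, hi] at e
  linarith

variable [FiniteDimensional ℝ E] [MeasurableSpace E] [BorelSpace E] (μ : Measure E)
  [μ.IsAddHaarMeasure]

lemma integrable_mul_pd {O : Set E} {T : E → ℝ} (hT : ∀ x, 𝒞 T x) (hTc : HasCompactSupport T)
    (hTO : tsupport T ⊆ O) {Y : E → ℝ} (hY : ∀ x ∈ O, 𝒞 Y x) (v : E) :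
    Integrable (fun x => Y x * pd v T x) μ :=
  integrable_cs μ (fun x => (sm_mul_supp (fun x => sm_pd (hT x) v)
    (fun x hx => hY x (hTO (tsupport_pd_subset _ _ hx))) x).continuousAt) (cs_mul (cs_pd hTc v))

theorem integral_flux_nonpos (hJ : ∀ x, J (J x) = -x) {O : Set E} {T : E → ℝ} (hT : ∀ x, 𝒞 T x)
    (hTc : HasCompactSupport T) (hTO : tsupport T ⊆ O) (hT0 : ∀ x, 0 ≤ T x) {f₁ f₂ : E → ℝ}
    (h1 : Harm b O f₁) (h2 : Harm b O f₂) :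
    ∫ x, ∑ i, flux J f₁ f₂ (b i) x * pd (b i) T x ∂μ ≤ 0 := by
  have hY : ∀ i, ∀ x ∈ O, 𝒞 (flux J f₁ f₂ (b i)) x := fun i x hx =>
    sm_flux (h1.sm hx) (h2.sm hx) _
  have hs : ∀ i x, 𝒞 (fun y => flux J f₁ f₂ (b i) y * T y) x := fun i =>
    sm_mul_supp hT fun x hx => hY i x (hTO hx)
  have hI : ∀ i, Integrable (pd (b i) fun y => flux J f₁ f₂ (b i) y * T y) μ := fun i =>
    integrable_cs μ (fun x => (sm_pd (hs i x) _).continuousAt) (cs_pd (cs_mul hTc) _)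
  have hz : ∫ x, ∑ i, pd (b i) (fun y => flux J f₁ f₂ (b i) y * T y) x ∂μ = 0 := by
    rw [integral_finsetSum _ fun i _ => hI i]
    exact Finset.sum_eq_zero fun i _ => integral_pd_eq_zero μ (hs i) (cs_mul hTc) _
  rw [← hz]
  refine integral_mono (integrable_finsetSum _ fun i _ => integrable_mul_pd μ hT hTc hTO (hY i) _)
    (integrable_finsetSum _ fun i _ => hI i) fun x => ?_
  dsimp only
  by_cases hx : x ∈ tsupport T
  · have hd := div_flux_nonneg (b := b) hJ (h1.sm (hTO hx)) (h2.sm (hTO hx)) (h1 x (hTO hx)).2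
      (h2 x (hTO hx)).2
    have e : ∀ i, pd (b i) (fun y => flux J f₁ f₂ (b i) y * T y) x =
        flux J f₁ f₂ (b i) x * pd (b i) T x + T x * pd (b i) (flux J f₁ f₂ (b i)) x := fun i =>
      pd_mul (sm_diff (hY i x (hTO hx))) (sm_diff (hT x)) _
    rw [Finset.sum_congr rfl fun i _ => e i, Finset.sum_add_distrib, ← Finset.mul_sum]
    linarith [mul_nonneg (hT0 x) hd]
  · refine (Finset.sum_le_sum fun i _ => ?_)
    rw [pd_eq_zero_of_notMem hx, mul_zero,
      pd_eq_zero_of_notMem fun h => hx (tsupport_mul_subset' _ _ h)]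
end FluxInequality

section LeviInequality
variable {E : Type*} [NormedAddCommGroup E] [InnerProductSpace ℝ E] {ι : Type*} [Fintype ι]
  {b : OrthonormalBasis ι ℝ E} {J : E ≃ₗᵢ[ℝ] E} [MeasurableSpace E] {μ : Measure E}
  {l : E → ℝ} {c : ℝ} {m : ℕ} {ψ : E → E → ℝ} [FiniteDimensional ℝ E] [BorelSpace E]
  [μ.IsAddHaarMeasure]

omit [MeasurableSpace E] [FiniteDimensional ℝ E] [BorelSpace E] in
lemma op_neg (u : E × E → ℝ) (β σ τ : ℝ) (w : E) (p : E × E) :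
    op J β σ τ w (fun q => -u q) p = -op J β σ τ w u p := by
  simp only [op, fderiv_fun_neg, _root_.neg_apply]
  ring

lemma exists_compl_level (hG : GreenSys b J μ l c m ψ) {z : E} (hz : z ∈ Om l) {a : ℝ} (ha : 0 < a) :
    ∃ ε > 0, ∀ x ∈ Om l, x ≠ z → gr c m ψ z x ≤ 2 * ε → l x < a := by
  obtain ⟨r, hr, hrb⟩ := Metric.mem_nhdsWithin_iff.1 ((hG.tendsto_gr hz).eventually_gt_atTop 1)
  have hC : IsCompact ({x | a ≤ l x} \ ball z r) := 
    (hG.dom.isCompact_ge ha).inter_right isOpen_ball.isClosed_compl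
  have hmem : ∀ x ∈ {x | a ≤ l x} \ ball z r, x ∈ Om l \ {z} := fun x hx =>
    ⟨ha.trans_le hx.1, fun e => hx.2 (by rw [mem_singleton_iff.1 e]; exact mem_ball_self hr)⟩
  obtain ⟨d, hd, hdb⟩ : ∃ d > 0, ∀ x ∈ {x | a ≤ l x} \ ball z r, d ≤ gr c m ψ z x :=
    hC.exists_forall_le' (a := 0) (fun x hx =>
      ((hG.gr_harm hz).sm (hmem x hx)).continuousAt.continuousWithinAt)
      fun x hx => hG.gr_pos hz (hmem x hx).1 (hmem x hx).2
  refine ⟨min d 1 / 4, by positivity, fun x hx hxz hle => ?_⟩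
  by_contra! h
  have h0 : 0 < min d 1 := by positivity
  by_cases hxb : x ∈ ball z r
  · have : 1 < gr c m ψ z x := hrb ⟨hxb, hxz⟩
    linarith [min_le_right d 1]
  · linarith [min_le_left d 1, hdb x ⟨h, hxb⟩]

namespace GreenSys
variable (hG : GreenSys b J μ l c m ψ)
include hG

lemma op_ug {β σ : ℝ} (hβ : β = 2 * m * σ) (τ : ℝ) (w : E) {p : E × E} (hp : p ∈ Of l) :
    op J β σ τ w (ug c m ψ) p = -op J β σ τ w (fun p => ψ p.1 p.2) p := by
  rw [ug_eq, op_sub (sm_diff (sm_fund2 c m hp.2.2)) (sm_diff (hG.psi_smooth hp.1 hp.2.1)), hβ,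
    op_fundK c m hG.dom.J_sq hp.2.2, zero_sub]

lemma op_op_ug {β σ : ℝ} (hβ : β = 2 * m * σ) (τ : ℝ) (w : E) {p : E × E} (hp : p ∈ Of l) :
    op J β σ τ w (op J β σ τ w (ug c m ψ)) p =
      -op J β σ τ w (op J β σ τ w (fun p => ψ p.1 p.2)) p := by
  rw [← op_neg]
  refine op_congr ?_ _ _ _ _
  filter_upwards [hG.isOpen_Of.mem_nhds hp] with q hq using hG.op_ug hβ τ w hq

lemma pd_op_ug {β σ : ℝ} (hβ : β = 2 * m * σ) (τ : ℝ) (w v : E) {z x : E} (hp : (z, x) ∈ Of l) :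
    pd v (fun x => op J β σ τ w (ug c m ψ) (z, x)) x =
      -pd v (fun x => op J β σ τ w (fun p => ψ p.1 p.2) (z, x)) x := by
  rw [← pd_neg]
  refine pd_congr ?_ _
  filter_upwards [ev_slice (p := (z, x)) (hG.isOpen_Of.mem_nhds hp)] with q hq
    using hG.op_ug hβ τ w hq

/-- Near the boundary, the second variation of the Green function is controlled by the flux. -/
lemma flux_bound {z : E} (hz : z ∈ Om l) (w : E) {β₁ β₂ σ τ : ℝ} (h1 : β₁ = 2 * m * σ)
    (h2 : β₂ = 2 * m * (-τ)) {δ : ℝ} (hδ : 0 < δ) :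
    ∃ a > 0, ∀ x, 0 < l x → l x < a →
      -(gip b (gr c m ψ z) (gr c m ψ z) x *
        (op J β₁ σ τ w (op J β₁ σ τ w fun p => ψ p.1 p.2) (z, x)
          + op J β₂ (-τ) σ (J w) (op J β₂ (-τ) σ (J w) fun p => ψ p.1 p.2) (z, x))) ≤
      2 * ∑ i, flux J (fun x => op J β₁ σ τ w (fun p => ψ p.1 p.2) (z, x))
        (fun x => op J β₂ (-τ) σ (J w) (fun p => ψ p.1 p.2) (z, x)) (b i) x
          * pd (b i) (gr c m ψ z) x
      + δ * gip b (gr c m ψ z) (gr c m ψ z) x := by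
  have hJ := hG.dom.J_sq
  have := hG.nonempty
  obtain ⟨k, hk⟩ := hG.exists_ker
  obtain ⟨a, ha, C, hC, haz, hge⟩ := hG.gr_ge hz
  have hpw := pointwise hk hG.dom (g := gr c m ψ z) (hG.harm2_ug.hn_slice hz) (hG.ug_decay hz w).1
    (hG.zop_hn hz β₁ w) (hG.zop_decay hz β₁ w) (hG.zop_hn hz β₂ (J w)) (hG.zop_decay hz β₂ (J w))
    (hG.zop2_decay hz β₁ β₂ w (J w)) hC (nb_iff.2 ⟨a, ha, fun x h1 h2 => hge x h1 h2.le⟩)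
    (sm_aff (J := J) σ τ w z) hδ
  obtain ⟨a', ha', hpw⟩ := nb_iff.1 hpw
  refine ⟨min a a', lt_min ha ha', fun x hx1 hx2 => ?_⟩
  have hxz : x ≠ z := by
    rintro rfl; linarith [min_le_left a a']
  have hp : (z, x) ∈ Of l := ⟨hz, hx1, hxz⟩
  have hu := (hG.harm2_ug _ hp).1
  have key := hpw x hx1 (hx2.trans_le (min_le_right _ _))
  change ‖grd b (gr c m ψ z) x‖ ^ 2 * opU J (fun x => ug c m ψ (z, x)) _ _ _ _ _ ≤
    2 * (opF (fun x => ug c m ψ (z, x)) _ _ _ * opM J (fun x => ug c m ψ (z, x)) _ _ _ _ _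
      + opF (fun x => ug c m ψ (z, x)) _ _ _ * opN J (fun x => ug c m ψ (z, x)) _ _ _ _ _)
      + _ at key
  rw [opU_eq hJ hu, opM_eq hJ hu, opN_eq hJ hu, opF_fst hu, opF_snd hJ hu, hG.op_ug h1 _ _ hp,
    hG.op_ug h2 _ _ hp, hG.op_op_ug h1 _ _ hp, hG.op_op_ug h2 _ _ hp, hG.pd_op_ug h1 _ _ _ hp,
    hG.pd_op_ug h1 _ _ _ hp, hG.pd_op_ug h2 _ _ _ hp, hG.pd_op_ug h2 _ _ _ hp,
    norm_grd_sq] at key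
  have hf := flux_sum (b := b) (J := J) (fun x => op J β₁ σ τ w (fun p => ψ p.1 p.2) (z, x))
        (fun x => op J β₂ (-τ) σ (J w) (fun p => ψ p.1 p.2) (z, x)) x
        (fun i => pd (b i) (gr c m ψ z) x)
  rw [Finset.sum_congr rfl fun i _ => mul_comm _ _, ← hf]
  change _ ≤ 2 * flux J _ _ (grd b (gr c m ψ z) x) x + _
  rw [flux]
  linarith
lemma levi_harm {z : E} (hz : z ∈ Om l) (w : E) {β₁ β₂ σ τ : ℝ} (h1 : β₁ = 2 * m * σ)
    (h2 : β₂ = 2 * m * (-τ)) :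
    0 ≤ op J β₁ σ τ w (op J β₁ σ τ w fun p => ψ p.1 p.2) (z, z)
      + op J β₂ (-τ) σ (J w) (op J β₂ (-τ) σ (J w) fun p => ψ p.1 p.2) (z, z) := by
  have hJ := hG.dom.J_sq
  have hO := hG.isOpen_prod
  set H : E → ℝ := fun x => op J β₁ σ τ w (op J β₁ σ τ w fun p => ψ p.1 p.2) (z, x)
      + op J β₂ (-τ) σ (J w) (op J β₂ (-τ) σ (J w) fun p => ψ p.1 p.2) (z, x) with hH
  set f₁ : E → ℝ := fun x => op J β₁ σ τ w (fun p => ψ p.1 p.2) (z, x) with hf1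
  set f₂ : E → ℝ := fun x => op J β₂ (-τ) σ (J w) (fun p => ψ p.1 p.2) (z, x) with hf2
  set g := gr c m ψ z with hg
  have hsl : ∀ u : E × E → ℝ, Harm2 b (Om l ×ˢ Om l) u → Harm b (Om l) fun x => u (z, x) :=
    fun u hu x hx => ⟨sm_slice (p := (z, x)) (hu (z, x) ⟨hz, hx⟩).1, (hu (z, x) ⟨hz, hx⟩).2⟩
  have k1 := hG.harm2_psi.op hJ hO β₁ σ τ w
  have k2 := hG.harm2_psi.op hJ hO β₂ (-τ) σ (J w)
  have hHh : Harm b (Om l) H :=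
    (hsl _ (k1.op hJ hO β₁ σ τ w)).add (hsl _ (k2.op hJ hO β₂ (-τ) σ (J w)))
  change 0 ≤ H z
  refine le_of_forall_pos_le_add fun δ hδ => ?_
  obtain ⟨a, ha, hb⟩ := hG.flux_bound hz w h1 h2 hδ
  obtain ⟨ε, hε, hεa⟩ := exists_compl_level hG hz ha
  obtain ⟨θ, d, hθ, hθ0, hθ1, hθnn, hθm⟩ := exists_truncation hε
  have hθs : ∀ s, 𝒞 (deriv θ) s := fun s =>
    (contDiff_infty_iff_deriv.1 hθ).2.contDiffAt
  have hθs2 : ∀ s, 𝒞 (deriv (deriv θ)) s := fun s =>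
    (contDiff_infty_iff_deriv.1 (contDiff_infty_iff_deriv.1 hθ).2).2.contDiffAt
  have hd0 : ∀ s, s < ε → deriv θ s = 0 := fun s hs => by
    have : θ =ᶠ[𝓝 s] fun _ => 0 := by
      filter_upwards [gt_mem_nhds hs] with t ht using hθ0 t ht.le
    rw [this.deriv_eq, deriv_const]
  have hd1 : ∀ s, 2 * ε < s → deriv θ s = 1 := fun s hs => by
    have : θ =ᶠ[𝓝 s] fun t => t - d := by
      filter_upwards [lt_mem_nhds hs] with t ht using hθ1 t ht.le
    rw [this.deriv_eq, deriv_sub_const, deriv_id'']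
  obtain ⟨T, hT, hTc, hTO, hT0, -, -, hTpd⟩ :=
    hG.exists_level_cutoff hz hε zero_le_one hθs hd0 hd1 hθm
  obtain ⟨S, hS, hSc, hSO, hS0, hSeq, hSz, -⟩ :=
    hG.exists_level_cutoff hz hε le_rfl hθs2 (fun s hs => deriv2_zero_left hθ0 hs)
      (fun s hs => deriv2_zero_right hθ1 hs) hθnn
  have hSO' : tsupport S ⊆ Om l \ {z} := fun x hx =>
    ⟨hSO hx, fun e => by
      rw [mem_singleton_iff.1 e] at hx
      exact notMem_tsupport_iff_eventuallyEq.2 hSz hx⟩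
  have hSall : ∀ x ∈ Om l, S x = deriv (deriv θ) (g x) := fun x hx => by
    by_cases hxz : x = z
    · rw [hxz, hSz.self_of_nhds, deriv2_zero_left hθ0 ((hG.gr_self hz).trans hε)]
    · exact hSeq x hx hxz
  have hgs : ∀ x ∈ Om l \ {z}, 𝒞 g x := fun x hx => (hG.gr_harm hz).sm hx
  have hSint : ∀ Y : E → ℝ, Harm b (Om l) Y →
      Integrable (fun x => gip b g g x * Y x * S x) μ ∧ ∫ x, gip b g g x * Y x * S x ∂μ = Y z := by
    intro Y hY
    refine ⟨integrable_cs μ (fun x => (sm_mul_supp hS (fun x hx =>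
      (sm_gip b (hgs x (hSO' hx)) (hgs x (hSO' hx))).mul (hY.sm (hSO hx))) x).continuousAt)
      (cs_mul hSc), ?_⟩
    rw [← hG.mean hz hε hθ hθ0 hθ1 hY, ← setIntegral_eq_integral_of_forall_compl_eq_zero
      (s := Om l) fun x hx => ?_]
    · refine setIntegral_congr_fun hG.isOpen.measurableSet fun x hx => ?_
      rw [hSall x hx]
      ring
    · rw [image_eq_zero_of_notMem_tsupport fun h => hx (hSO h), mul_zero]
  obtain ⟨i1, e1⟩ := hSint _ hHh
  obtain ⟨i2, e2⟩ := hSint _ (Harm.const (Om l) δ)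
  have hflux := integral_flux_nonpos μ (b := b) hJ hT hTc hTO hT0 (hsl _ k1) (hsl _ k2)
  have iflux : Integrable (fun x => ∑ i, flux J f₁ f₂ (b i) x * pd (b i) T x) μ :=
    integrable_finsetSum _ fun i _ => integrable_mul_pd μ hT hTc hTO
      (fun x hx => sm_flux ((hsl _ k1).sm hx) ((hsl _ k2).sm hx) _) _
  have hle : ∫ x, -(gip b g g x * H x * S x) ∂μ ≤
      ∫ x, (2 * ∑ i, flux J f₁ f₂ (b i) x * pd (b i) T x) + gip b g g x * δ * S x ∂μ := by
    refine integral_mono i1.neg ((iflux.const_mul 2).add i2) fun x => ?_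
    dsimp only
    by_cases hx : x ∈ Om l
    · have hTsum : ∑ i, flux J f₁ f₂ (b i) x * pd (b i) T x =
          S x * ∑ i, flux J f₁ f₂ (b i) x * pd (b i) g x := by
        rw [Finset.mul_sum]
        refine Finset.sum_congr rfl fun i _ => ?_
        rw [hTpd x hx, hSall x hx]
        ring
      rw [hTsum]
      by_cases hS1 : S x = 0
      · simp [hS1]
      · have hxz : x ≠ z := fun e => hS1 (by rw [e, hSz.self_of_nhds])
        have hla : l x < a := by
          refine hεa x hx hxz (not_lt.1 fun h => hS1 ?_)
          rw [hSall x hx, deriv2_zero_right hθ1 h]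
        have := mul_le_mul_of_nonneg_left (hb x hx hla) (hS0 x)
        linarith
    · rw [image_eq_zero_of_notMem_tsupport fun h => hx (hSO h),
        Finset.sum_eq_zero fun i _ => ?_]
      · simp
      · rw [pd_eq_zero_of_notMem fun h => hx (hTO h), mul_zero]
  rw [integral_neg, e1, integral_add (iflux.const_mul 2) i2, integral_const_mul, e2] at hle
  linarith

theorem levi {z : E} (hz : z ∈ Om l) (w : E) :
    pd w (fun z => ψ z z) z ^ 2 + pd (J w) (fun z => ψ z z) z ^ 2 ≤
      ψ z z * (hess (fun z => ψ z z) z w w + hess (fun z => ψ z z) z (J w) (J w)) := by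
  have hpos := hG.psi_pos hz hz
  have hm : (m : ℝ) ≠ 0 := by exact_mod_cast (hG.m_pos.trans_lt' one_pos).ne'
  have hJ := hG.dom.J_sq
  have hO := hG.isOpen_prod
  set D₁ := pd w (fun z => ψ z z) z with hD1
  set D₂ := pd (J w) (fun z => ψ z z) z with hD2
  set Λ := ψ z z with hΛ
  have key := hG.levi_harm hz w (β₁ := -D₁ / Λ) (β₂ := -D₂ / Λ) (σ := -D₁ / Λ / (2 * m))
    (τ := D₂ / Λ / (2 * m)) (by field_simp) (by field_simp)
  have hs := hG.psi_smooth (p := (z, z)) hz hz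
  rw [op_op_diag hs, op_op_diag hs] at key
  dsimp only at key
  rw [← hD1, ← hD2, ← hΛ] at key
  have e : (-D₁ / Λ) ^ 2 * Λ + 2 * (-D₁ / Λ) * D₁ = -(D₁ ^ 2 / Λ) := by field_simp; ring
  have e' : (-D₂ / Λ) ^ 2 * Λ + 2 * (-D₂ / Λ) * D₂ = -(D₂ ^ 2 / Λ) := by field_simp; ring
  rw [e, e'] at key
  have := mul_nonneg hpos.le key
  have e2 : Λ * (D₁ ^ 2 / Λ) = D₁ ^ 2 := by field_simp
  have e3 : Λ * (D₂ ^ 2 / Λ) = D₂ ^ 2 := by field_simp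
  linarith
end GreenSys
end LeviInequality

section CircleMean

lemma hasDerivAt_integral_of_continuous {f f' : ℝ → ℝ → ℝ} (hf : ∀ t, Continuous (f t))
    (hf' : Continuous fun p : ℝ × ℝ => f' p.1 p.2) (h : ∀ t s, HasDerivAt (fun t => f t s) (f' t s) t)
    (a b t₀ : ℝ) :
    HasDerivAt (fun t => ∫ s in a..b, f t s) (∫ s in a..b, f' t₀ s) t₀ := by
  obtain ⟨C, hC⟩ := ((isCompact_Icc (a := t₀ - 1) (b := t₀ + 1)).prod
    (isCompact_uIcc (a := a) (b := b))).exists_bound_of_continuousOn hf'.continuousOn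
  refine (intervalIntegral.hasDerivAt_integral_of_dominated_loc_of_deriv_le (bound := fun _ => C)
    (F' := f') (Icc_mem_nhds (by linarith : t₀ - 1 < t₀) (by linarith : t₀ < t₀ + 1))
    (Eventually.of_forall fun t => (hf t).aestronglyMeasurable)
    ((hf t₀).intervalIntegrable _ _)
    (hf'.comp (by fun_prop : Continuous fun s => (t₀, s))).aestronglyMeasurable
    (Eventually.of_forall fun s hs t ht => hC (t, s) ⟨ht, uIoc_subset_uIcc hs⟩)
    intervalIntegrable_const (Eventually.of_forall fun s _ t _ => h t s)).2

variable {f : ℂ → ℝ}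

lemma hess_rotate (f : ℂ → ℝ) (p e : ℂ) (he : ‖e‖ = 1) :
    hess f p e e + hess f p (I * e) (I * e) = hess f p 1 1 + hess f p I I := by
  have h1 : e = e.re • (1 : ℂ) + e.im • I := by simp [re_add_im]
  have h2 : I * e = -e.im • (1 : ℂ) + e.re • I := by
    apply Complex.ext <;> simp
  have h3 : e.re ^ 2 + e.im ^ 2 = 1 := by
    have := Complex.sq_norm e
    rw [he, normSq_apply] at this; linarith
  have e1 : hess f p e e = hess f p (e.re • (1 : ℂ) + e.im • I) (e.re • (1 : ℂ) + e.im • I) := by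
    rw [← h1]
  rw [e1, h2]
  simp only [map_add, map_smul, _root_.add_apply, _root_.smul_apply, smul_eq_mul]
  linear_combination (hess f p 1 1 + hess f p I I) * h3

lemma hasDerivAt_expI (s : ℝ) :
    HasDerivAt (fun s : ℝ => Complex.exp (s * I)) (I * Complex.exp (s * I)) s := by
  have := ((hasDerivAt_id (s : ℂ)).mul_const I).cexp.comp_ofReal
  simpa [mul_comm] using this

/-- Quantitative sub-mean value inequality for smooth functions of one complex variable. -/
theorem add_le_circle_mean (hf : ∀ p, 𝒞 f p) {r κ : ℝ} (hr : 0 < r)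
    (hκ : ∀ p, ‖p‖ ≤ r → κ ≤ hess f p 1 1 + hess f p I I) :
    f 0 + κ * r ^ 2 / 4 ≤
      (2 * Real.pi)⁻¹ * ∫ s in (0 : ℝ)..(2 * Real.pi), f (r * Complex.exp (s * I)) := by
  have hπ := Real.pi_pos
  set e : ℝ → ℂ := fun s => Complex.exp (s * I) with he
  have hen : ∀ s, ‖e s‖ = 1 := fun s => norm_exp_ofReal_mul_I s
  have hec : Continuous e := by fun_prop
  have hed : ∀ s, HasDerivAt e (I * e s) s := hasDerivAt_expI
  have hfc : Continuous f := continuous_iff_continuousAt.2 fun p => (hf p).continuousAt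
  have hdc : Continuous (fderiv ℝ f) :=
    continuous_iff_continuousAt.2 fun p => (sm_fderiv (hf p)).continuousAt
  have hhc : Continuous (hess f) :=
    continuous_iff_continuousAt.2 fun p => (sm_hess (hf p)).continuousAt
  have hrad : ∀ t s, HasDerivAt (fun t : ℝ => (t : ℂ) * e s) (e s) t := fun t s => by
    simpa using (Complex.ofRealCLM.hasDerivAt (x := t)).mul_const (e s)
  set φ : ℝ → ℝ := fun t => ∫ s in (0 : ℝ)..(2 * Real.pi), f (t * e s) with hφ
  set φ₁ : ℝ → ℝ := fun t => ∫ s in (0 : ℝ)..(2 * Real.pi), fderiv ℝ f (t * e s) (e s) with hφ1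
  set φ₂ : ℝ → ℝ := fun t => ∫ s in (0 : ℝ)..(2 * Real.pi), hess f (t * e s) (e s) (e s) with hφ2
  set φ₃ : ℝ → ℝ := fun t =>
    ∫ s in (0 : ℝ)..(2 * Real.pi), hess f (t * e s) (I * e s) (I * e s) with hφ3
  have hd1 : ∀ t, HasDerivAt φ (φ₁ t) t := fun t => by
    refine hasDerivAt_integral_of_continuous (f := fun t s => f (t * e s))
      (f' := fun t s => fderiv ℝ f (t * e s) (e s)) (fun t => by fun_prop) (by fun_prop)
      (fun t s => ?_) _ _ _
    exact (sm_diff (hf _)).hasFDerivAt.comp_hasDerivAt t (hrad t s)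
  have hd2 : ∀ t, HasDerivAt φ₁ (φ₂ t) t := fun t => by
    refine hasDerivAt_integral_of_continuous (f := fun t s => fderiv ℝ f (t * e s) (e s))
      (f' := fun t s => hess f (t * e s) (e s) (e s)) (fun t => by fun_prop) (by fun_prop)
      (fun t s => ?_) _ _ _
    have := ((sm_diff (sm_fderiv (hf _))).hasFDerivAt.comp_hasDerivAt t (hrad t s)).clm_apply
      (hasDerivAt_const t (e s))
    simpa [hess] using this
  have hpar : ∀ t, t * φ₃ t - φ₁ t = 0 := fun t => by
    have hder : ∀ s, HasDerivAt (fun s : ℝ => fderiv ℝ f (t * e s) (I * e s))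
        (t * hess f (t * e s) (I * e s) (I * e s) - fderiv ℝ f (t * e s) (e s)) s := fun s => by
      have h1 : HasDerivAt (fun s => (t : ℂ) * e s) (t * (I * e s)) s := (hed s).const_mul _
      have := ((sm_diff (sm_fderiv (hf _))).hasFDerivAt.comp_hasDerivAt s h1).clm_apply
        ((hed s).const_mul I)
      refine this.congr_deriv ?_
      have e1 : (t : ℂ) * (I * e s) = t • (I * e s) := by simp
      have e2 : I * (I * e s) = - e s := by rw [← mul_assoc, I_mul_I]; ring
      rw [e1, e2, map_neg, map_smul]
      simp [hess, sub_eq_add_neg]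
    have hi := intervalIntegral.integral_eq_sub_of_hasDerivAt (a := 0) (b := 2 * Real.pi)
      (fun s _ => hder s) (Continuous.intervalIntegrable (by fun_prop) _ _)
    rw [intervalIntegral.integral_sub (Continuous.intervalIntegrable (by fun_prop) _ _)
      (Continuous.intervalIntegrable (by fun_prop) _ _), intervalIntegral.integral_const_mul] at hi
    have e0 : e (2 * Real.pi) = e 0 := by simp [he, exp_two_pi_mul_I]
    rw [e0, sub_self] at hi
    exact hi
  have hsum : ∀ t, 0 ≤ t → t ≤ r → 2 * Real.pi * κ ≤ φ₂ t + φ₃ t := fun t h0 h1 => by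
    rw [hφ2, hφ3]
    dsimp only
    rw [← intervalIntegral.integral_add (Continuous.intervalIntegrable (by fun_prop) _ _)
      (Continuous.intervalIntegrable (by fun_prop) _ _)]
    have := intervalIntegral.integral_mono_on (μ := volume) (a := 0) (b := 2 * Real.pi)
      (by positivity) (f := fun _ => κ)
      (g := fun s => hess f (t * e s) (e s) (e s) + hess f (t * e s) (I * e s) (I * e s))
      intervalIntegrable_const (Continuous.intervalIntegrable (by fun_prop) _ _) fun s _ => by
        rw [hess_rotate f _ _ (hen s)]
        refine hκ _ ?_
        rw [norm_mul, hen, mul_one, norm_real, Real.norm_of_nonneg h0]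
        exact h1
    rwa [intervalIntegral.integral_const, sub_zero, smul_eq_mul] at this
  have hmono1 : MonotoneOn (fun t => t * φ₁ t - Real.pi * κ * t ^ 2) (Icc 0 r) := by
    have hD : ∀ t, HasDerivAt (fun t => t * φ₁ t - Real.pi * κ * t ^ 2)
        (1 * φ₁ t + t * φ₂ t - Real.pi * κ * (2 * t)) t := fun t => by
      refine ((hasDerivAt_id t).mul (hd2 t)).sub (HasDerivAt.const_mul _ ?_)
      simpa using hasDerivAt_pow 2 t
    refine monotoneOn_of_deriv_nonneg (convex_Icc _ _)
      (fun t _ => (hD t).continuousAt.continuousWithinAt)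
      (fun t _ => (hD t).differentiableAt.differentiableWithinAt) fun t ht => ?_
    rw [interior_Icc] at ht
    rw [(hD t).deriv]
    have := mul_le_mul_of_nonneg_left (hsum t ht.1.le ht.2.le) ht.1.le
    linarith [hpar t]
  have hφ1nn : ∀ t, 0 < t → t ≤ r → Real.pi * κ * t ≤ φ₁ t := fun t h0 h1 => by
    have := hmono1 ⟨le_rfl, hr.le⟩ ⟨h0.le, h1⟩ h0.le
    simp only [zero_mul, ne_eq, OfNat.ofNat_ne_zero, not_false_eq_true, zero_pow, mul_zero,
      sub_zero] at this
    refine le_of_mul_le_mul_left ?_ h0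
    linarith
  have hmono2 : MonotoneOn (fun t => φ t - Real.pi * κ / 2 * t ^ 2) (Icc 0 r) := by
    have hD : ∀ t, HasDerivAt (fun t => φ t - Real.pi * κ / 2 * t ^ 2)
        (φ₁ t - Real.pi * κ / 2 * (2 * t)) t := fun t => by
      refine (hd1 t).sub (HasDerivAt.const_mul _ ?_)
      simpa using hasDerivAt_pow 2 t
    refine monotoneOn_of_deriv_nonneg (convex_Icc _ _)
      (fun t _ => (hD t).continuousAt.continuousWithinAt)
      (fun t _ => (hD t).differentiableAt.differentiableWithinAt) fun t ht => ?_
    rw [interior_Icc] at ht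
    rw [(hD t).deriv]
    linarith [hφ1nn t ht.1 ht.2.le]
  have hfin := hmono2 ⟨le_rfl, hr.le⟩ ⟨hr.le, le_rfl⟩ hr.le
  have h0 : φ 0 = 2 * Real.pi * f 0 := by simp [hφ]
  dsimp only at hfin
  rw [h0] at hfin
  change _ ≤ (2 * Real.pi)⁻¹ * φ r
  rw [← mul_le_mul_iff_right₀ (by positivity : 0 < 2 * Real.pi), ← mul_assoc,
    mul_inv_cancel₀ (by positivity), one_mul]
  linarith
end CircleMean

section Plurisubharmonic

variable {n : ℕ} {u : Cn n → ℝ} {z w : Cn n}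

lemma continuous_disc (z w : Cn n) : Continuous fun a : ℂ => z + a • w := by fun_prop

lemma pd_disc {a : ℂ} (hu : DifferentiableAt ℝ u (z + a • w)) (v : ℂ) :
    pd v (fun a : ℂ => u (z + a • w)) a = pd (v • w) u (z + a • w) := by
  set L : ℂ →L[ℝ] Cn n := ((1 : ℂ →L[ℂ] ℂ).smulRight w).restrictScalars ℝ with hL
  have hL' : HasFDerivAt (fun a : ℂ => z + a • w) L a := (L.hasFDerivAt (x := a)).const_add z
  have := (hu.hasFDerivAt.comp a hL').fderiv
  change fderiv ℝ (u ∘ fun a : ℂ => z + a • w) a v = _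
  rw [this]
  simp [pd, hL]

lemma sm_disc {a : ℂ} (hu : 𝒞 u (z + a • w)) : 𝒞 (fun a : ℂ => u (z + a • w)) a := by
  have h : 𝒞 (fun a : ℂ => z + a • w) a := by fun_prop
  exact ContDiffAt.comp (g := u) (f := fun a : ℂ => z + a • w) a hu h

lemma hess_disc {a : ℂ} (hu : 𝒞 u (z + a • w)) (v v' : ℂ) :
    hess (fun a : ℂ => u (z + a • w)) a v v' = hess u (z + a • w) (v • w) (v' • w) := by
  rw [← pd_pd (sm_disc hu), ← pd_pd hu]
  have h : pd v' (fun a : ℂ => u (z + a • w)) =ᶠ[𝓝 a] fun a => pd (v' • w) u (z + a • w) := by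
    filter_upwards [(continuous_disc z w).continuousAt.eventually (sm_ev hu)] with b hb
    exact pd_disc hb v'
  rw [pd_congr h]
  exact pd_disc (sm_diff (sm_pd hu _)) v

lemma hess_congr {u u' : Cn n → ℝ} {x : Cn n} (h : u =ᶠ[𝓝 x] u') : hess u x = hess u' x :=
  h.fderiv.fderiv_eq

/-- Sub-mean value inequality on discs from a lower bound for the Levi form. -/
theorem add_le_mean_of_levi {O : Set (Cn n)} (hO : IsOpen O) (hu : ∀ x ∈ O, 𝒞 u x) {r κ : ℝ}
    (hr : 0 < r) (hd : ∀ a : ℂ, ‖a‖ ≤ r → z + a • w ∈ O)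
    (hκ : ∀ x ∈ O, κ ≤ hess u x w w + hess u x (I • w) (I • w)) :
    u z + κ * r ^ 2 / 4 ≤ (2 * Real.pi)⁻¹ *
      ∫ θ in (0 : ℝ)..(2 * Real.pi), u (z + ((r : ℂ) * Complex.exp (θ * I)) • w) := by
  set C := (fun a : ℂ => z + a • w) '' Metric.closedBall 0 r with hC
  have hCc : IsCompact C := (isCompact_closedBall _ _).image (continuous_disc z w)
  have hmem : ∀ a : ℂ, ‖a‖ ≤ r → z + a • w ∈ C := fun a ha =>
    ⟨a, by simpa using ha, rfl⟩
  obtain ⟨η, hη, -, hηO, hη1, -⟩ := exists_cutoff hCc hO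
    (by rintro _ ⟨a, ha, rfl⟩; exact hd a (by simpa using ha))
  set U : Cn n → ℝ := fun x => u x * η x with hU
  have hUs : ∀ x, 𝒞 U x := fun x => sm_mul_supp hη (fun x hx => hu x (hηO hx)) x
  have hUu : ∀ x ∈ C, U =ᶠ[𝓝 x] u := fun x hx => by
    filter_upwards [hη1 x hx] with y hy
    simp [hU, hy]
  have key := add_le_circle_mean (f := fun a : ℂ => U (z + a • w)) (κ := κ)
    (fun a => sm_disc (hUs _)) hr fun a ha => by
      rw [hess_disc (hUs _), hess_disc (hUs _), hess_congr (hUu _ (hmem a ha)), one_smul]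
      exact hκ _ (hd a ha)
  have h0 := (hUu _ (hmem 0 (by simpa using hr.le))).eq_of_nhds
  rw [h0] at key
  simp only [zero_smul, add_zero] at key
  refine key.trans_eq ?_
  congr 1
  refine intervalIntegral.integral_congr fun θ _ => ?_
  refine (hUu _ (hmem _ ?_)).eq_of_nhds
  rw [norm_mul, norm_exp_ofReal_mul_I, mul_one, norm_real, Real.norm_of_nonneg hr.le]

lemma norm_circle {r : ℝ} (hr : 0 ≤ r) (θ : ℝ) : ‖(r : ℂ) * Complex.exp (θ * I)‖ ≤ r := by
  rw [norm_mul, norm_exp_ofReal_mul_I, mul_one, norm_real, Real.norm_of_nonneg hr]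

lemma continuous_circle {O : Set (Cn n)} (hu : ∀ x ∈ O, 𝒞 u x) {r : ℝ}
    (hr : 0 < r) (hd : ∀ a : ℂ, ‖a‖ ≤ r → z + a • w ∈ O) :
    Continuous fun θ : ℝ => u (z + ((r : ℂ) * Complex.exp (θ * I)) • w) := by
  refine continuous_iff_continuousAt.2 fun θ => ?_
  have h1 := (hu _ (hd _ (norm_circle hr.le θ))).continuousAt
  have h2 : ContinuousAt (fun θ : ℝ => z + ((r : ℂ) * Complex.exp (θ * I)) • w) θ := by fun_prop
  exact ContinuousAt.comp (g := u) h1 h2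

theorem levi_of_psh {W : Set (Cn n)} (hW : IsOpen W) (hu : ∀ x ∈ W, 𝒞 u x) (hpsh : PshOn u W)
    {x : Cn n} (hx : x ∈ W) (w : Cn n) : 0 ≤ hess u x w w + hess u x (I • w) (I • w) := by
  by_contra! hneg
  set L := hess u x w w + hess u x (I • w) (I • w) with hL
  have hcont : ContinuousAt (fun y => hess u y w w + hess u y (I • w) (I • w)) x := by
    have := (sm_hess (hu x hx)).continuousAt
    fun_prop
  obtain ⟨O, hO, hOo, hxO⟩ := _root_.eventually_nhds_iff.1 ((hW.eventually_mem hx).and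
    (hcont.eventually (gt_mem_nhds (by linarith : L < L / 2))))
  have hdisc : ∀ᶠ a : ℂ in 𝓝 0, x + a • w ∈ O :=
    (continuous_disc x w).continuousAt.eventually (hOo.mem_nhds (by simpa using hxO))
  obtain ⟨ρ, hρ, hball⟩ := Metric.eventually_nhds_iff.1 hdisc
  have hd : ∀ a : ℂ, ‖a‖ ≤ ρ / 2 → x + a • w ∈ O := fun a ha => by
    refine hball ?_
    rw [dist_zero_right]; linarith
  have hus : ∀ y ∈ O, 𝒞 u y := fun y hy => hu y (hO y hy).1
  have h1 := add_le_mean_of_levi (u := fun y => - u y) (κ := -(L / 2)) hOo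
    (fun y hy => (hus y hy).neg) (half_pos hρ) hd fun y hy => by
      have e : hess (fun y => - u y) y = - hess u y := by
        have : fderiv ℝ (fun y => - u y) = fun y => - fderiv ℝ u y := by
          ext1 y; exact fderiv_neg
        unfold hess
        rw [this]
        exact fderiv_neg
      rw [e]
      have := (hO y hy).2
      simp only [_root_.neg_apply]
      linarith
  have h2 := hpsh.2 x hx w (ρ / 2) (half_pos hρ) (fun a ha => (hO _ (hd a ha)).1) _
    (continuous_circle hus (half_pos hρ) hd) (fun θ => le_rfl)
  rw [EReal.coe_le_coe_iff] at h2
  rw [intervalIntegral.integral_neg] at h1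
  have : 0 < -(L / 2) * (ρ / 2) ^ 2 / 4 := by
    have : 0 < -(L / 2) := by linarith
    positivity
  linarith

lemma hess_log {x : Cn n} (hu : 𝒞 u x) (hpos : 0 < u x) (v : Cn n) :
    hess (fun y => Real.log (u y)) x v v = hess u x v v / u x - pd v u x ^ 2 / u x ^ 2 := by
  have hl : 𝒞 (fun y => Real.log (u y)) x := hu.log hpos.ne'
  rw [← pd_pd hl, ← pd_pd hu]
  have h : pd v (fun y => Real.log (u y)) =ᶠ[𝓝 x] fun y => (u y)⁻¹ * pd v u y := by
    filter_upwards [sm_ev hu, hu.continuousAt.eventually (lt_mem_nhds hpos)] with y hy hy0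
    rw [pd_comp (Real.differentiableAt_log hy0.ne') hy, Real.deriv_log]
  rw [pd_congr h, pd_mul (u := fun y => (u y)⁻¹) (sm_diff (hu.inv hpos.ne')) (sm_diff (sm_pd hu v)),
    pd_comp (φ := fun t => t⁻¹) (differentiableAt_inv hpos.ne') (sm_diff hu)]
  simp only [deriv_inv]
  field_simp
  ring

theorem log_psh_of_levi {O : Set (Cn n)} (hO : IsOpen O) (hu : ∀ x ∈ O, 𝒞 u x)
    (hpos : ∀ x ∈ O, 0 < u x)
    (hlevi : ∀ x ∈ O, ∀ w, pd w u x ^ 2 + pd (I • w) u x ^ 2 ≤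
      u x * (hess u x w w + hess u x (I • w) (I • w))) :
    PlurisubharmonicOn (fun z => elog (u z)) O := by
  have hls : ∀ x ∈ O, 𝒞 (fun y => Real.log (u y)) x := fun x hx => (hu x hx).log (hpos x hx).ne'
  have hel : ∀ x ∈ O, elog (u x) = (Real.log (u x) : EReal) := fun x hx => if_pos (hpos x hx)
  refine ⟨?_, fun z hz w r hr hd h hh hle => ?_⟩
  · have : ContinuousOn (fun z => (Real.log (u z) : EReal)) O := fun x hx =>
      (continuous_coe_real_ereal.continuousAt.comp (hls x hx).continuousAt).continuousWithinAt
    exact (this.congr hel).upperSemicontinuousOn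
  · have key := add_le_mean_of_levi (z := z) (w := w) (κ := 0) hO hls hr hd fun x hx => by
      have hx0 := hpos x hx
      rw [hess_log (hu x hx) hx0, hess_log (hu x hx) hx0]
      have e : hess u x w w / u x - pd w u x ^ 2 / u x ^ 2 +
          (hess u x (I • w) (I • w) / u x - pd (I • w) u x ^ 2 / u x ^ 2) =
          (u x * (hess u x w w + hess u x (I • w) (I • w)) -
            (pd w u x ^ 2 + pd (I • w) u x ^ 2)) / u x ^ 2 := by
        field_simp; ring
      rw [e]
      exact div_nonneg (sub_nonneg.2 (hlevi x hx w)) (sq_nonneg _)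
    dsimp only
    rw [hel z hz, EReal.coe_le_coe_iff]
    have hmono : ∫ θ in (0 : ℝ)..(2 * Real.pi),
        Real.log (u (z + ((r : ℂ) * Complex.exp (θ * I)) • w)) ≤
        ∫ θ in (0 : ℝ)..(2 * Real.pi), h θ :=
      intervalIntegral.integral_mono Real.two_pi_pos.le
        ((continuous_circle hls hr hd).intervalIntegrable _ _) (hh.intervalIntegrable _ _)
        fun θ => by
          have := hle θ
          dsimp only at this
          rwa [hel _ (hd _ (norm_circle hr.le θ)), EReal.coe_le_coe_iff] at this
    have := mul_le_mul_of_nonneg_left hmono (inv_nonneg.2 Real.two_pi_pos.le)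
    linarith

end Plurisubharmonic

section Robin

variable {n : ℕ}

lemma isAddHaarMeasure_volume_Cn (n : ℕ) : (volume : Measure (Cn n)).IsAddHaarMeasure := by
  change (Measure.map (EuclideanSpace.equiv (Fin n) ℂ).symm volume).IsAddHaarMeasure
  infer_instance

/-- Multiplication by the imaginary unit as a real isometry. -/
def mulI (n : ℕ) : Cn n ≃ₗᵢ[ℝ] Cn n where
  toFun x := I • x
  invFun x := -(I • x)
  map_add' := smul_add I
  map_smul' a x := smul_comm I a x
  left_inv x := by simp [smul_smul]
  right_inv x := by simp [smul_smul]
  norm_map' x := by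
    change ‖I • x‖ = ‖x‖
    rw [norm_smul, norm_I, one_mul]

lemma mulI_apply (x : Cn n) : mulI n x = I • x := rfl

/-- The standard real orthonormal basis of `ℂⁿ`. -/
def realBasis (n : ℕ) : OrthonormalBasis ((_ : Fin n) × Fin 2) ℝ (Cn n) :=
  Pi.orthonormalBasis fun _ => Complex.orthonormalBasisOneI

lemma Lap_realBasis {u : Cn n → ℝ} {x : Cn n} (hu : 𝒞 u x) :
    Lap (realBasis n) u x = laplacianC u x := by
  rw [Lap_hess _ hu, Fintype.sum_sigma, laplacianC]
  refine Finset.sum_congr rfl fun j _ => ?_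
  rw [Fin.sum_univ_two]
  simp only [realBasis, Pi.orthonormalBasis_apply, Complex.coe_orthonormalBasisOneI,
    iteratedFDeriv_two_apply]
  rfl

/-- A smoothly bounded pseudoconvex domain is defined by a compactly supported smooth function. -/
lemma SmoothlyBoundedPseudoconvex.exists_dom {Ω : Set (Cn n)}
    (hΩ : SmoothlyBoundedPseudoconvex n Ω) (hconn : IsPreconnected Ω) :
    ∃ l : Cn n → ℝ, Om l = Ω ∧ Dom (realBasis n) (mulI n) l := by
  obtain ⟨-, hbdd, r, W, hW, hcl, hr, hpsh, hΩeq, hgrad⟩ := hΩ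
  have hrs : ∀ x ∈ W, 𝒞 r x := fun x hx => (hr x hx).contDiffAt (hW.mem_nhds hx)
  have hC : IsCompact (closure Ω) := hbdd.isCompact_closure
  obtain ⟨η, hη, hηc, hηW, hη1, hηI⟩ := exists_cutoff hC hW hcl
  set l : Cn n → ℝ := fun x => -r x * η x with hl
  have hls : ∀ x, 𝒞 l x := fun x =>
    sm_mul_supp (Γ := fun x => - r x) hη (fun x hx => (hrs x (hηW hx)).neg) x
  have hlr : ∀ x ∈ closure Ω, l =ᶠ[𝓝 x] fun x => - r x := fun x hx => by
    filter_upwards [hη1 x hx] with y hy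
    simp [hl, hy]
  have hOm : Om l = Ω := by
    ext x
    refine ⟨fun hx => ?_, fun hx => ?_⟩
    · have hx0 : 0 < -r x * η x := hx
      have hxs : x ∈ tsupport η := subset_tsupport _ (right_ne_zero_of_mul hx0.ne')
      have : 0 < - r x := pos_of_mul_pos_left hx0 (hηI x).1
      rw [hΩeq]
      exact ⟨hηW hxs, by linarith⟩
    · have h1 : l x = - r x := (hlr x (subset_closure hx)).eq_of_nhds
      rw [hΩeq] at hx
      have := hx.2
      change 0 < l x
      linarith
  have hlc : Continuous l := continuous_iff_continuousAt.2 fun x => (hls x).continuousAt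
  have hgc : Continuous (gip (realBasis n) l l) :=
    continuous_iff_continuousAt.2 fun x => (sm_gip _ (hls x) (hls x)).continuousAt
  have hΩo : IsOpen Ω := by
    rw [← hOm]; exact isOpen_lt continuous_const hlc
  have hgf : ∀ x ∈ frontier Ω, 0 < gip (realBasis n) l l x := fun x hx => by
    refine lt_of_le_of_ne (gip_self_nonneg _ _ _) fun h0 => hgrad x hx ?_
    have h1 : ∀ i, pd (realBasis n i) l x = 0 := fun i => by
      have := (Finset.sum_eq_zero_iff_of_nonneg fun i _ => mul_self_nonneg _).1 h0.symm i
        (Finset.mem_univ i)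
      exact mul_self_eq_zero.1 this
    have h2 : fderiv ℝ l x = 0 := by
      ext v
      rw [← sum_inner_smul (realBasis n) v, map_sum]
      refine Finset.sum_eq_zero fun i _ => ?_
      rw [map_smul]
      exact smul_eq_zero_of_right _ (h1 i)
    rw [(hlr x hx.1).fderiv_eq, fderiv_fun_neg, neg_eq_zero] at h2
    exact h2
  refine ⟨l, hOm, fun x => ?_, hls, hηc.mul_left, hOm ▸ hconn, fun x hx v => ?_, ?_⟩
  · rw [mulI_apply, mulI_apply, smul_smul, I_mul_I, neg_smul, one_smul]
  · rw [hOm] at hx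
    have hxc := subset_closure hx
    have := levi_of_psh hW hrs hpsh (hcl hxc) v
    have e : hess l x = - hess r x := by
      rw [hess_congr (hlr x hxc)]
      have : fderiv ℝ (fun y => - r y) = fun y => - fderiv ℝ r y := by
        ext1 y; exact fderiv_fun_neg
      unfold hess
      rw [this]
      exact fderiv_fun_neg
    rw [e]
    simp only [_root_.neg_apply, mulI_apply]
    linarith
  · obtain ⟨a, ha, ha'⟩ := (hC.inter_right (isClosed_le hgc continuous_const :
      IsClosed {x | gip (realBasis n) l l x ≤ 0})).exists_forall_le' hlc.continuousOn (a := 0)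
      fun x hx => by
        have : x ∈ Om l := by
          rw [hOm]
          by_contra hxΩ
          have := hgf x ⟨hx.1, by rwa [hΩo.interior_eq]⟩
          exact absurd hx.2 (not_le.2 this)
        exact this
    obtain ⟨c, hc, hc'⟩ := (hC.inter_right (isClosed_le hlc continuous_const :
      IsClosed {x | l x ≤ a / 2})).exists_forall_le' hgc.continuousOn (a := 0)
      fun x hx => by
        by_contra! h0
        have h1 := ha' x ⟨hx.1, h0⟩
        have h2 : l x ≤ a / 2 := hx.2
        linarith
    exact ⟨a / 2, half_pos ha, c, hc, fun x hx hxa =>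
      hc' x ⟨subset_closure (hOm ▸ hx), hxa⟩⟩

/-- A Green function is uniformly small near the boundary. -/
lemma IsGreenFunction.small {Ω : Set (Cn n)} {z : Cn n} {g : Cn n → ℝ}
    (hg : IsGreenFunction Ω z g) (hbdd : Bornology.IsBounded Ω) {l : Cn n → ℝ}
    (hl : Continuous l) (hOm : Om l = Ω) (hz : z ∈ Ω) {ε : ℝ} (hε : 0 < ε) :
    ∃ s > 0, ∀ x ∈ Ω, l x < s → x ≠ z ∧ |g x| ≤ ε := by
  have hΩo : IsOpen Ω := by
    rw [← hOm]; exact isOpen_lt continuous_const hl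
  have hpos : ∀ x ∈ Ω, 0 < l x := fun x hx => by rw [← hOm] at hx; exact hx
  obtain ⟨ρ, hρ, hb⟩ := Metric.nhds_basis_closedBall.mem_iff.1 (hΩo.mem_nhds hz)
  set K := closure Ω ∩ (ball z ρ)ᶜ with hK
  have hKc : IsCompact K := hbdd.isCompact_closure.inter_right isOpen_ball.isClosed_compl
  have hgK : ContinuousOn (fun x => |g x|) K := (hg.1.mono fun x hx => ⟨hx.1, fun h => hx.2 (by
    rw [mem_singleton_iff.1 h]; exact mem_ball_self hρ)⟩).abs
  have hS : IsCompact (K ∩ (fun x => |g x|) ⁻¹' Ici ε) :=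
    hKc.of_isClosed_subset (hgK.preimage_isClosed_of_isClosed hKc.isClosed isClosed_Ici)
      inter_subset_left
  obtain ⟨s₁, hs₁, h₁⟩ := hS.exists_forall_le' hl.continuousOn (a := 0) fun x hx => by
    refine hpos x ?_
    by_contra hxΩ
    have h0 := hg.2.1 x ⟨hx.1.1, by rwa [hΩo.interior_eq]⟩
    have h1 : ε ≤ |g x| := hx.2
    rw [h0, abs_zero] at h1
    linarith
  obtain ⟨s₂, hs₂, h₂⟩ := (isCompact_closedBall z ρ).exists_forall_le' hl.continuousOn (a := 0)
    fun x hx => hpos x (hb hx)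
  refine ⟨min s₁ s₂, lt_min hs₁ hs₂, fun x hx hxs => ?_⟩
  have hxb : x ∉ ball z ρ := fun h =>
    (h₂ x (ball_subset_closedBall h)).not_gt (hxs.trans_le (min_le_right _ _))
  refine ⟨fun h => hxb (h ▸ mem_ball_self hρ), ?_⟩
  by_contra! h
  exact (h₁ x ⟨⟨subset_closure hx, hxb⟩, h.le⟩).not_gt (hxs.trans_le (min_le_left _ _))

end Robin

/-- **Log-plurisubharmonicity of the Robin function** (Section 7).  Let `Ω ⊆ ℂⁿ`, `n > 1`, be
a smoothly bounded pseudoconvex domain, write its Green function as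
`G(z,ζ) = -c_n/|z-ζ|^{2n-2} + ψ(z,ζ)` with `ψ(z,·)` harmonic, where `c_n` is the constant
making `-c_n/|ζ|^{2n-2}` the fundamental solution of the Laplacian in `ℝ²ⁿ`, and let
`Λ(z) = ψ(z,z)` be the Robin function.  Then `log Λ` is plurisubharmonic on `Ω`. -/
theorem log_robin_psh (n : ℕ) (hn : 1 < n) (Ω : Set (Cn n))
    (hΩ : SmoothlyBoundedPseudoconvex n Ω) (hΩconn : IsConnected Ω)
    (hΩpsc : Pseudoconvex Ω)
    (c : ℝ) (hc : 0 < c)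
    (hfund : ∀ w : Cn n → ℝ, ContDiff ℝ (⊤ : ℕ∞) w → HasCompactSupport w →
      (∫ ζ, (-(c / ‖ζ‖ ^ (2 * n - 2))) * laplacianC w ζ) = w 0)
    (G : Cn n → Cn n → ℝ) (hG : ∀ z ∈ Ω, IsGreenFunction Ω z (G z))
    (ψ : Cn n → Cn n → ℝ)
    (hψG : ∀ z ∈ Ω, ∀ ζ ∈ Ω, ζ ≠ z → G z ζ = -(c / ‖z - ζ‖ ^ (2 * n - 2)) + ψ z ζ)
    (hψharm : ∀ z ∈ Ω, ContDiffOn ℝ (⊤ : ℕ∞) (ψ z) Ω ∧ ∀ ζ ∈ Ω, laplacianC (ψ z) ζ = 0) :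
    PlurisubharmonicOn (fun z => elog (ψ z z)) Ω := by
  have hhaar := isAddHaarMeasure_volume_Cn n
  have hne : Nonempty (Fin n) := ⟨⟨0, by omega⟩⟩
  have hΩo : IsOpen Ω := hΩ.1
  obtain ⟨m, rfl⟩ : ∃ m, n = m + 1 := ⟨n - 1, by omega⟩
  have hexp : 2 * (m + 1) - 2 = 2 * m := by omega
  rw [hexp] at hfund hψG
  obtain ⟨l, hOm, hdom⟩ := hΩ.exists_dom hΩconn.isPreconnected
  have hGK : ∀ z ∈ Ω, ∀ x ∈ Ω, x ≠ z → G z x = -(fundK c m (x - z) - ψ z x) :=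
    fun z hz x hx hxz => by
      rw [hψG z hz x hx hxz, fundK, norm_sub_rev]; ring
  have hsys : GreenSys (realBasis (m + 1)) (mulI (m + 1)) volume l c m ψ := by
    refine ⟨hdom, hc, by omega, by simp; ring, fun w hw hwc => ?_, ?_, ?_, ?_⟩
    · rw [← hfund w hw hwc]
      refine integral_congr_ae (Eventually.of_forall fun x => ?_)
      dsimp only
      rw [Lap_realBasis hw.contDiffAt, fundK]
    · rw [hOm]
      intro z hz x hx
      have := (hψharm z hz).1.contDiffAt (hΩo.mem_nhds hx)
      exact ⟨this, by rw [Lap_realBasis this, (hψharm z hz).2 x hx]⟩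
    · rw [hOm]
      intro z hz ε hε
      obtain ⟨s, hs, h⟩ := (hG z hz).small hΩ.2.1 hdom.cont hOm hz hε
      refine ⟨s, hs, fun x hx hxs => ?_⟩
      obtain ⟨hxz, hle⟩ := h x hx hxs
      rwa [hGK z hz x hx hxz, abs_neg] at hle
    · rw [hOm]
      intro z hz w hw hwc hwΩ
      rw [← (hG z hz).2.2 w hw hwc hwΩ,
        ← setIntegral_eq_integral_of_forall_compl_eq_zero (s := Ω) fun x hx => by
          rw [image_eq_zero_of_notMem_tsupport
            fun h => hx (hwΩ (tsupport_Lap_subset (realBasis (m + 1)) w h)), mul_zero]]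
      refine setIntegral_congr_ae hΩo.measurableSet ?_
      have hz0 : ∀ᵐ x : Cn (m + 1), x ≠ z := by
        simp [ae_iff]
      filter_upwards [hz0] with x hxz hx
      rw [hGK z hz x hx hxz, Lap_realBasis hw.contDiffAt]
  rw [← hOm]
  refine log_psh_of_levi (u := fun z => ψ z z) hsys.isOpen (fun x hx => ?_)
    (fun x hx => hsys.psi_pos hx hx) fun x hx w => hsys.levi hx w
  exact sm_diag (u := fun p : Cn (m + 1) × Cn (m + 1) => ψ p.1 p.2) (hsys.psi_smooth hx hx)

end Berndtsson
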